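/- arXiv:1710.08308 — 3 statements merged into one kernel-verified Lean document; each statement's English description precedes it below -/
import Mathlib

section
/- Lemma 6 (invertibility of the sampled Gram matrix, elementwise-sampling). Let δ > 0 and suppose γ := √(8dμ(S)·log(2d/δ)/(3m)) < 1. Then with probability at least 1 − δ, the d × d matrix U_Ωᵀ U_Ω is invertible and ‖(U_Ωᵀ U_Ω)⁻¹‖ ≤ N/((1−γ)·m), where ‖·‖ is the operator (spectral) norm. -/
open Matrix
open scoped BigOperators

/-- The operator (spectral) norm of a square real matrix. -/
noncomputable def realMatrixOpNorm {n : ℕ} (M : Matrix (Fin n) (Fin n) ℝ) : ℝ :=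
  ‖Matrix.toEuclideanCLM (𝕜 := ℝ) M‖

section aux

/-- The quadratic form of a matrix at `u`, as a linear functional in the matrix. -/
noncomputable def qf {n : ℕ} (u : Fin n → ℝ) : Matrix (Fin n) (Fin n) ℝ →ₗ[ℝ] ℝ where
  toFun M := u ⬝ᵥ M *ᵥ u
  map_add' A B := by simp [add_mulVec, dotProduct_add]
  map_smul' c A := by simp [smul_mulVec, dotProduct_smul]

variable {n : ℕ}

lemma qf_apply (u : Fin n → ℝ) (M : Matrix (Fin n) (Fin n) ℝ) : qf u M = u ⬝ᵥ M *ᵥ u := rfl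

lemma qf_mid (u : Fin n → ℝ) (A B : Matrix (Fin n) (Fin n) ℝ) :
    qf u (A * vecMulVec u u * B) = qf u A * qf u B := by
  simp only [qf_apply]
  rw [← mulVec_mulVec, ← mulVec_mulVec, vecMulVec_mulVec]
  simp [mulVec_smul, dotProduct_smul, mul_comm]

lemma trace_mul_P (u : Fin n → ℝ) (A : Matrix (Fin n) (Fin n) ℝ) :
    (A * vecMulVec u u).trace = qf u A := by
  rw [mul_vecMulVec, trace_vecMulVec, qf_apply, dotProduct_comm]

lemma qf_nonneg (u : Fin n → ℝ) {A : Matrix (Fin n) (Fin n) ℝ} (hA : A.PosSemidef) :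
    0 ≤ qf u A := by
  simpa [qf_apply] using hA.dotProduct_mulVec_nonneg u

lemma qf_spec' (u : Fin n → ℝ) {X : Matrix (Fin n) (Fin n) ℝ} (hX : X.IsHermitian) :
    ∃ w : Fin n → ℝ, (∀ a, 0 ≤ w a) ∧
      ∀ k : ℕ, qf u (X ^ k) = ∑ a, w a * hX.eigenvalues a ^ k := by
  let V : Matrix (Fin n) (Fin n) ℝ := hX.eigenvectorUnitary
  refine ⟨fun a => ((star V) *ᵥ u) a ^ 2, fun a => sq_nonneg _, fun k => ?_⟩
  have h := hX.spectral_theorem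
  have hk : X ^ k = V * diagonal (fun a => hX.eigenvalues a ^ k) * star V := by
    conv_lhs => rw [h]
    rw [← map_pow, diagonal_pow, Unitary.conjStarAlgAut_apply]
    rfl
  rw [qf_apply, hk, ← mulVec_mulVec, ← mulVec_mulVec, dotProduct_mulVec, ← mulVec_transpose]
  have : Vᵀ = star V := by simp [star_eq_conjTranspose]
  rw [this, dotProduct]
  refine Finset.sum_congr rfl fun a _ => ?_
  rw [mulVec_diagonal]; ring

lemma qf_spec (u : Fin n → ℝ) {X : Matrix (Fin n) (Fin n) ℝ} (hX : X.PosSemidef) :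
    ∃ w l : Fin n → ℝ, (∀ a, 0 ≤ w a) ∧ (∀ a, 0 ≤ l a) ∧
      ∀ k : ℕ, qf u (X ^ k) = ∑ a, w a * l a ^ k := by
  obtain ⟨w, hw, h⟩ := qf_spec' u hX.isHermitian
  exact ⟨w, _, hw, fun a => hX.eigenvalues_nonneg a, h⟩

lemma qf_cheb0 (u : Fin n → ℝ) {X : Matrix (Fin n) (Fin n) ℝ} (hX : X.PosSemidef) (i j : ℕ) :
    qf u (X ^ j) * qf u (X ^ i) ≤ qf u 1 * qf u (X ^ (i + j)) := by
  obtain ⟨w, l, hw, hl, h⟩ := qf_spec u hX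
  rw [← pow_zero X, h, h, h, h]
  have key : 0 ≤ ∑ a, ∑ b, w a * w b * ((l a ^ j - l b ^ j) * (l a ^ i - l b ^ i)) := by
    refine Finset.sum_nonneg fun a _ => Finset.sum_nonneg fun b _ => ?_
    refine mul_nonneg (mul_nonneg (hw a) (hw b)) ?_
    rcases le_total (l a) (l b) with hab | hab
    · exact mul_nonneg_of_nonpos_of_nonpos (sub_nonpos.2 (pow_le_pow_left₀ (hl a) hab _))
        (sub_nonpos.2 (pow_le_pow_left₀ (hl a) hab _))
    · exact mul_nonneg (sub_nonneg.2 (pow_le_pow_left₀ (hl b) hab _))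
        (sub_nonneg.2 (pow_le_pow_left₀ (hl b) hab _))
  have e : ∑ a, ∑ b, w a * w b * ((l a ^ j - l b ^ j) * (l a ^ i - l b ^ i))
      = (∑ a, w a * l a ^ (i + j)) * (∑ b, w b * l b ^ 0)
        - (∑ a, w a * l a ^ j) * (∑ b, w b * l b ^ i)
        - (∑ a, w a * l a ^ i) * (∑ b, w b * l b ^ j)
        + (∑ a, w a * l a ^ 0) * (∑ b, w b * l b ^ (i + j)) := by
    simp only [Finset.sum_mul_sum, ← Finset.sum_sub_distrib, ← Finset.sum_add_distrib]
    refine Finset.sum_congr rfl fun a _ => Finset.sum_congr rfl fun b _ => ?_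
    ring
  rw [e] at key
  linarith

lemma qf_cheb (u : Fin n → ℝ) {X : Matrix (Fin n) (Fin n) ℝ} (hX : X.PosSemidef) {c : ℝ}
    (hc : 0 ≤ c) (k i j : ℕ) :
    qf u (X ^ j) * qf u ((X + c • 1) ^ k * X ^ i)
      ≤ qf u 1 * qf u ((X + c • 1) ^ k * X ^ (i + j)) := by
  induction k generalizing i with
  | zero => simpa using qf_cheb0 u hX i j
  | succ k ih =>
    have e : ∀ p, (X + c • (1 : Matrix (Fin n) (Fin n) ℝ)) ^ (k + 1) * X ^ p
        = (X + c • 1) ^ k * X ^ (p + 1) + c • ((X + c • 1) ^ k * X ^ p) := by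
      intro p
      rw [pow_succ, mul_assoc, add_mul, ← pow_succ', mul_add]
      simp
    rw [e, e, map_add, map_add, map_smul, map_smul]
    have h1 := ih (i + 1)
    have h2 := mul_le_mul_of_nonneg_left (ih i) hc
    rw [show i + 1 + j = i + j + 1 by ring] at h1
    simp only [smul_eq_mul]
    linarith

lemma qf_B_pow (u : Fin n → ℝ) {X : Matrix (Fin n) (Fin n) ℝ} (hX : X.PosSemidef) {t : ℝ}
    (ht : 0 ≤ t) (k j : ℕ) :
    qf u ((X + t • vecMulVec u u) ^ k * X ^ j) ≤ qf u ((X + (t * qf u 1) • 1) ^ k * X ^ j) := by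
  induction k generalizing j with
  | zero => simp
  | succ k ih =>
    have hs : 0 ≤ qf u 1 := qf_nonneg u PosSemidef.one
    have e1 : (X + t • vecMulVec u u) ^ (k + 1) * X ^ j
        = (X + t • vecMulVec u u) ^ k * X ^ (j + 1)
          + t • ((X + t • vecMulVec u u) ^ k * vecMulVec u u * X ^ j) := by
      rw [pow_succ, mul_assoc, add_mul, ← pow_succ', mul_add]
      simp [mul_assoc]
    have e2 : (X + (t * qf u 1) • (1 : Matrix (Fin n) (Fin n) ℝ)) ^ (k + 1) * X ^ j
        = (X + (t * qf u 1) • 1) ^ k * X ^ (j + 1)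
          + (t * qf u 1) • ((X + (t * qf u 1) • 1) ^ k * X ^ j) := by
      rw [pow_succ, mul_assoc, add_mul, ← pow_succ', mul_add]
      simp
    rw [e1, e2, map_add, map_add, map_smul, map_smul, qf_mid, smul_eq_mul, smul_eq_mul]
    have h1 := ih (j + 1)
    have h2 := ih 0
    simp only [pow_zero, mul_one] at h2
    have h3 := qf_cheb u hX (mul_nonneg ht hs) k 0 j
    simp only [pow_zero, mul_one, zero_add] at h3
    have h4 : 0 ≤ qf u (X ^ j) := qf_nonneg u (hX.pow j)
    have h5 := mul_le_mul_of_nonneg_right h2 h4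
    have h6 := mul_le_mul_of_nonneg_left (h5.trans ((mul_comm _ _).trans_le h3)) ht
    linarith

lemma P_psd (u : Fin n → ℝ) : (vecMulVec u u).PosSemidef := by
  simpa using posSemidef_vecMulVec_self_star u

lemma XP_psd (u : Fin n → ℝ) {X : Matrix (Fin n) (Fin n) ℝ} (hX : X.PosSemidef) {t : ℝ}
    (ht : 0 ≤ t) : (X + t • vecMulVec u u).PosSemidef :=
  hX.add ((P_psd u).smul ht)

lemma qf_A_pow0 (u : Fin n → ℝ) {X : Matrix (Fin n) (Fin n) ℝ} (hX : X.PosSemidef) {t : ℝ}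
    (ht : 0 ≤ t) (i j : ℕ) :
    qf u (X ^ (i + j)) ≤ qf u (X ^ i * (X + t • vecMulVec u u) ^ j) := by
  induction j generalizing i with
  | zero => simp
  | succ j ih =>
    have e : X ^ i * (X + t • vecMulVec u u) ^ (j + 1)
        = X ^ (i + 1) * (X + t • vecMulVec u u) ^ j
          + t • (X ^ i * vecMulVec u u * (X + t • vecMulVec u u) ^ j) := by
      rw [pow_succ', ← mul_assoc, mul_add, ← pow_succ, add_mul]
      simp
    rw [e, map_add, map_smul, qf_mid, smul_eq_mul]
    have h1 := ih (i + 1)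
    rw [show i + 1 + j = i + (j + 1) by ring] at h1
    have h2 : 0 ≤ t * (qf u (X ^ i) * qf u ((X + t • vecMulVec u u) ^ j)) :=
      mul_nonneg ht (mul_nonneg (qf_nonneg u (hX.pow i)) (qf_nonneg u ((XP_psd u hX ht).pow j)))
    linarith

lemma tr_A_pow (u : Fin n → ℝ) {X : Matrix (Fin n) (Fin n) ℝ} (hX : X.PosSemidef) {t : ℝ}
    (ht : 0 ≤ t) (i k : ℕ) :
    (X ^ (i + k)).trace + k * (t * qf u (X ^ (i + k - 1)))
      ≤ (X ^ i * (X + t • vecMulVec u u) ^ k).trace := by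
  induction k generalizing i with
  | zero => simp
  | succ k ih =>
    have e : X ^ i * (X + t • vecMulVec u u) ^ (k + 1)
        = X ^ (i + 1) * (X + t • vecMulVec u u) ^ k
          + t • (X ^ i * vecMulVec u u * (X + t • vecMulVec u u) ^ k) := by
      rw [pow_succ', ← mul_assoc, mul_add, ← pow_succ, add_mul]
      simp
    have e2 : (X ^ i * vecMulVec u u * (X + t • vecMulVec u u) ^ k).trace
        = qf u ((X + t • vecMulVec u u) ^ k * X ^ i) := by
      rw [trace_mul_comm, ← mul_assoc, trace_mul_P]
    have e3 : qf u ((X + t • vecMulVec u u) ^ k * X ^ i)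
        = qf u (X ^ i * (X + t • vecMulVec u u) ^ k) := by
      have h1 : ((X + t • vecMulVec u u) ^ k)ᵀ = (X + t • vecMulVec u u) ^ k := by
        simpa using ((XP_psd u hX ht).pow k).isHermitian.eq
      have h2 : (X ^ i)ᵀ = X ^ i := by simpa using (hX.pow i).isHermitian.eq
      rw [← h1, ← h2, ← transpose_mul, qf_apply, qf_apply, mulVec_transpose, dotProduct_comm,
        ← dotProduct_mulVec, h1, h2]
    rw [e, trace_add, trace_smul, e2, e3, smul_eq_mul]
    have h1 := ih (i + 1)
    have h2 := mul_le_mul_of_nonneg_left (qf_A_pow0 u hX ht i k) ht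
    rw [show i + 1 + k = i + k + 1 by ring, Nat.add_sub_cancel] at h1
    rw [show i + (k + 1) = i + k + 1 by ring, Nat.add_sub_cancel]
    push_cast
    linarith

open scoped Matrix.Norms.L2Operator in
lemma hasSum_lin (φ : Matrix (Fin n) (Fin n) ℝ →ₗ[ℝ] ℝ) (X : Matrix (Fin n) (Fin n) ℝ) :
    HasSum (fun k : ℕ => ((k.factorial : ℝ)⁻¹) * φ (X ^ k)) (φ (NormedSpace.exp X)) := by
  have h := NormedSpace.exp_series_hasSum_exp' (𝕂 := ℝ) X
  have hc : Continuous φ := LinearMap.continuous_of_finiteDimensional φ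
  have := h.map φ.toAddMonoidHom hc
  have e : (fun k : ℕ => ((k.factorial : ℝ)⁻¹) * φ (X ^ k))
      = φ.toAddMonoidHom ∘ fun k : ℕ => ((k.factorial : ℝ)⁻¹) • X ^ k := by
    funext k; simp
  rw [e]
  exact this

lemma exp_shift (X : Matrix (Fin n) (Fin n) ℝ) (c : ℝ) :
    NormedSpace.exp (X + c • (1 : Matrix (Fin n) (Fin n) ℝ))
      = Real.exp c • NormedSpace.exp X := by
  rw [Matrix.exp_add_of_commute _ _ ((Commute.one_right X).smul_right c), smul_one_eq_diagonal,
    exp_diagonal]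
  have : NormedSpace.exp (fun _ : Fin n => c) = fun _ => Real.exp c := by
    funext i
    rw [Pi.coe_exp, Real.exp_eq_exp_ℝ]
  rw [this, ← smul_one_eq_diagonal]
  simp

lemma qf_B (u : Fin n → ℝ) {X : Matrix (Fin n) (Fin n) ℝ} (hX : X.PosSemidef) {t : ℝ}
    (ht : 0 ≤ t) :
    qf u (NormedSpace.exp (X + t • vecMulVec u u))
      ≤ Real.exp (t * qf u 1) * qf u (NormedSpace.exp X) := by
  have h := hasSum_le (fun k => ?_) (hasSum_lin (qf u) (X + t • vecMulVec u u))
    (hasSum_lin (qf u) (X + (t * qf u 1) • 1))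
  · rwa [exp_shift, map_smul, smul_eq_mul] at h
  · have := qf_B_pow u hX ht k 0
    simp only [pow_zero, mul_one] at this
    gcongr

lemma tr_A (u : Fin n → ℝ) {X : Matrix (Fin n) (Fin n) ℝ} (hX : X.PosSemidef) {t : ℝ}
    (ht : 0 ≤ t) :
    (NormedSpace.exp X).trace + t * qf u (NormedSpace.exp X)
      ≤ (NormedSpace.exp (X + t • vecMulVec u u)).trace := by
  have h1 := hasSum_lin (traceLinearMap (Fin n) ℝ ℝ) X
  have h2 := hasSum_lin (traceLinearMap (Fin n) ℝ ℝ) (X + t • vecMulVec u u)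
  have h3 : HasSum (fun k : ℕ => ((k.factorial : ℝ)⁻¹) * (k * (t * qf u (X ^ (k - 1)))))
      (t * qf u (NormedSpace.exp X)) := by
    have := (hasSum_lin (qf u) X).mul_left t
    rw [← hasSum_nat_add_iff' 1]
    simp only [Finset.range_one, Finset.sum_singleton, Nat.cast_zero, zero_mul, mul_zero, sub_zero]
    have e : (fun k : ℕ => (((k + 1).factorial : ℝ)⁻¹)
          * (((k + 1 : ℕ) : ℝ) * (t * qf u (X ^ (k + 1 - 1)))))
        = fun k : ℕ => t * (((k.factorial : ℝ)⁻¹) * qf u (X ^ k)) := by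
      funext k
      rw [Nat.factorial_succ, Nat.add_sub_cancel]
      push_cast
      have : (k : ℝ) + 1 ≠ 0 := by positivity
      have : (k.factorial : ℝ) ≠ 0 := by positivity
      field_simp
    rw [e]
    exact this
  have := hasSum_le (fun k => ?_) (h1.add h3) h2
  · simpa using this
  · have := tr_A_pow u hX ht 0 k
    simp only [pow_zero, one_mul, zero_add] at this
    simp only [traceLinearMap_apply]
    rw [← mul_add]
    gcongr

lemma exp_psd {X : Matrix (Fin n) (Fin n) ℝ} (hX : X.IsHermitian) :
    (NormedSpace.exp X).PosSemidef := by
  have : X = (1/2 : ℝ) • X + (1/2 : ℝ) • X := by rw [← add_smul]; norm_num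
  rw [this, Matrix.exp_add_of_commute _ _ (Commute.refl _)]
  have h : ((1/2 : ℝ) • X).IsHermitian := by
    rw [IsHermitian, conjTranspose_smul, hX.eq]; simp
  have h2 := h.exp
  nth_rewrite 1 [← h2.eq]
  exact posSemidef_conjTranspose_mul_self _

lemma step (u : Fin n → ℝ) {X : Matrix (Fin n) (Fin n) ℝ} (hX : X.PosSemidef) {t : ℝ}
    (ht : 0 ≤ t) :
    (NormedSpace.exp X).trace
      ≤ (NormedSpace.exp (X + t • vecMulVec u u)).trace
        - (t - 2 / 3 * t ^ 2 * qf u 1) * qf u (NormedSpace.exp (X + t • vecMulVec u u)) := by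
  set h := t / 3 with hh
  have hh0 : 0 ≤ h := by positivity
  set P := vecMulVec u u with hP
  have e1 : X + h • P + h • P = X + (2 * h) • P := by rw [add_assoc, ← add_smul]; ring_nf
  have e2 : X + (2 * h) • P + h • P = X + t • P := by
    rw [add_assoc, ← add_smul]; congr 2; rw [hh]; ring
  have e3 : X + h • P + (2 * h) • P = X + t • P := by
    rw [add_assoc, ← add_smul]; congr 2; rw [hh]; ring
  have p1 := XP_psd u hX hh0
  have p2 := XP_psd u hX (t := 2 * h) (by positivity)
  have a0 := tr_A u hX hh0
  have a1 := tr_A u p1 hh0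
  have a2 := tr_A u p2 hh0
  have b0 := qf_B u hX ht
  have b1 := qf_B u p1 (t := 2 * h) (by positivity)
  have b2 := qf_B u p2 hh0
  rw [← hP] at a0 a1 a2 b0 b1 b2
  rw [e1] at a1
  rw [e2] at a2 b2
  rw [e3] at b1
  have hf : 0 ≤ qf u (NormedSpace.exp (X + t • P)) :=
    qf_nonneg u (exp_psd (XP_psd u hX ht).isHermitian)
  have key : ∀ x f g : ℝ, 0 ≤ f → f ≤ Real.exp x * g → (1 - x) * f ≤ g := by
    intro x f g hf hfg
    have h1 : 1 - x ≤ Real.exp (-x) := by linarith [Real.add_one_le_exp (-x)]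
    calc (1 - x) * f ≤ Real.exp (-x) * f := by gcongr
      _ ≤ Real.exp (-x) * (Real.exp x * g) := by gcongr
      _ = g := by rw [← mul_assoc, ← Real.exp_add]; simp
  have k0 := mul_le_mul_of_nonneg_left (key _ _ _ hf b0) hh0
  have k1 := mul_le_mul_of_nonneg_left (key _ _ _ hf b1) hh0
  have k2 := mul_le_mul_of_nonneg_left (key _ _ _ hf b2) hh0
  have ht3 : t = 3 * h := by rw [hh]; ring
  generalize NormedSpace.exp (X + t • P) = E at *
  rw [ht3] at k0 ⊢
  linarith

lemma trace_exp {X : Matrix (Fin n) (Fin n) ℝ} (hX : X.IsHermitian) :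
    (NormedSpace.exp X).trace = ∑ a, Real.exp (hX.eigenvalues a) := by
  let V := hX.eigenvectorUnitary
  have h : X = V * diagonal hX.eigenvalues * (V : Matrix (Fin n) (Fin n) ℝ)⁻¹ := by
    have h := hX.spectral_theorem
    rw [Unitary.conjStarAlgAut_apply] at h
    have h2 : (V : Matrix (Fin n) (Fin n) ℝ)⁻¹ = star (V : Matrix (Fin n) (Fin n) ℝ) :=
      Matrix.inv_eq_left_inv (Unitary.coe_star_mul_self V)
    rw [h2]
    exact h
  have hV : IsUnit (V : Matrix (Fin n) (Fin n) ℝ) :=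
    ⟨⟨V, star V, Unitary.coe_mul_star_self V, Unitary.coe_star_mul_self V⟩, rfl⟩
  conv_lhs => rw [h]
  rw [Matrix.exp_conj _ _ hV, trace_mul_comm, ← mul_assoc, Matrix.nonsing_inv_mul, one_mul,
    exp_diagonal, trace_diagonal]
  · refine Finset.sum_congr rfl fun a _ => ?_
    rw [Pi.coe_exp, Real.exp_eq_exp_ℝ]
  · exact (Matrix.isUnit_iff_isUnit_det _).1 hV

lemma trace_exp_ge (v : Fin n → ℝ) {X : Matrix (Fin n) (Fin n) ℝ} (hX : X.IsHermitian) {l : ℝ}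
    (hv : 0 < qf v 1) (h : l * qf v 1 ≤ qf v X) :
    Real.exp l ≤ (NormedSpace.exp X).trace := by
  obtain ⟨w, hw, hs⟩ := qf_spec' v hX
  have h0 := hs 0
  have h1 := hs 1
  simp only [pow_zero, pow_one, mul_one] at h0 h1
  have : ∃ a, l ≤ hX.eigenvalues a := by
    by_contra! hc
    have hpos : ∃ a ∈ Finset.univ, 0 < w a := by
      by_contra! hc2
      have := Finset.sum_nonpos hc2
      linarith
    obtain ⟨a, _, ha⟩ := hpos
    have : ∑ a, w a * hX.eigenvalues a < ∑ a, w a * l :=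
      Finset.sum_lt_sum (fun b _ => mul_le_mul_of_nonneg_left (hc b).le (hw b))
        ⟨a, Finset.mem_univ _, mul_lt_mul_of_pos_left (hc a) ha⟩
    rw [← Finset.sum_mul, ← h0, ← h1] at this
    linarith
  obtain ⟨a, ha⟩ := this
  rw [trace_exp hX]
  exact (Real.exp_le_exp.2 ha).trans
    (Finset.single_le_sum (f := fun a => Real.exp (hX.eigenvalues a))
      (fun b _ => (Real.exp_pos _).le) (Finset.mem_univ a))

lemma qf_one (u : Fin n → ℝ) : qf u 1 = ∑ a, u a ^ 2 := by
  simp [qf_apply, dotProduct, sq]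

lemma qf_P (v u : Fin n → ℝ) : qf v (vecMulVec u u) = (∑ a, u a * v a) ^ 2 := by
  rw [qf_apply, vecMulVec_mulVec]
  have h1 : v ⬝ᵥ u = ∑ a, u a * v a := by simp [dotProduct, mul_comm]
  have h2 : u ⬝ᵥ v = ∑ a, u a * v a := rfl
  rw [h2]
  simp [dotProduct_smul, h1, sq]

lemma LP_psd (u : Fin n → ℝ) {L : ℝ} (hL : qf u 1 ≤ L) :
    (L • (1 : Matrix (Fin n) (Fin n) ℝ) - vecMulVec u u).PosSemidef := by
  refine PosSemidef.of_dotProduct_mulVec_nonneg ?_ fun x => ?_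
  · refine IsHermitian.sub ?_ (P_psd u).isHermitian
    rw [IsHermitian, conjTranspose_smul]; simp
  · have : 0 ≤ qf x (L • (1 : Matrix (Fin n) (Fin n) ℝ) - vecMulVec u u) := by
      rw [map_sub, map_smul, qf_P, smul_eq_mul]
      have h1 := Finset.sum_mul_sq_le_sq_mul_sq Finset.univ u x
      rw [← qf_one, ← qf_one] at h1
      have h2 := mul_le_mul_of_nonneg_right hL (qf_nonneg x PosSemidef.one)
      linarith
    simpa [qf_apply] using this

/-- The exponent matrix of the Laplace-transform argument. -/
noncomputable def HH {N m : ℕ} (r : Fin N → Fin n → ℝ) (t L : ℝ) (ω : Fin m → Fin N) :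
    Matrix (Fin n) (Fin n) ℝ :=
  ∑ k, t • (L • (1 : Matrix (Fin n) (Fin n) ℝ) - vecMulVec (r (ω k)) (r (ω k)))

lemma HH_psd {N m : ℕ} (r : Fin N → Fin n → ℝ) {t L : ℝ} (ht : 0 ≤ t)
    (hL : ∀ i, qf (r i) 1 ≤ L) (ω : Fin m → Fin N) : (HH r t L ω).PosSemidef :=
  posSemidef_sum _ fun _ _ => (LP_psd _ (hL _)).smul ht

lemma one_step {N : ℕ} (hN : 0 < N) (r : Fin N → Fin n → ℝ) {t L : ℝ} (ht : 0 ≤ t)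
    (hL : ∀ i, qf (r i) 1 ≤ L) (hr : ∑ i, vecMulVec (r i) (r i) = 1)
    {H : Matrix (Fin n) (Fin n) ℝ} (hH : H.PosSemidef) :
    ∑ i, (NormedSpace.exp (t • (L • (1 : Matrix (Fin n) (Fin n) ℝ) - vecMulVec (r i) (r i))
        + H)).trace
      ≤ N * Real.exp (t * L - (t - 2 / 3 * t ^ 2 * L) / N) * (NormedSpace.exp H).trace := by
  set κ := t - 2 / 3 * t ^ 2 * L with hκ
  have hE := exp_psd hH.isHermitian
  have h1 : ∀ i, (NormedSpace.exp (t • (L • (1 : Matrix (Fin n) (Fin n) ℝ)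
      - vecMulVec (r i) (r i)) + H)).trace
      ≤ Real.exp (t * L) * ((NormedSpace.exp H).trace - κ * qf (r i) (NormedSpace.exp H)) := by
    intro i
    have hs := step (r i) (((LP_psd (r i) (hL i)).smul ht).add hH) ht
    have e : t • (L • (1 : Matrix (Fin n) (Fin n) ℝ) - vecMulVec (r i) (r i)) + H
        + t • vecMulVec (r i) (r i) = H + (t * L) • 1 := by
      rw [smul_sub, smul_smul]; abel
    rw [e, exp_shift, map_smul, trace_smul, smul_eq_mul, smul_eq_mul] at hs
    refine hs.trans ?_
    have h2 : κ ≤ t - 2 / 3 * t ^ 2 * qf (r i) 1 := by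
      rw [hκ]
      have := mul_le_mul_of_nonneg_left (hL i) (by positivity : 0 ≤ 2 / 3 * t ^ 2)
      linarith
    have h3 := mul_le_mul_of_nonneg_right h2
      (mul_nonneg (Real.exp_pos (t * L)).le (qf_nonneg (r i) hE))
    linarith
  refine (Finset.sum_le_sum fun i _ => h1 i).trans ?_
  have h2 : ∑ i, qf (r i) (NormedSpace.exp H) = (NormedSpace.exp H).trace := by
    simp_rw [← trace_mul_P]
    rw [← trace_sum, ← Finset.mul_sum, hr, mul_one]
  rw [← Finset.mul_sum, Finset.sum_sub_distrib, ← Finset.mul_sum, h2]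
  simp only [Finset.sum_const, Finset.card_univ, Fintype.card_fin, nsmul_eq_mul]
  have hN' : (0 : ℝ) < N := by exact_mod_cast hN
  have h3 : 1 - κ / N ≤ Real.exp (-(κ / N)) := by linarith [Real.add_one_le_exp (-(κ / N))]
  have h4 := mul_le_mul_of_nonneg_left h3
    (mul_nonneg (mul_nonneg hN'.le (Real.exp_pos (t * L)).le) hE.trace_nonneg)
  rw [sub_eq_add_neg (t * L), Real.exp_add]
  have h5 : (N : ℝ) * (κ / N) = κ := by field_simp
  calc _ = (N : ℝ) * Real.exp (t * L) * (NormedSpace.exp H).trace * (1 - κ / N) := by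
        linear_combination -(Real.exp (t * L) * (NormedSpace.exp H).trace) * h5.symm
    _ ≤ _ := h4
    _ = _ := by ring

lemma expect_bound {N : ℕ} (hN : 0 < N) (r : Fin N → Fin n → ℝ) {t L : ℝ} (ht : 0 ≤ t)
    (hL : ∀ i, qf (r i) 1 ≤ L) (hr : ∑ i, vecMulVec (r i) (r i) = 1) (m : ℕ) :
    ∑ ω : Fin m → Fin N, (NormedSpace.exp (HH r t L ω)).trace
      ≤ n * (N * Real.exp (t * L - (t - 2 / 3 * t ^ 2 * L) / N)) ^ m := by
  induction m with
  | zero => simp [HH, NormedSpace.exp_zero]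
  | succ m ih =>
    rw [← (Fin.consEquiv (fun _ => Fin N)).sum_comp, Fintype.sum_prod_type_right]
    have : ∀ ω : Fin m → Fin N, ∑ i : Fin N,
        (NormedSpace.exp (HH r t L ((Fin.consEquiv (fun _ => Fin N)) (i, ω)))).trace
        ≤ N * Real.exp (t * L - (t - 2 / 3 * t ^ 2 * L) / N)
          * (NormedSpace.exp (HH r t L ω)).trace := by
      intro ω
      refine le_of_eq_of_le ?_ (one_step hN r ht hL hr (HH_psd r ht hL ω))
      refine Finset.sum_congr rfl fun i _ => ?_
      congr 2
      rw [HH, Fin.sum_univ_succ]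
      simp [HH, Fin.consEquiv]
    refine (Finset.sum_le_sum fun ω _ => this ω).trans ?_
    rw [← Finset.mul_sum, pow_succ' _ m]
    have h := mul_le_mul_of_nonneg_left ih
      (by positivity : 0 ≤ N * Real.exp (t * L - (t - 2 / 3 * t ^ 2 * L) / N))
    refine h.trans (le_of_eq ?_)
    ring

lemma good_of {G : Matrix (Fin n) (Fin n) ℝ} {a : ℝ} (ha : 0 < a)
    (h : ∀ v, a * qf v 1 ≤ qf v G) :
    IsUnit G ∧ realMatrixOpNorm G⁻¹ ≤ 1 / a := by
  have hinj : Function.Injective G.mulVec := by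
    intro x y hxy
    have h1 := h (x - y)
    have h2 : G *ᵥ (x - y) = 0 := by rw [mulVec_sub, sub_eq_zero]; exact hxy
    rw [qf_apply (x - y) G, h2, dotProduct_zero, qf_one] at h1
    have h3 : ∑ b, (x - y) b ^ 2 = 0 :=
      le_antisymm (by nlinarith) (Finset.sum_nonneg fun _ _ => sq_nonneg _)
    rw [Finset.sum_eq_zero_iff_of_nonneg (fun _ _ => sq_nonneg _)] at h3
    funext b
    have := h3 b (Finset.mem_univ _)
    have := pow_eq_zero_iff (two_ne_zero) |>.1 this
    simpa [sub_eq_zero] using this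
  have hu : IsUnit G := Matrix.mulVec_injective_iff_isUnit.1 hinj
  refine ⟨hu, ?_⟩
  rw [realMatrixOpNorm]
  refine ContinuousLinearMap.opNorm_le_bound _ (by positivity) fun x => ?_
  set y := Matrix.toEuclideanCLM (𝕜 := ℝ) G⁻¹ x with hy
  have hGy : Matrix.toEuclideanCLM (𝕜 := ℝ) G y = x := by
    have hm : Matrix.toEuclideanCLM (𝕜 := ℝ) G * Matrix.toEuclideanCLM (𝕜 := ℝ) G⁻¹ = 1 := by
      rw [← map_mul, Matrix.mul_nonsing_inv _ ((Matrix.isUnit_iff_isUnit_det _).1 hu), map_one]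
    rw [hy, ← mul_apply_eq_comp, hm]; rfl
  have h1 := h y.ofLp
  rw [qf_apply _ G, ← inner_toEuclideanCLM, hGy, qf_one, ← EuclideanSpace.real_norm_sq_eq] at h1
  have h2 := real_inner_le_norm y x
  rw [div_mul_eq_mul_div, one_mul, le_div_iff₀ ha]
  rcases (norm_nonneg y).eq_or_lt with h0 | h0
  · rw [← h0]; simp
  · have : ‖y‖ * (‖y‖ * a) ≤ ‖y‖ * ‖x‖ := by nlinarith
    exact le_of_mul_le_mul_left this h0

end aux

/-- **Lemma 6 (invertibility of the sampled Gram matrix, elementwise-sampling).**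
Sampling with replacement is modeled by the uniform distribution on the finite
sample space `Fin m → Fin N`, probabilities being `#(event) / N ^ m`. -/
theorem elementwise_sampling_gram_invertibility
    (N d m : ℕ) (hN : 0 < N) (hd : 0 < d) (hdN : d ≤ N) (hm : 0 < m)
    (δ : ℝ) (hδ : 0 < δ)
    (U : Matrix (Fin N) (Fin d) ℝ)
    (hU : Uᵀ * U = 1)
    (μS : ℝ)
    (hμS : IsGreatest
      (Set.range fun i : Fin N => (N / d : ℝ) * ∑ j, ((U * Uᵀ) j i) ^ 2) μS)
    (γ : ℝ)
    (hγ : γ = Real.sqrt (8 * d * μS * Real.log (2 * d / δ) / (3 * m)))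
    (hγ1 : γ < 1) :
    1 - δ ≤
      (Set.ncard {ω : Fin m → Fin N |
        let UΩ : Matrix (Fin m) (Fin d) ℝ := Matrix.of fun k l => U (ω k) l
        let G : Matrix (Fin d) (Fin d) ℝ := UΩᵀ * UΩ
        IsUnit G ∧ realMatrixOpNorm G⁻¹ ≤ N / ((1 - γ) * m)} : ℝ) / (N : ℝ) ^ m := by
  have hN' : (0 : ℝ) < N := by exact_mod_cast hN
  have hd' : (0 : ℝ) < d := by exact_mod_cast hd
  have hd1 : (1 : ℝ) ≤ d := by exact_mod_cast hd
  have hm' : (0 : ℝ) < m := by exact_mod_cast hm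
  rcases le_or_gt 1 δ with hδ1 | hδ1
  · have : (0 : ℝ) ≤ (Set.ncard {ω : Fin m → Fin N |
        let UΩ : Matrix (Fin m) (Fin d) ℝ := Matrix.of fun k l => U (ω k) l
        let G : Matrix (Fin d) (Fin d) ℝ := UΩᵀ * UΩ
        IsUnit G ∧ realMatrixOpNorm G⁻¹ ≤ N / ((1 - γ) * m)} : ℝ) / (N : ℝ) ^ m := by positivity
    linarith
  -- the rows
  set r : Fin N → Fin d → ℝ := fun i => U i with hr
  have hsum : ∑ i, vecMulVec (r i) (r i) = 1 := by
    rw [← hU]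
    ext a b
    simp [Matrix.sum_apply, vecMulVec_apply, Matrix.mul_apply, hr]
  have hrow : ∀ i, ∑ j, ((U * Uᵀ) j i) ^ 2 = qf (r i) 1 := by
    intro i
    have h1 : (U * Uᵀ)ᵀ * (U * Uᵀ) = U * Uᵀ := by
      rw [transpose_mul, transpose_transpose, Matrix.mul_assoc, ← Matrix.mul_assoc Uᵀ, hU,
        Matrix.one_mul]
    have h2 : ((U * Uᵀ)ᵀ * (U * Uᵀ)) i i = (U * Uᵀ) i i := by rw [h1]
    rw [Matrix.mul_apply] at h2
    rw [qf_one]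
    simp only [transpose_apply, ← sq] at h2
    rw [h2, Matrix.mul_apply]
    simp [hr, sq]
  set L : ℝ := d * μS / N with hLdef
  have hL : ∀ i, qf (r i) 1 ≤ L := by
    intro i
    have h1 : (N / d : ℝ) * ∑ j, ((U * Uᵀ) j i) ^ 2 ≤ μS := hμS.2 ⟨i, rfl⟩
    rw [hrow] at h1
    rw [hLdef, le_div_iff₀ hN']
    have h2 := mul_le_mul_of_nonneg_left h1 hd'.le
    have h3 : (d : ℝ) * (N / d * qf (r i) 1) = qf (r i) 1 * N := by field_simp
    linarith
  have htr : ∑ i, qf (r i) 1 = d := by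
    have h1 := congrArg Matrix.trace hsum
    rw [trace_sum] at h1
    simp only [trace_one, Fintype.card_fin] at h1
    rw [← h1]
    refine Finset.sum_congr rfl fun i _ => ?_
    rw [← trace_mul_P, Matrix.one_mul]
  have hNL : N * L = d * μS := by rw [hLdef]; field_simp
  have hLpos : 0 < L := by
    have h1 : ∑ i : Fin N, qf (r i) 1 ≤ ∑ _i : Fin N, L := Finset.sum_le_sum fun i _ => hL i
    rw [htr] at h1
    simp only [Finset.sum_const, Finset.card_univ, Fintype.card_fin, nsmul_eq_mul] at h1
    by_contra hc
    have := mul_nonpos_of_nonneg_of_nonpos hN'.le (not_lt.1 hc)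
    linarith
  have hμpos : 0 < d * μS := by rw [← hNL]; positivity
  have hlog : 0 < Real.log (2 * d / δ) := by
    apply Real.log_pos
    rw [lt_div_iff₀ hδ]; linarith
  have harg : 0 < 8 * d * μS * Real.log (2 * d / δ) / (3 * m) := by
    have : 0 < 8 * (d * μS) * Real.log (2 * d / δ) / (3 * m) := by positivity
    rwa [← mul_assoc] at this
  have hγ0 : 0 < γ := by rw [hγ]; exact Real.sqrt_pos.2 harg
  have hγ2 : γ ^ 2 = 8 * d * μS * Real.log (2 * d / δ) / (3 * m) := by
    rw [hγ]; exact Real.sq_sqrt harg.le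
  set t : ℝ := 3 * γ / (4 * L) with htdef
  have ht : 0 < t := by positivity
  set a : ℝ := (1 - γ) * m / N with hadef
  have h1γ : 0 < 1 - γ := by linarith
  have ha : 0 < a := by positivity
  set good : Set (Fin m → Fin N) := {ω : Fin m → Fin N |
        let UΩ : Matrix (Fin m) (Fin d) ℝ := Matrix.of fun k l => U (ω k) l
        let G : Matrix (Fin d) (Fin d) ℝ := UΩᵀ * UΩ
        IsUnit G ∧ realMatrixOpNorm G⁻¹ ≤ N / ((1 - γ) * m)} with hgood
  have hbad : ∀ ω ∈ goodᶜ, Real.exp (t * (m * L - a)) ≤ (NormedSpace.exp (HH r t L ω)).trace := by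
    intro ω hω
    have hG : (Matrix.of fun k l => U (ω k) l : Matrix (Fin m) (Fin d) ℝ)ᵀ
        * (Matrix.of fun k l => U (ω k) l : Matrix (Fin m) (Fin d) ℝ)
        = ∑ k, vecMulVec (r (ω k)) (r (ω k)) := by
      ext b c
      simp [Matrix.sum_apply, vecMulVec_apply, Matrix.mul_apply, hr]
    have hex : ∃ v, qf v (∑ k, vecMulVec (r (ω k)) (r (ω k))) < a * qf v 1 := by
      by_contra! hc
      apply hω
      have h1 := good_of ha hc
      have h2 : 1 / a = N / ((1 - γ) * m) := by rw [hadef]; field_simp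
      rw [h2] at h1
      simp only [hgood, Set.mem_setOf_eq]
      rw [hG]
      exact h1
    obtain ⟨v, hv⟩ := hex
    have hGpos : 0 ≤ qf v (∑ k, vecMulVec (r (ω k)) (r (ω k))) :=
      qf_nonneg v (posSemidef_sum _ fun k _ => P_psd _)
    have hv1 : 0 < qf v 1 := by
      by_contra hc
      have := mul_nonpos_of_nonneg_of_nonpos ha.le (not_lt.1 hc)
      linarith
    refine trace_exp_ge v (HH_psd r ht.le hL ω).isHermitian hv1 ?_
    have hH : HH r t L ω
        = t • ((m * L) • (1 : Matrix (Fin d) (Fin d) ℝ) - ∑ k, vecMulVec (r (ω k)) (r (ω k))) := by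
      rw [HH, ← Finset.smul_sum, Finset.sum_sub_distrib]
      simp [← Nat.cast_smul_eq_nsmul ℝ, smul_smul]
    rw [hH, map_smul, map_sub, map_smul, smul_eq_mul, smul_eq_mul]
    have := mul_le_mul_of_nonneg_left hv.le ht.le
    linarith
  classical
  have hmarkov : ((goodᶜ).ncard : ℝ) * Real.exp (t * (m * L - a))
      ≤ d * (N * Real.exp (t * L - (t - 2 / 3 * t ^ 2 * L) / N)) ^ m := by
    refine le_trans ?_ (expect_bound hN r ht.le hL hsum m)
    rw [Set.ncard_eq_toFinset_card', ← nsmul_eq_mul]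
    refine (Finset.card_nsmul_le_sum _ (fun ω => (NormedSpace.exp (HH r t L ω)).trace) _
      fun ω hω => hbad ω (by simpa using hω)).trans ?_
    exact Finset.sum_le_sum_of_subset_of_nonneg (Finset.subset_univ _)
      fun ω _ _ => (exp_psd (HH_psd r ht.le hL ω).isHermitian).trace_nonneg
  have hexp : (Real.exp (t * L - (t - 2 / 3 * t ^ 2 * L) / N)) ^ m
      = Real.exp (t * (m * L - a)) * (δ / (2 * d)) := by
    have h1 : δ / (2 * d) = Real.exp (-Real.log (2 * d / δ)) := by
      rw [Real.exp_neg, Real.exp_log (by positivity), inv_div]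
    have hlogeq : Real.log (2 * d / δ) = 3 * m * γ ^ 2 / (8 * (N * L)) := by
      have hμ0 : μS ≠ 0 := by
        rintro h0
        rw [h0, mul_zero] at hμpos
        exact lt_irrefl _ hμpos
      rw [hγ2, hNL]; field_simp
    rw [h1, ← Real.exp_nat_mul, ← Real.exp_add, hlogeq]
    congr 1
    rw [hadef, htdef]
    field_simp
    ring
  have hbadcard : ((goodᶜ).ncard : ℝ) ≤ (N : ℝ) ^ m * (δ / 2) := by
    rw [mul_pow, hexp] at hmarkov
    have h1 : (d : ℝ) * ((N : ℝ) ^ m * (Real.exp (t * (m * L - a)) * (δ / (2 * d))))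
        = (N : ℝ) ^ m * (δ / 2) * Real.exp (t * (m * L - a)) := by field_simp
    rw [h1] at hmarkov
    exact le_of_mul_le_mul_right hmarkov (Real.exp_pos _)
  have hcard : (good.ncard : ℝ) + (goodᶜ).ncard = (N : ℝ) ^ m := by
    have := Set.ncard_add_ncard_compl good
    rw [Nat.card_eq_fintype_card] at this
    simp only [Fintype.card_pi, Finset.prod_const, Finset.card_univ, Fintype.card_fin] at this
    exact_mod_cast this
  have hNm : (0 : ℝ) < (N : ℝ) ^ m := by positivity
  rw [le_div_iff₀ hNm]
  nlinarith [mul_pos hNm hδ]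
end

section
/- Corollary 1 (Theorem 1 specialized to the DFT, where c² = n₃). Let δ > 0 and suppose m ≥ (8/3)·n₂·μ·log(2n₂n₃/δ) and γ := √(8n₃n₂μ·log(2n₂n₃/δ)/(3m)) < 1. Define α := √(2(n₁B_∞ − B)/(mB)·log(1/δ)) + (2(n₁B_∞ − B)/(3mB))·log(1/δ) and β := (1 + 2√(log(1/δ)))². Then with probability at least 1 − 4δ the matrix G := Σ_{k=1}^m A_{Ω(k)}ᴴ A_{Ω(k)} is invertible and Q := Σ_{k=1}^m ‖b_{Ω(k)}‖₂² − vᴴ G⁻¹ v, where v := Σ_{k=1}^m A_{Ω(k)}ᴴ b_{Ω(k)}, satisfies ((m(1−α) − n₃n₂μ·β/(1−γ))/n₁)·B ≤ Q ≤ (1+α)·(m/n₁)·B. -/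
open Matrix Real
open scoped BigOperators

namespace TMS

lemma mono_of_hasDerivAt {f f' : ℝ → ℝ} (h : ∀ x, HasDerivAt f (f' x) x)
    (h0 : ∀ x, 0 < x → 0 ≤ f' x) {x : ℝ} (hx : 0 ≤ x) : f 0 ≤ f x := by
  have : MonotoneOn f (Set.Ici 0) := by
    apply monotoneOn_of_deriv_nonneg (convex_Ici 0)
    · exact fun x _ => (h x).continuousAt.continuousWithinAt
    · exact fun x _ => (h x).differentiableAt.differentiableWithinAt
    · intro x hx
      rw [interior_Ici] at hx
      rw [(h x).deriv]
      exact h0 x hx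
  exact this (Set.mem_Ici.2 le_rfl) (Set.mem_Ici.2 hx) hx

lemma exp_neg_quad {x : ℝ} (hx : x ≤ 0) : exp x ≤ 1 + x + x ^ 2 / 2 := by
  have h := Real.quadratic_le_exp_of_nonneg (x := -x) (by linarith)
  have h1 : exp x * exp (-x) = 1 := by rw [← Real.exp_add]; simp
  have h2 : 0 < exp x := Real.exp_pos x
  have h4 : exp x * (1 + -x + (-x) ^ 2 / 2) ≤ 1 := by
    exact (mul_le_mul_of_nonneg_left h h2.le).trans h1.le
  have h5 : 0 < 1 + -x + (-x) ^ 2 / 2 := by nlinarith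
  by_contra hc
  push Not at hc
  have := mul_lt_mul_of_pos_right hc h5
  nlinarith [sq_nonneg (x^2)]

lemma exp_pade {x : ℝ} (hx : 0 ≤ x) : 2 * (3 - x) * exp x ≤ 6 + 4 * x + x ^ 2 := by
  have key := mono_of_hasDerivAt (f := fun x => (6 + 4 * x + x ^ 2) * exp (-x) - 6 + 2 * x)
    (f' := fun x => 2 - (2 + 2 * x + x ^ 2) * exp (-x)) ?_ ?_ hx
  · simp at key
    have h1 : exp x * exp (-x) = 1 := by rw [← Real.exp_add]; simp
    have h2 : 0 < exp x := Real.exp_pos x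
    have := mul_le_mul_of_nonneg_left key h2.le
    nlinarith
  · intro x
    have he : HasDerivAt (fun x : ℝ => exp (-x)) (-exp (-x)) x := by
      simpa using (hasDerivAt_neg x).exp
    have hp : HasDerivAt (fun x : ℝ => 6 + 4 * x + x ^ 2) (4 + 2 * x) x := by
      have := (((hasDerivAt_id x).const_mul 4).const_add 6).add (hasDerivAt_pow 2 x)
      convert! this using 1
      simp
    have hl : HasDerivAt (fun x : ℝ => 2 * x) 2 x := by
      simpa using (hasDerivAt_id x).const_mul 2
    have := ((hp.mul he).sub_const 6).add hl
    convert! this using 1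
    ring
  · intro x hx
    have h := Real.quadratic_le_exp_of_nonneg hx.le
    have h1 : exp x * exp (-x) = 1 := by rw [← Real.exp_add]; simp
    have h2 : 0 < exp (-x) := Real.exp_pos _
    nlinarith

/-- Bernstein's elementary inequality. -/
lemma exp_bern {x c : ℝ} (hx : x ≤ c) (hc0 : 0 ≤ c) (hc : c < 3) :
    exp x ≤ 1 + x + x ^ 2 / (2 * (1 - c / 3)) := by
  have hpos : 0 < 2 * (1 - c / 3) := by linarith
  rcases le_total x 0 with h | h
  · refine (exp_neg_quad h).trans ?_
    have : x ^ 2 / 2 ≤ x ^ 2 / (2 * (1 - c / 3)) := by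
      apply div_le_div_of_nonneg_left (sq_nonneg x) hpos; linarith
    linarith
  · have h1 := exp_pade h
    have h2 : exp x ≤ 1 + x + x ^ 2 / (2 * (1 - x / 3)) := by
      have : 1 + x + x ^ 2 / (2 * (1 - x / 3)) = (6 + 4 * x + x ^ 2) / (2 * (3 - x)) := by
        have : (3 - x) ≠ 0 := by linarith
        have : (1 - x / 3) ≠ 0 := by intro h; apply this; linarith
        field_simp
        ring
      rw [this, le_div_iff₀ (by linarith)]
      linarith
    refine h2.trans ?_
    have : x ^ 2 / (2 * (1 - x / 3)) ≤ x ^ 2 / (2 * (1 - c / 3)) := by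
      apply div_le_div_of_nonneg_left (sq_nonneg x) hpos; linarith
    linarith

lemma exp_five_six {x : ℝ} (hx : x ≤ 5 / 4) : exp x ≤ 1 + x + 5 / 6 * x ^ 2 := by
  rcases le_total x 0 with h | h
  · refine (exp_neg_quad h).trans ?_
    nlinarith [sq_nonneg x]
  · obtain ⟨y, rfl⟩ : ∃ y, x = 2 * y := ⟨x / 2, by ring⟩
    have hy0 : 0 ≤ y := by linarith
    have hy1 : y ≤ 5 / 8 := by linarith
    have h1 := Real.exp_bound' hy0 (by linarith) (n := 3) (by norm_num)
    norm_num [Finset.sum_range_succ, Nat.factorial] at h1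
    have h2 : exp (2 * y) = exp y ^ 2 := by rw [← Real.exp_nat_mul]; norm_num
    rw [h2]
    have h3 : exp y ^ 2 ≤ (1 + y + y ^ 2 / 2 + y ^ 3 * 4 / 18) ^ 2 :=
      pow_le_pow_left₀ (Real.exp_pos y).le (by linarith) 2
    refine h3.trans ?_
    have e1 : y ^ 2 ≤ 5 / 8 * y := by nlinarith
    have e2 : y ^ 3 ≤ 25 / 64 * y := by nlinarith
    have e3 : y ^ 4 ≤ 125 / 512 * y := by nlinarith
    have : (13 / 9 * y + 25 / 36 * y ^ 2 + 2 / 9 * y ^ 3 + 4 / 81 * y ^ 4) ≤ 4 / 3 := by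
      linarith
    nlinarith [mul_le_mul_of_nonneg_left this (sq_nonneg y)]

lemma exp_trace (x : ℝ) : exp x ≤ 1 + x + x ^ 2 / 2 + x ^ 2 / 6 * exp x := by
  rcases le_total x 0 with h | h
  · have := exp_neg_quad h
    have := Real.exp_pos x
    have : 0 ≤ x ^ 2 / 6 * exp x := by positivity
    linarith
  · have key := mono_of_hasDerivAt (f := fun x => (1 + x + x ^ 2 / 2) * exp (-x) + x ^ 2 / 6)
      (f' := fun x => x * (1 / 3 - x / 2 * exp (-x))) ?_ ?_ h
    · simp at key
      have h1 : exp x * exp (-x) = 1 := by rw [← Real.exp_add]; simp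
      have h2 : 0 < exp x := Real.exp_pos x
      have := mul_le_mul_of_nonneg_left key h2.le
      nlinarith
    · intro x
      have he : HasDerivAt (fun x : ℝ => exp (-x)) (-exp (-x)) x := by
        simpa using (hasDerivAt_neg x).exp
      have hp : HasDerivAt (fun x : ℝ => 1 + x + x ^ 2 / 2) (1 + x) x := by
        have := ((hasDerivAt_id x).const_add 1).add ((hasDerivAt_pow 2 x).div_const 2)
        convert! this using 1
        simp
      have hl : HasDerivAt (fun x : ℝ => x ^ 2 / 6) (x / 3) x := by
        have := (hasDerivAt_pow 2 x).div_const 6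
        convert! this using 1
        simp; ring
      have := (hp.mul he).add hl
      convert! this using 1
      ring
    · intro x hx
      have h := Real.quadratic_le_exp_of_nonneg hx.le
      have h1 : exp x * exp (-x) = 1 := by rw [← Real.exp_add]; simp
      have h2 : 0 < exp (-x) := Real.exp_pos _
      have : x / 2 * exp (-x) ≤ 1 / 3 := by
        nlinarith [sq_nonneg (x - 1), mul_le_mul_of_nonneg_right h h2.le, mul_nonneg (sq_nonneg (x-1)) h2.le, mul_nonneg (sq_nonneg (x-3/2)) h2.le]
      exact mul_nonneg hx.le (by linarith)

lemma sum_cons {n m : ℕ} (F : (Fin (m + 1) → Fin n) → ℝ) :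
    ∑ ω, F ω = ∑ j, ∑ ω : Fin m → Fin n, F (Fin.cons j ω) := by
  rw [← (Fin.consEquiv (fun _ => Fin n)).sum_comp, Fintype.sum_prod_type]
  rfl

/-- counting Markov inequality -/
lemma markov {Ω : Type*} [Fintype Ω] (F : Ω → ℝ) (hF : ∀ ω, 0 ≤ F ω) (t C : ℝ) (ht : 0 < t)
    (hC : ∑ ω, F ω ≤ t * C) (P : Ω → Prop) (hP : ∀ ω, P ω → t ≤ F ω) :
    (Set.ncard {ω | P ω} : ℝ) ≤ C := by
  classical
  have h1 : Set.ncard {ω | P ω} = (Finset.univ.filter P).card := by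
    rw [← Set.ncard_coe_finset]; congr 1; ext; simp
  rw [h1]
  have h2 : ((Finset.univ.filter P).card : ℝ) * t ≤ ∑ ω, F ω := by
    rw [← nsmul_eq_mul]
    refine (Finset.card_nsmul_le_sum _ F t ?_).trans ?_
    · intro ω hω; exact hP ω (by simpa using hω)
    · exact Finset.sum_le_univ_sum_of_nonneg hF
  nlinarith

lemma scalar_mgf {n : ℕ} (Z : Fin n → ℝ) (c : ℝ) (hc : 0 ≤ c) (l : ℝ)
    (h : ∑ j, exp (l * Z j) ≤ c) (m : ℕ) :
    ∑ ω : Fin m → Fin n, exp (l * ∑ k, Z (ω k)) ≤ c ^ m := by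
  induction m with
  | zero => simp
  | succ m ih =>
    rw [sum_cons]
    simp only [Fin.sum_univ_succ, Fin.cons_zero, Fin.cons_succ, mul_add, Real.exp_add]
    simp only [← Finset.mul_sum, ← Finset.sum_mul]
    rw [pow_succ']
    exact mul_le_mul h ih (Finset.sum_nonneg fun _ _ => (Real.exp_pos _).le) hc

set_option maxHeartbeats 1000000 in
lemma bernstein {n : ℕ} (hn : 0 < n) (Z : Fin n → ℝ) (m : ℕ) (hm : 0 < m) (M s L : ℝ)
    (hM0 : 0 ≤ M) (hL : 0 < L) (hs : 0 ≤ s)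
    (h0 : ∑ j, Z j = 0) (hM : ∀ j, Z j ≤ M) (hv : ∑ j, Z j ^ 2 ≤ n * s) :
    (Set.ncard {ω : Fin m → Fin n | √(2 * m * s * L) + 2 / 3 * M * L < ∑ k, Z (ω k)} : ℝ)
      ≤ exp (-L) * (n : ℝ) ^ m := by
  have hmR : (0 : ℝ) < m := by exact_mod_cast hm
  have hnR : (0 : ℝ) < n := by exact_mod_cast hn
  rcases hs.eq_or_lt with rfl | hs
  · have hz : ∀ j, Z j = 0 := by
      have h1 : ∑ j, Z j ^ 2 = 0 := le_antisymm (by simpa using hv)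
        (Finset.sum_nonneg fun _ _ => sq_nonneg _)
      rw [Finset.sum_eq_zero_iff_of_nonneg (fun _ _ => sq_nonneg _)] at h1
      intro j
      simpa using h1 j (Finset.mem_univ j)
    have : {ω : Fin m → Fin n | √(2 * m * 0 * L) + 2 / 3 * M * L < ∑ k, Z (ω k)} = ∅ := by
      ext ω
      simp [hz]
      positivity
    rw [this]
    simp
    positivity
  set r := √(2 * m * s * L) with hr
  have hr2 : r ^ 2 = 2 * m * s * L := Real.sq_sqrt (by positivity)
  have hr0 : 0 < r := Real.sqrt_pos.2 (by positivity)
  set t := r + 2 / 3 * M * L with ht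
  have htp : 0 < t := by positivity
  set D := m * s + M * t / 3 with hD
  have hDp : 0 < D := by positivity
  have hexp : L ≤ t ^ 2 / (2 * D) := by
    rw [le_div_iff₀ (by positivity)]
    have : t * r ≥ r ^ 2 := by
      have : 0 ≤ 2 / 3 * M * L := by positivity
      nlinarith
    have e : t ^ 2 = t * r + 2 / 3 * M * L * t := by rw [ht]; ring
    rw [e, hD]; nlinarith
  set l := t / D with hl
  have hlp : 0 < l := by positivity
  have hlD : l * D = t := by rw [hl]; field_simp
  have hq : 1 - l * M / 3 = m * s / D := by
    rw [eq_div_iff hDp.ne']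
    have : (1 - l * M / 3) * D = D - (l * D) * M / 3 := by ring
    rw [this, hlD, hD]; ring
  have hqp : 0 < 1 - l * M / 3 := by rw [hq]; positivity
  set c : ℝ := n * exp (l ^ 2 * s / (2 * (1 - l * M / 3))) with hc
  have hone : ∑ j, exp (l * Z j) ≤ c := by
    have : ∀ j, exp (l * Z j) ≤ 1 + l * Z j + (l * Z j) ^ 2 / (2 * (1 - l * M / 3)) := fun j =>
      exp_bern (mul_le_mul_of_nonneg_left (hM j) hlp.le) (by positivity) (by linarith)
    refine (Finset.sum_le_sum fun j _ => this j).trans ?_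
    rw [Finset.sum_add_distrib, Finset.sum_add_distrib, ← Finset.mul_sum, h0, ← Finset.sum_div]
    simp only [mul_pow, ← Finset.mul_sum]
    simp only [Finset.sum_const, Finset.card_univ, Fintype.card_fin, nsmul_eq_mul, mul_one, mul_zero,
      add_zero]
    have h1 : l ^ 2 * ∑ j, Z j ^ 2 ≤ l ^ 2 * (n * s) := by gcongr
    have h2 : l ^ 2 * (∑ j, Z j ^ 2) / (2 * (1 - l * M / 3)) ≤
       n * (l ^ 2 * s / (2 * (1 - l * M / 3))) := by
      rw [← mul_div_assoc]
      apply div_le_div_of_nonneg_right _ (by linarith)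
      linarith
    rw [hc]
    have h3 := Real.add_one_le_exp (l ^ 2 * s / (2 * (1 - l * M / 3)))
    nlinarith
  have hmgf := scalar_mgf Z c (by positivity) l hone m
  refine markov (fun ω => exp (l * ∑ k, Z (ω k))) (fun _ => (Real.exp_pos _).le) (exp (l * t)) _
    (Real.exp_pos _) (hmgf.trans ?_) _ ?_
  · rw [hc, mul_pow, mul_comm, ← mul_assoc, ← Real.exp_nat_mul, ← Real.exp_add]
    gcongr
    rw [hq]
    have : m * (l ^ 2 * s / (2 * (m * s / D))) = l * t / 2 := by
      rw [← hlD]; field_simp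
    rw [this]
    have : l * t = 2 * (t ^ 2 / (2 * D)) := by rw [hl]; field_simp
    linarith
  · intro ω hω
    gcongr

set_option linter.unusedSectionVars false

section Vec
variable {E : Type*} [NormedAddCommGroup E] [InnerProductSpace ℂ E]

/-- mean norm of `u + S_m` -/
noncomputable def fm {n : ℕ} (X : Fin n → E) (m : ℕ) (u : E) : ℝ :=
  (∑ ω : Fin m → Fin n, ‖u + ∑ k, X (ω k)‖) / (n : ℝ) ^ m

lemma fm_succ {n : ℕ} (hn : 0 < n) (X : Fin n → E) (m : ℕ) (u : E) :
    ∑ j, fm X m (u + X j) = n * fm X (m + 1) u := by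
  have hnR : (0 : ℝ) < n := by exact_mod_cast hn
  unfold fm
  rw [sum_cons, ← Finset.sum_div]
  simp only [Fin.sum_univ_succ, Fin.cons_zero, Fin.cons_succ, add_assoc]
  rw [pow_succ]
  field_simp

lemma fm_lip {n : ℕ} (hn : 0 < n) (X : Fin n → E) (m : ℕ) (u w : E) :
    fm X m u - fm X m w ≤ ‖u - w‖ := by
  have hnR : (0 : ℝ) < n := by exact_mod_cast hn
  unfold fm
  rw [← sub_div, div_le_iff₀ (by positivity), ← Finset.sum_sub_distrib]
  refine (Finset.sum_le_sum (g := fun _ => ‖u - w‖) fun ω _ => ?_).trans ?_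
  · have := norm_sub_norm_le (u + ∑ k, X (ω k)) (w + ∑ k, X (ω k))
    simpa using this
  · simp [mul_comm]

lemma abs_fm_lip {n : ℕ} (hn : 0 < n) (X : Fin n → E) (m : ℕ) (u w : E) :
    |fm X m u - fm X m w| ≤ ‖u - w‖ := by
  rw [abs_le]
  have h1 := fm_lip hn X m u w
  have h2 := fm_lip hn X m w u
  rw [norm_sub_rev] at h2
  constructor <;> linarith

lemma second_moment {n : ℕ} (hn : 0 < n) (X : Fin n → E) (h0 : ∑ j, X j = 0) (s : ℝ)
    (hv : ∑ j, ‖X j‖ ^ 2 ≤ n * s) (m : ℕ) (u : E) :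
    ∑ ω : Fin m → Fin n, ‖u + ∑ k, X (ω k)‖ ^ 2 ≤ (n : ℝ) ^ m * (‖u‖ ^ 2 + m * s) := by
  have hnR : (0 : ℝ) < n := by exact_mod_cast hn
  induction m generalizing u with
  | zero => simp
  | succ m ih =>
    rw [sum_cons]
    simp only [Fin.sum_univ_succ, Fin.cons_zero, Fin.cons_succ, ← add_assoc]
    refine (Finset.sum_le_sum fun j _ => ih (u + X j)).trans ?_
    rw [← Finset.mul_sum, Finset.sum_add_distrib]
    have : ∑ j, ‖u + X j‖ ^ 2 = n * ‖u‖ ^ 2 + ∑ j, ‖X j‖ ^ 2 := by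
      simp only [@norm_add_sq ℂ, Finset.sum_add_distrib]
      rw [← Finset.mul_sum, ← map_sum, ← inner_sum, h0]
      simp
    rw [this, pow_succ (n : ℝ) m, mul_assoc]
    gcongr
    push_cast
    simp
    nlinarith

lemma fm_zero_le {n : ℕ} (hn : 0 < n) (X : Fin n → E) (h0 : ∑ j, X j = 0) (s : ℝ)
    (hv : ∑ j, ‖X j‖ ^ 2 ≤ n * s) (m : ℕ) : fm X m 0 ≤ √(m * s) := by
  have hnR : (0 : ℝ) < n := by exact_mod_cast hn
  apply Real.le_sqrt_of_sq_le
  have h := second_moment hn X h0 s hv m 0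
  unfold fm
  rw [div_pow, div_le_iff₀ (by positivity)]
  have hc := sq_sum_le_card_mul_sum_sq (s := (Finset.univ : Finset (Fin m → Fin n)))
    (f := fun ω => ‖(0 : E) + ∑ k, X (ω k)‖)
  simp only [Finset.card_univ, Fintype.card_pi, Fintype.card_fin, Finset.prod_const] at hc
  push_cast at hc
  refine hc.trans ?_
  have : (n : ℝ) ^ m * ∑ ω : Fin m → Fin n, ‖0 + ∑ k, X (ω k)‖ ^ 2
    ≤ (n : ℝ) ^ m * ((n : ℝ) ^ m * (‖(0 : E)‖ ^ 2 + m * s)) := by gcongr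
  refine this.trans (le_of_eq ?_)
  simp
  ring

lemma vec_mgf {n : ℕ} (hn : 0 < n) (X : Fin n → E) (s M l : ℝ) (hl : 0 ≤ l)
    (hM : ∀ j, ‖X j‖ ≤ M) (hlM : l * (2 * M) ≤ 5 / 4)
    (hv : ∑ j, ‖X j‖ ^ 2 ≤ n * s) (m : ℕ) (u : E) :
    ∑ ω : Fin m → Fin n, exp (l * ‖u + ∑ k, X (ω k)‖) ≤
      (n : ℝ) ^ m * exp (l * fm X m u + 5 / 6 * l ^ 2 * s * m) := by
  have hnR : (0 : ℝ) < n := by exact_mod_cast hn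
  induction m generalizing u with
  | zero => simp [fm]
  | succ m ih =>
    rw [sum_cons]
    simp only [Fin.sum_univ_succ, Fin.cons_zero, Fin.cons_succ, ← add_assoc]
    refine (Finset.sum_le_sum fun j _ => ih (u + X j)).trans ?_
    rw [← Finset.mul_sum, pow_succ (n : ℝ) m, mul_assoc ((n : ℝ) ^ m)]
    refine mul_le_mul_of_nonneg_left ?_ (pow_nonneg hnR.le m)
    set a := fm X (m + 1) u with ha
    have hsum : ∑ j, (fm X m (u + X j) - a) = 0 := by
      rw [Finset.sum_sub_distrib, fm_succ hn]; simp [ha]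
    have hbd : ∀ j, fm X m (u + X j) - a ≤ 2 * M := by
      intro j
      have : n * (fm X m (u + X j) - a) ≤ n * (2 * M) := by
        rw [mul_sub, ha, ← fm_succ hn]
        have e : (n : ℝ) * fm X m (u + X j) = ∑ i : Fin n, fm X m (u + X j) := by simp
        have e2 : (n : ℝ) * (2 * M) = ∑ i : Fin n, 2 * M := by simp
        rw [e, e2, ← Finset.sum_sub_distrib]
        refine Finset.sum_le_sum fun i _ => ?_
        refine (fm_lip hn X m _ _).trans ?_
        have : u + X j - (u + X i) = X j - X i := by abel
        rw [this]
        refine (norm_sub_le _ _).trans ?_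
        linarith [hM i, hM j]
      exact le_of_mul_le_mul_left this hnR
    have hvar : ∑ j, (fm X m (u + X j) - a) ^ 2 ≤ n * s := by
      refine le_trans ?_ hv
      set d := a - fm X m u with hd
      have e : ∀ j, (fm X m (u + X j) - a) ^ 2 =
          (fm X m (u + X j) - fm X m u) ^ 2 - 2 * d * (fm X m (u + X j) - a) - d ^ 2 := by
        intro j; rw [hd]; ring
      simp only [e, Finset.sum_sub_distrib (f := fun j => _ - _)]
      rw [Finset.sum_sub_distrib, ← Finset.mul_sum, hsum]
      have : ∑ j, (fm X m (u + X j) - fm X m u) ^ 2 ≤ ∑ j, ‖X j‖ ^ 2 := by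
        refine Finset.sum_le_sum fun j _ => ?_
        have := abs_fm_lip hn X m (u + X j) u
        rw [add_sub_cancel_left] at this
        rw [← sq_abs]
        gcongr
      have h3 : 0 ≤ ∑ j : Fin n, d ^ 2 := Finset.sum_nonneg fun _ _ => sq_nonneg _
      linarith
    have hstep : ∑ j, exp (l * (fm X m (u + X j) - a)) ≤ n * exp (5 / 6 * l ^ 2 * s) := by
      have : ∀ j, exp (l * (fm X m (u + X j) - a)) ≤ 1 + l * (fm X m (u + X j) - a) +
          5 / 6 * (l * (fm X m (u + X j) - a)) ^ 2 := fun j =>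
        exp_five_six ((mul_le_mul_of_nonneg_left (hbd j) hl).trans hlM)
      refine (Finset.sum_le_sum fun j _ => this j).trans ?_
      rw [Finset.sum_add_distrib, Finset.sum_add_distrib, ← Finset.mul_sum, hsum, ← Finset.mul_sum]
      simp only [mul_pow, ← Finset.mul_sum]
      simp only [Finset.sum_const, Finset.card_univ, Fintype.card_fin, nsmul_eq_mul, mul_one,
        mul_zero, add_zero]
      have h1 : l ^ 2 * ∑ j, (fm X m (u + X j) - a) ^ 2 ≤ l ^ 2 * (n * s) := by gcongr
      have h3 := Real.add_one_le_exp (5 / 6 * l ^ 2 * s)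
      nlinarith
    have e : ∀ j, exp (l * fm X m (u + X j) + 5 / 6 * l ^ 2 * s * m) =
        exp (l * (fm X m (u + X j) - a)) * exp (l * a + 5 / 6 * l ^ 2 * s * m) := by
      intro j; rw [← Real.exp_add]; ring_nf
    rw [Finset.sum_congr rfl fun j _ => e j, ← Finset.sum_mul]
    refine (mul_le_mul_of_nonneg_right hstep (Real.exp_pos _).le).trans (le_of_eq ?_)
    rw [mul_assoc, ← Real.exp_add]
    push_cast
    ring_nf

set_option maxHeartbeats 1000000 in
lemma vec_bernstein {n : ℕ} (hn : 0 < n) (X : Fin n → E) (h0 : ∑ j, X j = 0) (s K L : ℝ)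
    (hs : 0 < s) (hL : 0 < L) (hK : 0 ≤ K)
    (hM : ∀ j, ‖X j‖ ^ 2 ≤ s * K)
    (hv : ∑ j, ‖X j‖ ^ 2 ≤ n * s) (m : ℕ) (hm : 0 < m) (hmK : 384 / 125 * K * L ≤ m) :
    (Set.ncard {ω : Fin m → Fin n | √(m * s) * (1 + 2 * √(5 / 6 * L)) < ‖∑ k, X (ω k)‖} : ℝ)
      ≤ exp (-L) * (n : ℝ) ^ m := by
  have hmR : (0 : ℝ) < m := by exact_mod_cast hm
  have hnR : (0 : ℝ) < n := by exact_mod_cast hn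
  set r := √(m * s) with hr
  have hr2 : r ^ 2 = m * s := Real.sq_sqrt (by positivity)
  have hr0 : 0 < r := Real.sqrt_pos.2 (by positivity)
  set q := √(5 / 6 * L) with hq
  have hq2 : q ^ 2 = 5 / 6 * L := Real.sq_sqrt (by positivity)
  have hq0 : 0 < q := Real.sqrt_pos.2 (by positivity)
  set l := 6 / 5 * q / r with hl
  have hl0 : 0 < l := by positivity
  have hlr : l * r = 6 / 5 * q := by rw [hl]; field_simp
  have hl2 : l ^ 2 * (m * s) = 6 / 5 * L := by
    rw [← hr2, ← mul_pow, hlr, mul_pow, hq2]; ring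
  have hlM : l * (2 * √(s * K)) ≤ 5 / 4 := by
    apply le_of_sq_le_sq _ (by norm_num)
    rw [mul_pow, mul_pow, Real.sq_sqrt (by positivity)]
    have : l ^ 2 * (2 ^ 2 * (s * K)) * m = 4 * K * (l ^ 2 * (m * s)) := by ring
    have h2 : l ^ 2 * (2 ^ 2 * (s * K)) * m ≤ (5 / 4) ^ 2 * m := by
      rw [this, hl2]; nlinarith
    exact le_of_mul_le_mul_right h2 hmR
  have hmgf := vec_mgf hn X s (√(s * K)) l hl0.le (fun j => Real.le_sqrt_of_sq_le (hM j)) hlM hv m 0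
  refine markov (fun ω => exp (l * ‖0 + ∑ k, X (ω k)‖)) (fun _ => (Real.exp_pos _).le)
    (exp (l * (r * (1 + 2 * q)))) _
    (Real.exp_pos _) (hmgf.trans ?_) _ ?_
  · rw [← mul_assoc, ← Real.exp_add, mul_comm]
    refine mul_le_mul_of_nonneg_right (Real.exp_le_exp.2 ?_) (by positivity)
    have h1 : l * fm X m 0 ≤ l * r := by
      gcongr; exact fm_zero_le hn X h0 s hv m
    have h2 : 5 / 6 * l ^ 2 * s * m = L := by
      have : 5 / 6 * l ^ 2 * s * m = 5 / 6 * (l ^ 2 * (m * s)) := by ring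
      rw [this, hl2]; ring
    have h3 : l * (r * (1 + 2 * q)) = l * r + 2 * L := by
      have : l * (r * (1 + 2 * q)) = l * r + 2 * (l * r) * q := by ring
      rw [this, hlr]
      have : 2 * (6 / 5 * q) * q = 12 / 5 * q ^ 2 := by ring
      rw [this, hq2]; ring
    rw [h2, h3]; linarith
  · intro ω hω
    simp only [zero_add]
    gcongr

end Vec

section Tr
variable {E : Type*} [NormedAddCommGroup E] [InnerProductSpace ℂ E] [FiniteDimensional ℂ E]

open Classical in
/-- trace of the exponential -/
noncomputable def trE {d : ℕ} (hd : Module.finrank ℂ E = d) (K : E →ₗ[ℂ] E) : ℝ :=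
  if h : K.IsSymmetric then ∑ i, exp (h.eigenvalues hd i) else 0

/-- `tr (exp K X)` -/
noncomputable def trEX {d : ℕ} (hd : Module.finrank ℂ E = d) {K : E →ₗ[ℂ] E}
    (h : K.IsSymmetric) (X : E →ₗ[ℂ] E) : ℝ :=
  ∑ i, exp (h.eigenvalues hd i) *
    (inner ℂ (h.eigenvectorBasis hd i) (X (h.eigenvectorBasis hd i))).re

/-- For any symmetric `C` and vector `x`, moments of the spectral measure. -/
lemma spec_inner {d : ℕ} (hd : Module.finrank ℂ E = d) {C : E →ₗ[ℂ] E} (hC : C.IsSymmetric)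
    (k : ℝ) (x : E) (i : Fin d) (D : E →ₗ[ℂ] E) (hD : D x = (k : ℂ) • x - C x) :
    inner ℂ (hC.eigenvectorBasis hd i) (D x) =
      ((k - hC.eigenvalues hd i : ℝ) : ℂ) * inner ℂ (hC.eigenvectorBasis hd i) x := by
  rw [hD, inner_sub_right, inner_smul_right, ← hC, hC.apply_eigenvectorBasis, inner_smul_left]
  simp
  ring

lemma spec_first {d : ℕ} (hd : Module.finrank ℂ E = d) {C : E →ₗ[ℂ] E} (hC : C.IsSymmetric)
    (k : ℝ) (x : E) (D : E →ₗ[ℂ] E) (hD : D x = (k : ℂ) • x - C x) :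
    ∑ i, (k - hC.eigenvalues hd i) * ‖inner ℂ (hC.eigenvectorBasis hd i) x‖ ^ 2 =
      (inner ℂ x (D x)).re := by
  rw [← (hC.eigenvectorBasis hd).sum_inner_mul_inner x (D x), Complex.re_sum]
  refine Finset.sum_congr rfl fun i _ => ?_
  rw [spec_inner hd hC k x i D hD]
  rw [mul_left_comm, Complex.re_ofReal_mul]
  congr 1
  have h := inner_mul_symm_re_eq_norm (𝕜 := ℂ) x (hC.eigenvectorBasis hd i)
  rw [norm_mul, norm_inner_symm, ← sq] at h
  exact h.symm

lemma spec_second {d : ℕ} (hd : Module.finrank ℂ E = d) {C : E →ₗ[ℂ] E} (hC : C.IsSymmetric)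
    (k : ℝ) (x : E) (D : E →ₗ[ℂ] E) (hD : D x = (k : ℂ) • x - C x) :
    ∑ i, (k - hC.eigenvalues hd i) ^ 2 * ‖inner ℂ (hC.eigenvectorBasis hd i) x‖ ^ 2 =
      ‖D x‖ ^ 2 := by
  rw [← (hC.eigenvectorBasis hd).sum_sq_norm_inner_right (D x)]
  refine Finset.sum_congr rfl fun i _ => ?_
  rw [spec_inner hd hC k x i D hD, norm_mul, mul_pow, Complex.norm_real, Real.norm_eq_abs, sq_abs]

lemma tr_step {d : ℕ} (hd : Module.finrank ℂ E = d) {K X : E →ₗ[ℂ] E} (hK : K.IsSymmetric)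
    (hX : X.IsSymmetric) (R θ : ℝ) (hR0 : 0 ≤ R) (hθ : 0 < θ)
    (hR : ∀ x, ‖X x‖ ^ 2 ≤ R * (inner ℂ x (X x)).re) :
    trE hd (K - (θ : ℂ) • X) ≤ trE hd K - θ * (1 - 2 / 3 * (θ * R)) * trEX hd hK X := by
  have hθX : ((θ : ℂ) • X).IsSymmetric := by
    intro x y
    simp only [LinearMap.smul_apply, inner_smul_left, inner_smul_right, hX x y, Complex.conj_ofReal]
  have hC : (K - (θ : ℂ) • X).IsSymmetric := hK.sub hθX
  set C := K - (θ : ℂ) • X with hCdef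
  have e1 : trE hd C = ∑ i, exp (hC.eigenvalues hd i) := by simp [trE, hC]
  have e2 : trE hd K = ∑ j, exp (hK.eigenvalues hd j) := by simp [trE, hK]
  rw [e1, e2]
  set c := hC.eigenvalues hd
  set k := hK.eigenvalues hd
  set u := hC.eigenvectorBasis hd
  set w := hK.eigenvectorBasis hd
  have hKw : ∀ j, K (w j) = (k j : ℂ) • w j := fun j => hK.apply_eigenvectorBasis hd j
  have hCu : ∀ i, C (u i) = (c i : ℂ) • u i := fun i => hC.apply_eigenvectorBasis hd i
  set P : Fin d → Fin d → ℝ := fun i j => ‖inner ℂ (u i) (w j)‖ ^ 2 with hP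
  have hP0 : ∀ i j, 0 ≤ P i j := fun i j => sq_nonneg _
  have hP1 : ∀ j, ∑ i, P i j = 1 := by
    intro j; rw [hP]; simp only
    rw [u.sum_sq_norm_inner_right, w.norm_eq_one]; norm_num
  have hP2 : ∀ i, ∑ j, P i j = 1 := by
    intro i; rw [hP]; simp only
    rw [w.sum_sq_norm_inner_left, u.norm_eq_one]; norm_num
  set fK : Fin d → ℝ := fun j => (inner ℂ (w j) (X (w j))).re with hfK
  set fC : Fin d → ℝ := fun i => (inner ℂ (u i) (X (u i))).re with hfC
  have re1 : ∀ x : E, (inner ℂ x (((θ : ℂ) • X) x)).re = θ * (inner ℂ x (X x)).re := by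
    intro x
    rw [LinearMap.smul_apply, inner_smul_right, Complex.re_ofReal_mul]
  have no1 : ∀ x : E, ‖((θ : ℂ) • X) x‖ ^ 2 = θ ^ 2 * ‖X x‖ ^ 2 := by
    intro x
    rw [LinearMap.smul_apply, norm_smul, mul_pow, Complex.norm_real, Real.norm_eq_abs, sq_abs]
  have A1 : ∀ j, ∑ i, (k j - c i) * P i j = θ * fK j := by
    intro j
    rw [hfK]; simp only
    rw [← re1]
    refine spec_first hd hC (k j) (w j) ((θ : ℂ) • X) ?_
    rw [← hKw, hCdef, LinearMap.sub_apply]; abel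
  have A2 : ∀ j, ∑ i, (k j - c i) ^ 2 * P i j = θ ^ 2 * ‖X (w j)‖ ^ 2 := by
    intro j
    rw [← no1]
    refine spec_second hd hC (k j) (w j) ((θ : ℂ) • X) ?_
    rw [← hKw, hCdef, LinearMap.sub_apply]; abel
  have hDn : ∀ i, (-((θ : ℂ) • X)) (u i) = (c i : ℂ) • u i - K (u i) := by
    intro i
    rw [← hCu, hCdef, LinearMap.sub_apply, LinearMap.neg_apply]; abel
  have B1 : ∀ i, ∑ j, (k j - c i) * P i j = θ * fC i := by
    intro i
    have := spec_first hd hK (c i) (u i) _ (hDn i)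
    rw [LinearMap.neg_apply, inner_neg_right, Complex.neg_re, re1] at this
    rw [hfC]; simp only
    rw [← neg_eq_iff_eq_neg.2 this, ← Finset.sum_neg_distrib]
    refine Finset.sum_congr rfl fun j _ => ?_
    rw [hP]; simp only
    rw [norm_inner_symm (u i) (w j)]
    ring
  have B2 : ∀ i, ∑ j, (k j - c i) ^ 2 * P i j = θ ^ 2 * ‖X (u i)‖ ^ 2 := by
    intro i
    have := spec_second hd hK (c i) (u i) _ (hDn i)
    rw [LinearMap.neg_apply, norm_neg, no1] at this
    rw [← this]
    refine Finset.sum_congr rfl fun j _ => ?_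
    rw [hP]; simp only
    rw [norm_inner_symm (u i) (w j)]
    ring
  have T1 : ∑ i, exp (c i) = ∑ i, ∑ j, exp (c i) * P i j := by
    simp only [← Finset.mul_sum, hP2, mul_one]
  have T2 : ∑ j, exp (k j) = ∑ i, ∑ j, exp (k j) * P i j := by
    rw [Finset.sum_comm]; simp only [← Finset.mul_sum, hP1, mul_one]
  have T3 : θ * trEX hd hK X = ∑ i, ∑ j, exp (k j) * ((k j - c i) * P i j) := by
    rw [Finset.sum_comm]; simp only [← Finset.mul_sum, A1]
    unfold trEX
    rw [Finset.mul_sum]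
    refine Finset.sum_congr rfl fun j _ => ?_
    simp only [hfK]; ring
  have T4 : θ * trEX hd hC X = ∑ i, ∑ j, exp (c i) * ((k j - c i) * P i j) := by
    simp only [← Finset.mul_sum, B1]
    unfold trEX
    rw [Finset.mul_sum]
    refine Finset.sum_congr rfl fun j _ => ?_
    simp only [hfC]; ring
  have T5 : ∑ i, ∑ j, exp (k j) * ((k j - c i) ^ 2 * P i j) ≤ θ ^ 2 * R * trEX hd hK X := by
    rw [Finset.sum_comm]; simp only [← Finset.mul_sum, A2]
    unfold trEX
    rw [Finset.mul_sum]
    refine Finset.sum_le_sum fun j _ => ?_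
    have := mul_le_mul_of_nonneg_left (hR (w j)) (mul_nonneg (Real.exp_pos (k j)).le (sq_nonneg θ))
    linarith
  have T6 : ∑ i, ∑ j, exp (c i) * ((k j - c i) ^ 2 * P i j) ≤ θ ^ 2 * R * trEX hd hC X := by
    simp only [← Finset.mul_sum, B2]
    unfold trEX
    rw [Finset.mul_sum]
    refine Finset.sum_le_sum fun j _ => ?_
    have := mul_le_mul_of_nonneg_left (hR (u j)) (mul_nonneg (Real.exp_pos (c j)).le (sq_nonneg θ))
    linarith
  have mon : θ * trEX hd hC X ≤ θ * trEX hd hK X := by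
    rw [T3, T4]
    refine Finset.sum_le_sum fun i _ => Finset.sum_le_sum fun j _ => ?_
    rw [← mul_assoc, ← mul_assoc]
    refine mul_le_mul_of_nonneg_right ?_ (hP0 i j)
    rcases le_total (c i) (k j) with h | h
    · exact mul_le_mul_of_nonneg_right (Real.exp_le_exp.2 h) (by linarith)
    · exact mul_le_mul_of_nonpos_right (Real.exp_le_exp.2 h) (by linarith)
  have main : ∑ i, exp (c i) ≤ ∑ j, exp (k j) - θ * trEX hd hK X
      + 1 / 2 * ∑ i, ∑ j, exp (k j) * ((k j - c i) ^ 2 * P i j)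
      + 1 / 6 * ∑ i, ∑ j, exp (c i) * ((k j - c i) ^ 2 * P i j) := by
    rw [T1, T2, T3]
    simp only [Finset.mul_sum, ← Finset.sum_sub_distrib, ← Finset.sum_add_distrib]
    refine Finset.sum_le_sum fun i _ => Finset.sum_le_sum fun j _ => ?_
    have h := exp_trace (c i - k j)
    have h2 : exp (c i) = exp (k j) * exp (c i - k j) := by rw [← Real.exp_add]; ring_nf
    have h3 : exp (c i) ≤ exp (k j) - exp (k j) * (k j - c i) + 1 / 2 * (exp (k j) * (k j - c i) ^ 2)
       + 1 / 6 * (exp (c i) * (k j - c i) ^ 2) := by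
      have := mul_le_mul_of_nonneg_left h (Real.exp_pos (k j)).le
      rw [h2]
      linarith
    have := mul_le_mul_of_nonneg_right h3 (hP0 i j)
    linarith
  have : θ ^ 2 * R * trEX hd hC X ≤ θ ^ 2 * R * trEX hd hK X := by
    have := mul_le_mul_of_nonneg_left mon (mul_nonneg hθ.le hR0)
    linarith
  linarith

lemma tr_mgf {n d : ℕ} (hn : 0 < n) (hd : Module.finrank ℂ E = d) (X : Fin n → E →ₗ[ℂ] E)
    (hX : ∀ j, (X j).IsSymmetric) (R θ : ℝ) (hR0 : 0 ≤ R) (hθ : 0 < θ)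
    (hR : ∀ j x, ‖X j x‖ ^ 2 ≤ R * (inner ℂ x (X j x)).re)
    (hsum : ∑ j, X j = LinearMap.id) (m : ℕ) (K : E →ₗ[ℂ] E) (hK : K.IsSymmetric) :
    ∑ ω : Fin m → Fin n, trE hd (K - (θ : ℂ) • ∑ k, X (ω k)) ≤
      (n * exp (-(θ * (1 - 2 / 3 * (θ * R))) / n)) ^ m * trE hd K := by
  have hnR : (0 : ℝ) < n := by exact_mod_cast hn
  have hpos : ∀ K : E →ₗ[ℂ] E, 0 ≤ trE hd K := by
    intro K
    unfold trE
    split_ifs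
    · positivity
    · exact le_rfl
  induction m generalizing K with
  | zero => simp
  | succ m ih =>
    rw [sum_cons]
    simp only [Fin.sum_univ_succ, Fin.cons_zero, Fin.cons_succ, smul_add, ← sub_sub]
    refine (Finset.sum_le_sum fun j _ => ih (K - (θ : ℂ) • X j) ?_).trans ?_
    · refine hK.sub ?_
      intro x y
      simp only [LinearMap.smul_apply, inner_smul_left, inner_smul_right, hX j x y, Complex.conj_ofReal]
    rw [← Finset.mul_sum, pow_succ, mul_assoc]
    refine mul_le_mul_of_nonneg_left ?_ (by positivity)
    refine (Finset.sum_le_sum fun j _ => tr_step hd hK (hX j) R θ hR0 hθ (hR j)).trans ?_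
    rw [Finset.sum_sub_distrib, ← Finset.mul_sum]
    have : ∑ j, trEX hd hK (X j) = trE hd K := by
      unfold trEX trE
      rw [Finset.sum_comm, dif_pos hK]
      refine Finset.sum_congr rfl fun i _ => ?_
      rw [← Finset.mul_sum, ← Complex.re_sum, ← inner_sum, ← LinearMap.sum_apply, hsum]
      simp
    rw [this]
    simp only [Finset.sum_const, Finset.card_univ, Fintype.card_fin, nsmul_eq_mul]
    have h3 := Real.add_one_le_exp (-(θ * (1 - 2 / 3 * (θ * R))) / n)
    have h4 : n - θ * (1 - 2 / 3 * (θ * R)) ≤ n * exp (-(θ * (1 - 2 / 3 * (θ * R))) / n) := by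
      have := mul_le_mul_of_nonneg_left h3 hnR.le
      refine le_trans (le_of_eq ?_) this
      field_simp
      ring
    have := mul_le_mul_of_nonneg_right h4 (hpos K)
    linarith

lemma tr_lower {d : ℕ} (hd : Module.finrank ℂ E = d) {K : E →ₗ[ℂ] E} (hK : K.IsSymmetric)
    (a : ℝ) (x : E) (h : a * ‖x‖ ^ 2 < (inner ℂ x (K x)).re) : exp a ≤ trE hd K := by
  have : ∃ i, a ≤ hK.eigenvalues hd i := by
    by_contra hc
    push Not at hc
    have h1 := spec_first hd hK a x ((a : ℂ) • (LinearMap.id : E →ₗ[ℂ] E) - K) (by simp)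
    have h2 : 0 ≤ (inner ℂ x (((a : ℂ) • (LinearMap.id : E →ₗ[ℂ] E) - K) x)).re := by
      rw [← h1]
      exact Finset.sum_nonneg fun i _ => mul_nonneg (by linarith [hc i]) (sq_nonneg _)
    rw [LinearMap.sub_apply, inner_sub_right, LinearMap.smul_apply, inner_smul_right,
      Complex.sub_re, Complex.re_ofReal_mul, LinearMap.id_apply] at h2
    have h3 : (inner ℂ x x).re = ‖x‖ ^ 2 := by
      rw [inner_self_eq_norm_sq_to_K]; norm_cast
    rw [h3] at h2
    linarith
  obtain ⟨i, hi⟩ := this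
  unfold trE
  rw [dif_pos hK]
  refine (Real.exp_le_exp.2 hi).trans ?_
  exact Finset.single_le_sum (f := fun i => exp (hK.eigenvalues hd i))
    (fun _ _ => (Real.exp_pos _).le) (Finset.mem_univ i)

/-- matrix Chernoff lower tail -/
lemma chernoff {n d : ℕ} (hn : 0 < n) (hd : Module.finrank ℂ E = d) (X : Fin n → E →ₗ[ℂ] E)
    (hX : ∀ j, (X j).IsSymmetric) (p γ : ℝ) (hp : 0 < p) (hγ : 0 < γ)
    (hR : ∀ j x, ‖X j x‖ ^ 2 ≤ p / n * (inner ℂ x (X j x)).re)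
    (hsum : ∑ j, X j = LinearMap.id) (m : ℕ) :
    (Set.ncard {ω : Fin m → Fin n |
      ∃ x, (inner ℂ x ((∑ k, X (ω k)) x)).re < (1 - γ) * (m / n) * ‖x‖ ^ 2} : ℝ)
      ≤ d * exp (-(3 / 8 * γ ^ 2 * m / p)) * (n : ℝ) ^ m := by
  have hnR : (0 : ℝ) < n := by exact_mod_cast hn
  set θ := 3 / 4 * γ * n / p with hθdef
  have hθ : 0 < θ := by positivity
  have hsym0 : (0 : E →ₗ[ℂ] E).IsSymmetric := fun x y => by simp
  have hmgf := tr_mgf hn hd X hX (p / n) θ (by positivity) hθ hR hsum m 0 hsym0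
  have h0 : trE hd (0 : E →ₗ[ℂ] E) = d := by
    unfold trE
    rw [dif_pos hsym0]
    have : ∀ i, hsym0.eigenvalues hd i = 0 := by
      intro i
      have h := hsym0.apply_eigenvectorBasis hd i
      have hne : hsym0.eigenvectorBasis hd i ≠ 0 := by
        intro h0
        have := (hsym0.eigenvectorBasis hd).norm_eq_one i
        rw [h0] at this; simp at this
      simp only [LinearMap.zero_apply] at h
      have := (smul_eq_zero.1 h.symm).resolve_right hne
      exact Complex.ofReal_eq_zero.1 this
    simp [this]
  have hpos : ∀ K : E →ₗ[ℂ] E, 0 ≤ trE hd K := by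
    intro K
    unfold trE
    split_ifs
    · positivity
    · exact le_rfl
  rw [h0] at hmgf
  refine markov _ (fun _ => hpos _) (exp (-θ * ((1 - γ) * (m / n)))) _ (Real.exp_pos _)
    (hmgf.trans (le_of_eq ?_)) _ ?_
  · rw [mul_pow, ← Real.exp_nat_mul]
    have : exp (-θ * ((1 - γ) * (m / n))) * (d * exp (-(3 / 8 * γ ^ 2 * m / p)) * (n : ℝ) ^ m)
      = (n : ℝ) ^ m * (exp (-θ * ((1 - γ) * (m / n))) * exp (-(3 / 8 * γ ^ 2 * m / p))) * d := by
      ring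
    rw [this, ← Real.exp_add]
    congr 3
    rw [hθdef]
    field_simp
    ring
  · rintro ω ⟨x, hx⟩
    have hS : (∑ k, X (ω k)).IsSymmetric := by
      intro x y
      simp only [LinearMap.sum_apply, sum_inner, inner_sum]
      exact Finset.sum_congr rfl fun k _ => hX _ x y
    refine tr_lower hd (hsym0.sub ?_) _ x ?_
    · intro x y
      simp only [LinearMap.smul_apply, inner_smul_left, inner_smul_right, hS x y, Complex.conj_ofReal]
    · rw [LinearMap.sub_apply, inner_sub_right, LinearMap.smul_apply, inner_smul_right,
        Complex.sub_re, Complex.re_ofReal_mul]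
      simp only [LinearMap.zero_apply, inner_zero_right, Complex.zero_re, zero_sub]
      have := mul_lt_mul_of_pos_left hx hθ
      linarith

end Tr

section Mat

lemma inner_conjT {r d : ℕ} (M : Matrix (Fin r) (Fin d) ℂ) (x : EuclideanSpace ℂ (Fin d))
    (y : Fin r → ℂ) :
    inner ℂ x (WithLp.toLp 2 (Mᴴ *ᵥ y)) =
      inner ℂ (WithLp.toLp 2 (M *ᵥ x.ofLp) : EuclideanSpace ℂ (Fin r)) (WithLp.toLp 2 y) := by
  rw [EuclideanSpace.inner_eq_star_dotProduct, EuclideanSpace.inner_eq_star_dotProduct]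
  simp only
  rw [Matrix.star_mulVec, dotProduct_comm, dotProduct_mulVec, dotProduct_comm]

lemma frob {r d : ℕ} (M : Matrix (Fin r) (Fin d) ℂ) (y : Fin r → ℂ) :
    ‖(WithLp.toLp 2 (Mᴴ *ᵥ y) : EuclideanSpace ℂ (Fin d))‖ ^ 2 ≤
      (∑ i, ∑ l, ‖M i l‖ ^ 2) * ∑ i, ‖y i‖ ^ 2 := by
  rw [EuclideanSpace.norm_sq_eq, Finset.sum_comm, Finset.sum_mul]
  refine Finset.sum_le_sum fun l _ => ?_
  simp only [mulVec, dotProduct, conjTranspose_apply]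
  have h1 : ‖∑ i, star (M i l) * y i‖ ≤ ∑ i, ‖M i l‖ * ‖y i‖ := by
    refine (norm_sum_le _ _).trans (le_of_eq ?_)
    simp
  refine (pow_le_pow_left₀ (norm_nonneg _) h1 2).trans ?_
  exact Finset.sum_mul_sq_le_sq_mul_sq _ _ _

lemma euc_sq {r : ℕ} (y : Fin r → ℂ) :
    ‖(WithLp.toLp 2 y : EuclideanSpace ℂ (Fin r))‖ ^ 2 = ∑ i, ‖y i‖ ^ 2 := by
  rw [EuclideanSpace.norm_sq_eq]

lemma re_inner_gram {r d : ℕ} (M : Matrix (Fin r) (Fin d) ℂ) (x : EuclideanSpace ℂ (Fin d)) :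
    (inner ℂ x (Matrix.toEuclideanLin (Mᴴ * M) x)).re =
      ‖(WithLp.toLp 2 (M *ᵥ x.ofLp) : EuclideanSpace ℂ (Fin r))‖ ^ 2 := by
  rw [Matrix.toEuclideanLin_apply, ← Matrix.mulVec_mulVec, inner_conjT, inner_self_eq_norm_sq_to_K]
  norm_cast

lemma gram_sq {r d : ℕ} (M : Matrix (Fin r) (Fin d) ℂ) (R : ℝ) (hR : ∑ i, ∑ l, ‖M i l‖ ^ 2 ≤ R)
    (x : EuclideanSpace ℂ (Fin d)) :
    ‖Matrix.toEuclideanLin (Mᴴ * M) x‖ ^ 2 ≤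
      R * (inner ℂ x (Matrix.toEuclideanLin (Mᴴ * M) x)).re := by
  rw [re_inner_gram, Matrix.toEuclideanLin_apply, ← Matrix.mulVec_mulVec, euc_sq (M *ᵥ x.ofLp)]
  refine (frob M _).trans ?_
  exact mul_le_mul_of_nonneg_right hR (Finset.sum_nonneg fun _ _ => sq_nonneg _)

lemma gram_symm {r d : ℕ} (M : Matrix (Fin r) (Fin d) ℂ) :
    (Matrix.toEuclideanLin (Mᴴ * M)).IsSymmetric :=
  Matrix.isSymmetric_toEuclideanLin_iff.2 (Matrix.isHermitian_conjTranspose_mul_self M)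

lemma det_part {r d m : ℕ} (A : Fin m → Matrix (Fin r) (Fin d) ℂ) (b : Fin m → Fin r → ℂ) (a : ℝ)
    (ha : 0 < a)
    (h : ∀ x : EuclideanSpace ℂ (Fin d), a * ‖x‖ ^ 2 ≤
      (inner ℂ x ((∑ k, Matrix.toEuclideanLin ((A k)ᴴ * A k)) x)).re)
    (G : Matrix (Fin d) (Fin d) ℂ) (hG : G = ∑ k, (A k)ᴴ * A k)
    (v : Fin d → ℂ) (hv : v = ∑ k, (A k)ᴴ *ᵥ b k) :
    IsUnit G ∧ 0 ≤ (star v ⬝ᵥ (G⁻¹ *ᵥ v)).re ∧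
      (star v ⬝ᵥ (G⁻¹ *ᵥ v)).re ≤ ∑ k, ∑ i, ‖b k i‖ ^ 2 ∧
      a * (star v ⬝ᵥ (G⁻¹ *ᵥ v)).re ≤ ‖(WithLp.toLp 2 v : EuclideanSpace ℂ (Fin d))‖ ^ 2 := by
  have hT : ∑ k, Matrix.toEuclideanLin ((A k)ᴴ * A k) = Matrix.toEuclideanLin G := by
    rw [hG, map_sum]
  have hu : IsUnit G := by
    rw [← Matrix.mulVec_injective_iff_isUnit]
    have : ∀ x, G *ᵥ x = 0 → x = 0 := by
      intro x hx
      have h1 := h (WithLp.toLp 2 x)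
      rw [hT, Matrix.toEuclideanLin_apply] at h1
      simp only [hx, WithLp.toLp_zero, inner_zero_right, Complex.zero_re] at h1
      have h2 : ‖(WithLp.toLp 2 x : EuclideanSpace ℂ (Fin d))‖ ^ 2 ≤ 0 := by
        by_contra hc
        push Not at hc
        have := mul_pos ha hc
        linarith
      have h3 : ‖(WithLp.toLp 2 x : EuclideanSpace ℂ (Fin d))‖ = 0 := by
        have := sq_nonneg ‖(WithLp.toLp 2 x : EuclideanSpace ℂ (Fin d))‖
        exact pow_eq_zero_iff (two_ne_zero) |>.1 (le_antisymm h2 this)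
      have h4 := norm_eq_zero.1 h3
      simpa using h4
    intro x y hxy
    have : x - y = 0 := this _ (by rw [Matrix.mulVec_sub]; exact sub_eq_zero.2 hxy)
    exact sub_eq_zero.1 this
  have hGw : G *ᵥ (G⁻¹ *ᵥ v) = v := by
    rw [Matrix.mulVec_mulVec, Matrix.mul_nonsing_inv _ ((Matrix.isUnit_iff_isUnit_det G).1 hu),
      Matrix.one_mulVec]
  set w := G⁻¹ *ᵥ v with hw
  set W : EuclideanSpace ℂ (Fin d) := WithLp.toLp 2 w with hW
  set V : EuclideanSpace ℂ (Fin d) := WithLp.toLp 2 v with hV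
  have hq : (star v ⬝ᵥ w).re = (inner ℂ V W).re := by
    rw [EuclideanSpace.inner_eq_star_dotProduct, dotProduct_comm]
  have hsymm : (inner ℂ W V).re = (inner ℂ V W).re := inner_re_symm (𝕜 := ℂ) W V
  rw [hq]
  set q := (inner ℂ V W).re with hqdef
  have hTW : (∑ k, Matrix.toEuclideanLin ((A k)ᴴ * A k)) W = V := by
    rw [hT, Matrix.toEuclideanLin_apply, hW, hV]
    simp only [hGw]
  have h1 : a * ‖W‖ ^ 2 ≤ q := by
    have := h W
    rwa [hTW, hsymm] at this
  have hq0 : 0 ≤ q := le_trans (by positivity) h1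
  refine ⟨hu, hq0, ?_, ?_⟩
  · have hWV : (inner ℂ W V).re =
        ∑ k, (inner ℂ (WithLp.toLp 2 (A k *ᵥ w) : EuclideanSpace ℂ (Fin r)) (WithLp.toLp 2 (b k))).re := by
      rw [hV, hv, WithLp.toLp_sum, inner_sum, Complex.re_sum]
      refine Finset.sum_congr rfl fun k _ => ?_
      rw [inner_conjT]
    have hWG : (inner ℂ W V).re =
        ∑ k, ‖(WithLp.toLp 2 (A k *ᵥ w) : EuclideanSpace ℂ (Fin r))‖ ^ 2 := by
      rw [← hTW, LinearMap.sum_apply, inner_sum, Complex.re_sum]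
      refine Finset.sum_congr rfl fun k _ => ?_
      rw [re_inner_gram]
    have hpos : 0 ≤ ∑ k, ‖(WithLp.toLp 2 (A k *ᵥ w) - WithLp.toLp 2 (b k) : EuclideanSpace ℂ (Fin r))‖ ^ 2 :=
      Finset.sum_nonneg fun _ _ => sq_nonneg _
    simp only [@norm_sub_sq ℂ, Finset.sum_add_distrib, Finset.sum_sub_distrib, ← Finset.mul_sum,
      euc_sq (b _)] at hpos
    rw [← hWG] at hpos
    have e : ∑ k, RCLike.re (inner ℂ (WithLp.toLp 2 (A k *ᵥ w) : EuclideanSpace ℂ (Fin r)) (WithLp.toLp 2 (b k))) =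
      (inner ℂ W V).re := hWV.symm
    rw [e, hsymm] at hpos
    linarith
  · have hcs : q ≤ ‖V‖ * ‖W‖ := re_inner_le_norm (𝕜 := ℂ) V W
    have h2 : q ^ 2 ≤ ‖V‖ ^ 2 * ‖W‖ ^ 2 := by
      rw [← mul_pow]; exact pow_le_pow_left₀ hq0 hcs 2
    rcases hq0.eq_or_lt with h0 | h0
    · rw [← h0]; simp
    · have h3 : a * q * q ≤ ‖V‖ ^ 2 * q := by
        have e1 := mul_le_mul_of_nonneg_left h2 ha.le
        have e2 := mul_le_mul_of_nonneg_left h1 (sq_nonneg ‖V‖)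
        linarith
      exact le_of_mul_le_mul_right h3 h0

end Mat

end TMS

namespace TMS

lemma union_bound {Ω : Type*} [Fintype Ω] (Good B1 B2 B3 B4 : Set Ω) (δ N : ℝ)
    (hN : (Fintype.card Ω : ℝ) = N)
    (h : ∀ ω, ω ∉ B1 → ω ∉ B2 → ω ∉ B3 → ω ∉ B4 → ω ∈ Good)
    (h1 : (Set.ncard B1 : ℝ) ≤ δ * N) (h2 : (Set.ncard B2 : ℝ) ≤ δ * N)
    (h3 : (Set.ncard B3 : ℝ) ≤ δ * N) (h4 : (Set.ncard B4 : ℝ) ≤ δ * N) :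
    (1 - 4 * δ) * N ≤ (Set.ncard Good : ℝ) := by
  have hsub : (Set.univ : Set Ω) ⊆ (((Good ∪ B1) ∪ B2) ∪ B3) ∪ B4 := by
    intro ω _
    simp only [Set.mem_union]
    by_contra hc
    push Not at hc
    exact hc.1.1.1.1 (h ω hc.1.1.1.2 hc.1.1.2 hc.1.2 hc.2)
  have e0 := Set.ncard_le_ncard hsub (Set.toFinite _)
  have e1 := Set.ncard_union_le (((Good ∪ B1) ∪ B2) ∪ B3) B4
  have e2 := Set.ncard_union_le ((Good ∪ B1) ∪ B2) B3
  have e3 := Set.ncard_union_le (Good ∪ B1) B2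
  have e4 := Set.ncard_union_le Good B1
  rw [Set.ncard_univ, Nat.card_eq_fintype_card] at e0
  have e5 : (Fintype.card Ω : ℝ) ≤
      Set.ncard Good + Set.ncard B1 + Set.ncard B2 + Set.ncard B3 + Set.ncard B4 := by
    exact_mod_cast (by omega)
  rw [hN] at e5
  linarith

lemma mat_chernoff {n r d : ℕ} (hn : 0 < n) (A : Fin n → Matrix (Fin r) (Fin d) ℂ)
    (hA : ∑ j, (A j)ᴴ * A j = 1) (p γ : ℝ) (hp : 0 < p) (hγ : 0 < γ)
    (hAF : ∀ j, ∑ i, ∑ l, ‖A j i l‖ ^ 2 ≤ p / n) (m : ℕ) :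
    ∃ T : Set (Fin m → Fin n),
      (Set.ncard T : ℝ) ≤ d * exp (-(3 / 8 * γ ^ 2 * m / p)) * (n : ℝ) ^ m ∧
      ∀ ω, ω ∉ T → ∀ x : EuclideanSpace ℂ (Fin d), (1 - γ) * (m / n) * ‖x‖ ^ 2 ≤
        (inner ℂ x ((∑ k, Matrix.toEuclideanLin ((A (ω k))ᴴ * A (ω k))) x)).re := by
  have hd : Module.finrank ℂ (EuclideanSpace ℂ (Fin d)) = d := by simp
  have hsum : ∑ j, Matrix.toEuclideanLin ((A j)ᴴ * A j) =
      (LinearMap.id : EuclideanSpace ℂ (Fin d) →ₗ[ℂ] EuclideanSpace ℂ (Fin d)) := by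
    have h1 : ∑ j, Matrix.toEuclideanLin ((A j)ᴴ * A j) =
      Matrix.toEuclideanLin (∑ j, (A j)ᴴ * A j) := (map_sum _ _ _).symm
    rw [h1, hA]
    apply LinearMap.ext
    intro x
    rw [Matrix.toEuclideanLin_apply]
    simp
  have c := chernoff hn hd (fun j => Matrix.toEuclideanLin ((A j)ᴴ * A j))
    (fun j => gram_symm (A j)) p γ hp hγ (fun j x => gram_sq (A j) _ (hAF j) x) hsum m
  refine ⟨_, c, ?_⟩
  intro ω hω x
  by_contra hc
  exact hω ⟨x, not_le.1 hc⟩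

/-- The deterministic real-number conclusion on the good event. -/
lemma final_arith (n m p β γ α τ L s S q V B : ℝ) (hn : 0 < n) (hm : 0 < m) (hB : 0 < B)
    (hγ : 0 < 1 - γ) (hs : s = p * B / n ^ 2)
    (hkey : p * τ ^ 2 / (1 - γ) + 2 / 3 * L ≤ p * β / (1 - γ))
    (hms : 0 ≤ m * s) (hV0 : 0 ≤ V)
    (h1 : n * S / B - m ≤ m * α) (h2 : -(n * S / B - m) ≤ m * α + 2 / 3 * L)
    (h3 : m * (1 - α) - p * β / (1 - γ) ≤ 0 ∨ V ≤ √(m * s) * τ)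
    (hq0 : 0 ≤ q) (hqS : q ≤ S) (hqV : (1 - γ) * (m / n) * q ≤ V ^ 2) :
    (m * (1 - α) - p * β / (1 - γ)) / n * B ≤ S - q ∧ S - q ≤ (1 + α) * (m / n) * B := by
  have hS : n * S / B * B = n * S := by field_simp
  set R := n * S / B with hR
  have hSR : S = R * (B / n) := by rw [hR]; field_simp
  have hBn : 0 < B / n := by positivity
  constructor
  · have e : (m * (1 - α) - p * β / (1 - γ)) / n * B =
        (m * (1 - α) - p * β / (1 - γ)) * (B / n) := by ring
    rw [e]
    rcases h3 with h3 | h3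
    · have := mul_nonpos_of_nonpos_of_nonneg h3 hBn.le
      linarith
    · have hV2 : V ^ 2 ≤ m * s * τ ^ 2 := by
        have := pow_le_pow_left₀ hV0 h3 2
        rwa [mul_pow, Real.sq_sqrt hms] at this
      have hq : q ≤ p * τ ^ 2 / (1 - γ) * (B / n) := by
        have h4 := hqV.trans hV2
        have h5 : m * s * τ ^ 2 = (1 - γ) * (m / n) * (p * τ ^ 2 / (1 - γ) * (B / n)) := by
          rw [hs]; field_simp
        rw [h5] at h4
        exact le_of_mul_le_mul_left h4 (by positivity)
      have h6 : (m * (1 - α) - p * β / (1 - γ)) * (B / n) ≤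
          (R - p * τ ^ 2 / (1 - γ)) * (B / n) :=
        mul_le_mul_of_nonneg_right (by linarith) hBn.le
      rw [hSR]
      linarith
  · have h7 : R * (B / n) ≤ ((1 + α) * m) * (B / n) :=
      mul_le_mul_of_nonneg_right (by linarith) hBn.le
    have e : (1 + α) * (m / n) * B = ((1 + α) * m) * (B / n) := by ring
    rw [e, hSR] at *
    linarith

end TMS

set_option maxHeartbeats 4000000 in
/-- **Corollary 1 (Theorem 1 specialized to the DFT, where `c² = n₃`).**
Sampling with replacement is modeled by the uniform distribution on the finite
sample space `Fin m → Fin n₁`, probabilities being `#(event) / n₁ ^ m`. -/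
theorem tensor_matched_subspace_tubal_energy_estimation_dft
    (n₁ n₂ n₃ m : ℕ) (hn₁ : 0 < n₁) (hn₂ : 0 < n₂) (hn₃ : 0 < n₃) (hm : 0 < m)
    (μ δ : ℝ) (hμ : 1 ≤ μ) (hδ : 0 < δ)
    (A : Fin n₁ → Matrix (Fin n₃) (Fin (n₂ * n₃)) ℂ)
    (hA : ∑ j, (A j)ᴴ * A j = 1)
    (hAF : ∀ j, ∑ i, ∑ l, ‖A j i l‖ ^ 2 ≤ (n₃ : ℝ) * n₂ * μ / n₁)
    (b : Fin n₁ → Fin n₃ → ℂ)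
    (hb : ∃ j, b j ≠ 0)
    (horth : ∑ j, (A j)ᴴ *ᵥ b j = 0)
    (B Bmax : ℝ)
    (hB : B = ∑ j, ∑ i, ‖b j i‖ ^ 2)
    (hBmax : IsGreatest (Set.range fun j => ∑ i, ‖b j i‖ ^ 2) Bmax)
    (hsize : (8 / 3 : ℝ) * n₂ * μ * Real.log (2 * n₂ * n₃ / δ) ≤ m)
    (γ α β : ℝ)
    (hγ : γ = Real.sqrt (8 * n₃ * n₂ * μ * Real.log (2 * n₂ * n₃ / δ) / (3 * m)))
    (hγ1 : γ < 1)
    (hα : α = Real.sqrt (2 * (n₁ * Bmax - B) / (m * B) * Real.log (1 / δ))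
            + 2 * (n₁ * Bmax - B) / (3 * m * B) * Real.log (1 / δ))
    (hβ : β = (1 + 2 * Real.sqrt (Real.log (1 / δ))) ^ 2) :
    1 - 4 * δ ≤
      (Set.ncard {ω : Fin m → Fin n₁ |
        let G : Matrix (Fin (n₂ * n₃)) (Fin (n₂ * n₃)) ℂ := ∑ k, (A (ω k))ᴴ * A (ω k)
        let v : Fin (n₂ * n₃) → ℂ := ∑ k, (A (ω k))ᴴ *ᵥ b (ω k)
        let Q : ℝ := (∑ k, ∑ i, ‖b (ω k) i‖ ^ 2) - (star v ⬝ᵥ (G⁻¹ *ᵥ v)).re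
        IsUnit G ∧
        (m * (1 - α) - (n₃ : ℝ) * n₂ * μ * β / (1 - γ)) / n₁ * B ≤ Q ∧
        Q ≤ (1 + α) * (m / n₁) * B} : ℝ) / (n₁ : ℝ) ^ m := by
  classical
  have hnR : (0 : ℝ) < n₁ := by exact_mod_cast hn₁
  have hmR : (0 : ℝ) < m := by exact_mod_cast hm
  have h2R : (1 : ℝ) ≤ n₂ := by exact_mod_cast hn₂
  have h3R : (1 : ℝ) ≤ n₃ := by exact_mod_cast hn₃
  by_cases hδ4 : 1 / 4 ≤ δ
  · refine le_trans (by linarith) (div_nonneg (Nat.cast_nonneg _) (by positivity))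
  push Not at hδ4
  set L := Real.log (1 / δ) with hLdef
  have hL : 0 < L := Real.log_pos (by rw [lt_div_iff₀ hδ]; linarith)
  have hexpL : exp (-L) = δ := by
    rw [hLdef, one_div, Real.log_inv, neg_neg, Real.exp_log hδ]
  set p : ℝ := (n₃ : ℝ) * n₂ * μ with hp
  have hp1 : 1 ≤ p := by
    have : (1 : ℝ) ≤ (n₃ : ℝ) * n₂ := one_le_mul_of_one_le_of_one_le h3R h2R
    exact one_le_mul_of_one_le_of_one_le this hμ
  have hp0 : 0 < p := by linarith
  -- the energies
  set y : Fin n₁ → ℝ := fun j => ∑ i, ‖b j i‖ ^ 2 with hy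
  have hy0 : ∀ j, 0 ≤ y j := fun j => Finset.sum_nonneg fun _ _ => sq_nonneg _
  have hyB : ∑ j, y j = B := hB.symm
  have hymax : ∀ j, y j ≤ Bmax := fun j => hBmax.2 ⟨j, rfl⟩
  have hBpos : 0 < B := by
    obtain ⟨j, hj⟩ := hb
    obtain ⟨i, hi⟩ := Function.ne_iff.1 hj
    have h1 : 0 < y j := by
      refine Finset.sum_pos' (fun _ _ => sq_nonneg _) ⟨i, Finset.mem_univ i, ?_⟩
      have : 0 < ‖b j i‖ := norm_pos_iff.2 hi
      positivity
    rw [← hyB]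
    exact Finset.sum_pos' (fun _ _ => hy0 _) ⟨j, Finset.mem_univ j, h1⟩
  set K := n₁ * Bmax / B with hK
  have hKB : K * B = n₁ * Bmax := by rw [hK]; field_simp
  have hK1 : 1 ≤ K := by
    rw [hK, le_div_iff₀ hBpos, one_mul, ← hyB]
    refine (Finset.sum_le_sum fun j _ => hymax j).trans ?_
    simp
  have hBK : n₁ * Bmax - B = (K - 1) * B := by rw [← hKB]; ring
  have hε : 0 ≤ K - 1 := by linarith
  -- rewriting α
  set x := (K - 1) * L / m with hx
  have hx0 : 0 ≤ x := by positivity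
  have hα1 : α = √(2 * x) + 2 / 3 * x := by
    have e1 : 2 * ((K - 1) * B) / (m * B) * L = 2 * x := by rw [hx]; field_simp
    have e2 : 2 * ((K - 1) * B) / (3 * m * B) * L = 2 / 3 * x := by rw [hx]; field_simp
    rw [hα, hBK, e1, e2]
  have hmx : m * x = (K - 1) * L := by rw [hx]; field_simp
  have hα2 : m * α = √(2 * m * (K - 1) * L) + 2 / 3 * (K - 1) * L := by
    have h1 : 2 * m * (K - 1) * L = (m : ℝ) ^ 2 * (2 * x) := by
      have : (m : ℝ) ^ 2 * (2 * x) = 2 * m * (m * x) := by ring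
      rw [this, hmx]; ring
    rw [h1, Real.sqrt_mul (sq_nonneg _), Real.sqrt_sq hmR.le, hα1, mul_add]
    have : m * (2 / 3 * x) = 2 / 3 * (m * x) := by ring
    rw [this, hmx]; ring
  -- rewriting γ
  set ℓ := Real.log (2 * n₂ * n₃ / δ) with hℓdef
  have hd1 : (1 : ℝ) ≤ (n₂ : ℝ) * n₃ := one_le_mul_of_one_le_of_one_le h2R h3R
  have hℓ : 0 < ℓ := Real.log_pos (by rw [lt_div_iff₀ hδ]; nlinarith)
  have hγ0 : 0 < γ := by rw [hγ]; exact Real.sqrt_pos.2 (by positivity)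
  have hγ2 : 3 / 8 * γ ^ 2 * m / p = ℓ := by
    rw [hγ, Real.sq_sqrt (by positivity)]
    have : 8 * (n₃ : ℝ) * n₂ * μ * ℓ = 8 * p * ℓ := by rw [hp]; ring
    rw [this]
    field_simp
  have h1γ : 0 < 1 - γ := by linarith
  have hexpℓ : (n₂ * n₃ : ℕ) * exp (-ℓ) ≤ δ := by
    rw [Real.exp_neg, hℓdef, Real.exp_log (by positivity)]
    push_cast
    have : (n₂ : ℝ) * n₃ * (2 * n₂ * n₃ / δ)⁻¹ = δ / 2 := by
      field_simp
    rw [this]; linarith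
  -- scalar variables
  set Z : Fin n₁ → ℝ := fun j => n₁ * y j / B - 1 with hZ
  have hZ0 : ∑ j, Z j = 0 := by
    rw [hZ, Finset.sum_sub_distrib, ← Finset.sum_div, ← Finset.mul_sum, hyB]
    simp
    field_simp
    simp
  have hZK : ∀ j, Z j ≤ K - 1 := by
    intro j
    have : n₁ * y j / B ≤ K := by
      rw [hK]
      have := hymax j
      gcongr
    simp only [hZ]; linarith
  have hZ1 : ∀ j, -Z j ≤ K := by
    intro j
    have : 0 ≤ n₁ * y j / B := div_nonneg (mul_nonneg hnR.le (hy0 j)) hBpos.le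
    simp only [hZ]; linarith
  have hZv : ∑ j, Z j ^ 2 ≤ n₁ * (K - 1) := by
    have h1 : ∀ j, Z j ^ 2 ≤ (K - 1) + (K - 2) * Z j := by
      intro j
      have e1 := hZK j
      have e2 : -1 ≤ Z j := by
        have : 0 ≤ n₁ * y j / B := div_nonneg (mul_nonneg hnR.le (hy0 j)) hBpos.le
        simp only [hZ]; linarith
      nlinarith [mul_nonneg (sub_nonneg.2 e1) (by linarith : (0 : ℝ) ≤ Z j + 1)]
    refine (Finset.sum_le_sum fun j _ => h1 j).trans ?_
    rw [Finset.sum_add_distrib, ← Finset.mul_sum, hZ0]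
    simp
    try linarith
  have hZS : ∀ ω : Fin m → Fin n₁, ∑ k, Z (ω k) = n₁ * (∑ k, y (ω k)) / B - m := by
    intro ω
    simp only [hZ]
    rw [Finset.sum_sub_distrib, ← Finset.sum_div, ← Finset.mul_sum]
    simp
  have c1 := TMS.bernstein hn₁ Z m hm (K - 1) (K - 1) L hε hL hε hZ0 hZK hZv
  have c2 := TMS.bernstein hn₁ (fun j => -Z j) m hm K (K - 1) L (by linarith) hL hε
    (by rw [Finset.sum_neg_distrib, hZ0, neg_zero]) hZ1 (by simpa using hZv)
  rw [hexpL] at c1 c2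
  -- matrix part
  obtain ⟨T4, c4, hT4⟩ := TMS.mat_chernoff hn₁ A hA p γ hp0 hγ0 hAF m
  rw [hγ2] at c4
  replace c4 := c4.trans (mul_le_mul_of_nonneg_right hexpℓ (by positivity))
  -- vector part
  set X : Fin n₁ → EuclideanSpace ℂ (Fin (n₂ * n₃)) := fun j => WithLp.toLp 2 ((A j)ᴴ *ᵥ b j) with hX
  have hX0 : ∑ j, X j = 0 := by
    rw [hX, ← WithLp.toLp_sum, horth, WithLp.toLp_zero]
  set s := p * B / (n₁ : ℝ) ^ 2 with hs
  have hs0 : 0 < s := by positivity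
  have hXy : ∀ j, ‖X j‖ ^ 2 ≤ p / n₁ * y j := fun j =>
    (TMS.frob (A j) (b j)).trans (mul_le_mul_of_nonneg_right (hAF j) (hy0 j))
  have hXM : ∀ j, ‖X j‖ ^ 2 ≤ s * K := by
    intro j
    refine (hXy j).trans ?_
    have : s * K = p / n₁ * Bmax := by
      have : s * K = p / (n₁ : ℝ) ^ 2 * (K * B) := by rw [hs]; ring
      rw [this, hKB]; field_simp
    rw [this]
    exact mul_le_mul_of_nonneg_left (hymax j) (by positivity)
  have hXv : ∑ j, ‖X j‖ ^ 2 ≤ n₁ * s := by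
    refine (Finset.sum_le_sum fun j _ => hXy j).trans (le_of_eq ?_)
    rw [← Finset.mul_sum, hyB, hs]
    field_simp
  set τ := 1 + 2 * √(5 / 6 * L) with hτ
  have hτβ : τ ^ 2 + 2 / 3 * L ≤ β := by
    have e1 : √(5 / 6 * L) ≤ √L := Real.sqrt_le_sqrt (by linarith)
    have e2 : √(5 / 6 * L) ^ 2 = 5 / 6 * L := Real.sq_sqrt (by positivity)
    have e3 : √L ^ 2 = L := Real.sq_sqrt hL.le
    rw [hβ, hτ]
    clear * - e1 e2 e3 hL
    nlinarith
  have hβ4 : 4 * L ≤ β := by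
    have e3 : √L ^ 2 = L := Real.sq_sqrt hL.le
    have := Real.sqrt_nonneg L
    rw [hβ]; (clear * - e3 this hL; nlinarith)
  have hβ0 : 0 < β := by linarith
  have hpβ : β ≤ p * β / (1 - γ) := by
    rw [le_div_iff₀ h1γ]
    clear * - hp1 hβ0 hγ0 h1γ
    nlinarith
  have hkey : p * τ ^ 2 / (1 - γ) + 2 / 3 * L ≤ p * β / (1 - γ) := by
    have e : p * τ ^ 2 / (1 - γ) + 2 / 3 * L = (p * τ ^ 2 + 2 / 3 * L * (1 - γ)) / (1 - γ) := by
      field_simp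
    rw [e]
    apply div_le_div_of_nonneg_right _ h1γ.le
    have e1 := mul_le_mul_of_nonneg_left hτβ hp0.le
    have e2 : 2 / 3 * L * (1 - γ) ≤ 2 / 3 * L := by (clear * - hL hγ0; nlinarith)
    have e3 : 2 / 3 * L ≤ p * (2 / 3 * L) := by (clear * - hL hp1; nlinarith)
    linarith
  obtain ⟨T, hTc, hT⟩ : ∃ T : Set (Fin m → Fin n₁), (Set.ncard T : ℝ) ≤ δ * (n₁ : ℝ) ^ m ∧
      ∀ ω, ω ∉ T → (m * (1 - α) - p * β / (1 - γ) ≤ 0 ∨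
        ‖∑ k, X (ω k)‖ ≤ √(m * s) * τ) := by
    by_cases htriv : m * (1 - α) - p * β / (1 - γ) ≤ 0
    · exact ⟨∅, by simp; positivity, fun ω _ => Or.inl htriv⟩
    push Not at htriv
    refine ⟨_, hexpL ▸ TMS.vec_bernstein hn₁ X hX0 s K L hs0 hL (by linarith) hXM hXv m hm ?_,
      fun ω hω => Or.inr (not_lt.1 hω)⟩
    have h1 : 4 * L < m * (1 - α) := by linarith
    set r := √(2 * x) with hr
    have hr2 : r ^ 2 = 2 * x := Real.sq_sqrt (by positivity)
    have hr0 : 0 ≤ r := Real.sqrt_nonneg _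
    have hα3 : α = r + r ^ 2 / 3 := by rw [hα1, hr2]; ring
    have h1α : 0 < 1 - α := by
      by_contra hc
      push Not at hc
      have := mul_nonpos_of_nonneg_of_nonpos hmR.le hc
      linarith
    have hr8 : r < 4 / 5 := by
      by_contra hc
      push Not at hc
      clear * - hc hα3 h1α hr0
      nlinarith
    have h2 : 1 - α ≤ 1 - 384 / 125 * x := by
      have : x = r ^ 2 / 2 := by linarith
      rw [hα3, this]
      clear * - hr8 hr0
      nlinarith
    have h3 := mul_le_mul_of_nonneg_left h2 hmR.le
    have h4 : m * (1 - 384 / 125 * x) = m - 384 / 125 * ((K - 1) * L) := by rw [← hmx]; ring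
    rw [h4] at h3
    clear * - h3 h1 hL hε
    nlinarith
  -- union bound
  have hN0 : 0 < (n₁ : ℝ) ^ m := by positivity
  rw [le_div_iff₀ hN0]
  refine TMS.union_bound _ _ _ T T4 δ _ (by simp) ?_ c1 c2 hTc c4
  intro ω h1 h2 h3 h4
  have h1' := h1
  have h2' := h2
  rw [Set.mem_setOf_eq, not_lt] at h1' h2'
  rw [Finset.sum_neg_distrib, hZS] at h2'
  rw [hZS, ← hα2] at h1'
  have h2'' : -(n₁ * (∑ k, y (ω k)) / B - m) ≤ m * α + 2 / 3 * L := by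
    rw [hα2]; linarith
  obtain ⟨g1, g2, g3, g4⟩ := TMS.det_part (fun k => A (ω k)) (fun k => b (ω k))
    ((1 - γ) * (m / n₁)) (by positivity) (hT4 ω h4) _ rfl _ rfl
  have hV : (WithLp.toLp 2 (∑ k, (A (ω k))ᴴ *ᵥ b (ω k)) : EuclideanSpace ℂ (Fin (n₂ * n₃))) =
      ∑ k, X (ω k) := by
    rw [WithLp.toLp_sum]
  rw [hV] at g4
  exact ⟨g1, TMS.final_arith n₁ m p β γ α τ L s _ _ _ B hnR hmR hBpos h1γ hs hkey
    (by positivity) (norm_nonneg _) h1' h2'' (hT ω h3) g2 g3 g4⟩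
end

section
/- Corollary 3 (Theorem 1 under the bound c ≤ √n₃, the DCT case). Let δ > 0 and 0 < c ≤ √n₃, suppose m ≥ (8/3)·c²·n₂·μ·log(2n₂n₃/δ) and γ := √(8c²n₂μ·log(2n₂n₃/δ)/(3m)) < 1, and define α := √(2(n₁B_∞ − B)/(mB)·log(1/δ)) + (2(n₁B_∞ − B)/(3mB))·log(1/δ) and β := (1 + 2√(log(1/δ)))². Then with probability at least 1 − 4δ the matrix G := Σ_{k=1}^m A_{Ω(k)}ᴴ A_{Ω(k)} is invertible and Q := Σ_{k=1}^m ‖b_{Ω(k)}‖₂² − vᴴ G⁻¹ v, where v := Σ_{k=1}^m A_{Ω(k)}ᴴ b_{Ω(k)}, satisfies ((m(1−α) − n₃n₂μ·β/(1−γ))/n₁)·B ≤ Q ≤ (1+α)·(m/n₁)·B. -/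
open Matrix Real
open scoped BigOperators


theorem aux_pow_sub_pow_norm {𝔸 : Type*} [NormedRing 𝔸] [NormOneClass 𝔸] (a b : 𝔸) (K : ℝ) (hK : 1 ≤ K)
    (ha : ‖a‖ ≤ K) (hb : ‖b‖ ≤ K) (N : ℕ) : ‖a ^ N - b ^ N‖ ≤ N * K ^ N * ‖a - b‖ := by
  induction N with
  | zero => simp
  | succ N ih =>
    have h : a ^ (N+1) - b ^ (N+1) = a * (a ^ N - b ^ N) + (a - b) * b ^ N := by
      rw [pow_succ', pow_succ']; noncomm_ring
    have hbN : ‖b ^ N‖ ≤ K ^ N := (norm_pow_le b N).trans (pow_le_pow_left₀ (norm_nonneg _) hb N)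
    have h1 : ‖a * (a ^ N - b ^ N)‖ ≤ K * (N * K ^ N * ‖a - b‖) :=
      (norm_mul_le _ _).trans (by gcongr)
    have h2 : ‖(a - b) * b ^ N‖ ≤ ‖a - b‖ * K ^ N := (norm_mul_le _ _).trans (by gcongr)
    have h3 : K ^ N ≤ K ^ (N+1) := pow_le_pow_right₀ hK (Nat.le_succ N)
    rw [h]
    refine (norm_add_le _ _).trans ((add_le_add h1 h2).trans ?_)
    push_cast
    have := mul_le_mul_of_nonneg_left h3 (norm_nonneg (a - b))
    calc _ = N * K^(N+1) * ‖a-b‖ + ‖a - b‖ * K ^ N := by ring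
      _ ≤ _ := by linarith

open NormedSpace Filter Topology in
theorem aux_trotter {𝔸 : Type*} [NormedRing 𝔸] [NormOneClass 𝔸] [NormedAlgebra ℝ 𝔸] [CompleteSpace 𝔸] (a b : 𝔸) :
    Tendsto (fun N : ℕ => (exp ((1 / (N:ℝ)) • a) * exp ((1 / (N:ℝ)) • b)) ^ N) atTop (𝓝 (exp (a + b))) := by
  let _ : NormedAlgebra ℚ 𝔸 := NormedAlgebra.restrictScalars ℚ ℝ 𝔸
  have hnorm : ∀ x : 𝔸, ‖exp x‖ ≤ Real.exp ‖x‖ := fun x => by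
    rw [Real.exp_eq_exp_ℝ, NormedSpace.exp_eq_tsum ℝ, NormedSpace.exp_eq_tsum ℝ]
    refine tsum_of_norm_bounded (NormedSpace.expSeries_summable' (𝕂 := ℝ) ‖x‖).hasSum ?_
    intro i
    rw [norm_smul, norm_inv, smul_eq_mul]
    simp only [RCLike.norm_natCast]
    gcongr
    exact norm_pow_le _ _
  have hd : HasDerivAt (fun t : ℝ => exp (t • a) * exp (t • b) - exp (t • (a + b))) 0 0 := by
    have h1 := hasDerivAt_exp_smul_const (𝕂 := ℝ) a (0:ℝ)
    have h2 := hasDerivAt_exp_smul_const (𝕂 := ℝ) b (0:ℝ)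
    have h3 := hasDerivAt_exp_smul_const (𝕂 := ℝ) (a+b) (0:ℝ)
    have h := (h1.mul h2).sub h3
    have e0 : a + b - (a + b) = (0:𝔸) := sub_self _
    simp only [zero_smul, NormedSpace.exp_zero, one_mul, mul_one, e0] at h
    exact h
  have hlim : Tendsto (fun N : ℕ => (N:ℝ) * ‖exp ((1 / (N:ℝ)) • a) * exp ((1 / (N:ℝ)) • b) - exp ((1 / (N:ℝ)) • (a + b))‖) atTop (𝓝 0) := by
    have h := hd.tendsto_slope_zero_right.norm
    have h4 : Tendsto (fun N : ℕ => 1 / (N:ℝ)) atTop (𝓝[>] 0) := by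
      refine tendsto_nhdsWithin_iff.2 ⟨tendsto_one_div_atTop_nhds_zero_nat, ?_⟩
      filter_upwards [eventually_gt_atTop 0] with N hN
      simp [hN]
    have h5 := h.comp h4
    simp only [norm_zero] at h5
    refine h5.congr' ?_
    filter_upwards [eventually_gt_atTop 0] with N hN
    simp [norm_smul]
  set C := Real.exp (‖a‖ + ‖b‖) with hC
  rw [tendsto_iff_norm_sub_tendsto_zero]
  refine squeeze_zero' (Eventually.of_forall fun _ => norm_nonneg _) ?_ (by simpa only [mul_zero] using hlim.const_mul C)
  filter_upwards [eventually_gt_atTop 0] with N hN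
  have hN' : (0:ℝ) < N := by exact_mod_cast hN
  have hK1 : 1 ≤ Real.exp ((‖a‖ + ‖b‖) / N) := Real.one_le_exp (by positivity)
  have e1 : exp (a + b) = exp ((1 / (N:ℝ)) • (a + b)) ^ N := by
    rw [← NormedSpace.exp_nsmul, ← Nat.cast_smul_eq_nsmul ℝ, smul_smul]
    congr 1
    field_simp
    simp
  rw [e1]
  have hs : ∀ x : 𝔸, ‖(1 / (N:ℝ)) • x‖ = ‖x‖ / N := fun x => by
    rw [norm_smul]; simp; field_simp
  refine (aux_pow_sub_pow_norm _ _ _ hK1 ?_ ?_ N).trans (le_of_eq ?_)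
  · refine (norm_mul_le _ _).trans ?_
    rw [add_div, Real.exp_add]
    gcongr
    · exact (hnorm _).trans_eq (by rw [hs])
    · exact (hnorm _).trans_eq (by rw [hs])
  · refine (hnorm _).trans ?_
    rw [hs]
    gcongr
    exact norm_add_le _ _
  · rw [← Real.exp_nat_mul, hC]
    have : (N:ℝ) * ((‖a‖ + ‖b‖) / N) = ‖a‖ + ‖b‖ := by field_simp
    rw [this]; ring

section
variable {n : Type*} [Fintype n] [DecidableEq n]

open NormedSpace Filter Topology in
theorem aux_trotter_matrix [Nonempty n] (a b : Matrix n n ℂ) :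
    Tendsto (fun N : ℕ => (exp ((1 / (N:ℝ)) • a) * exp ((1 / (N:ℝ)) • b)) ^ N) atTop (𝓝 (exp (a + b))) := by
  let _ : NormedRing (Matrix n n ℂ) := Matrix.linftyOpNormedRing
  let _ : NormedAlgebra ℝ (Matrix n n ℂ) := Matrix.linftyOpNormedAlgebra
  have : NormOneClass (Matrix n n ℂ) := Matrix.linfty_opNormOneClass
  exact aux_trotter a b
end

section
variable {n : Type*} [Fintype n] [DecidableEq n]

theorem aux_trace_frob (M : Matrix n n ℂ) : (Mᴴ * M).trace = ((∑ i, ∑ j, ‖M j i‖ ^ 2 : ℝ) : ℂ) := by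
  simp only [Matrix.trace, Matrix.diag_apply, Matrix.mul_apply, Matrix.conjTranspose_apply]
  push_cast
  refine Finset.sum_congr rfl fun i _ => Finset.sum_congr rfl fun j _ => ?_
  rw [← Complex.conj_mul']; rfl

theorem aux_trace_cs (M N : Matrix n n ℂ) :
    ‖(Mᴴ * N).trace‖ ^ 2 ≤ ‖(Mᴴ * M).trace‖ * ‖(Nᴴ * N).trace‖ := by
  rw [aux_trace_frob, aux_trace_frob, Complex.norm_real, Complex.norm_real,
    Real.norm_of_nonneg (by positivity), Real.norm_of_nonneg (by positivity)]
  have h : ‖(Mᴴ * N).trace‖ ≤ ∑ p : n × n, ‖M p.2 p.1‖ * ‖N p.2 p.1‖ := by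
    simp only [Matrix.trace, Matrix.diag_apply, Matrix.mul_apply, Matrix.conjTranspose_apply]
    rw [Fintype.sum_prod_type]
    refine (norm_sum_le _ _).trans (Finset.sum_le_sum fun i _ => (norm_sum_le _ _).trans (Finset.sum_le_sum fun j _ => ?_))
    simp
  have h2 := Finset.sum_mul_sq_le_sq_mul_sq (Finset.univ : Finset (n × n)) (fun p => ‖M p.2 p.1‖) (fun p => ‖N p.2 p.1‖)
  rw [Fintype.sum_prod_type (fun p : n × n => ‖M p.2 p.1‖ ^ 2), Fintype.sum_prod_type (fun p : n × n => ‖N p.2 p.1‖ ^ 2)] at h2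
  exact (pow_le_pow_left₀ (norm_nonneg _) h 2).trans h2

theorem aux_trace_pow_comm (M N : Matrix n n ℂ) (k : ℕ) : ((M * N) ^ k).trace = ((N * M) ^ k).trace := by
  cases k with
  | zero => simp
  | succ k =>
    have h : (M * N) ^ (k+1) = M * ((N * M) ^ k * N) := by
      induction k with
      | zero => simp
      | succ k ih => rw [pow_succ', ih, pow_succ' (N * M)]; simp only [Matrix.mul_assoc]
    rw [h, Matrix.trace_mul_comm, pow_succ, Matrix.mul_assoc]

theorem aux_trace_pow (k : ℕ) :
    (∀ M : Matrix n n ℂ, ‖(M ^ (2 ^ (k+1))).trace‖ ≤ ‖((Mᴴ * M) ^ (2 ^ k)).trace‖) ∧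
    (∀ P Q : Matrix n n ℂ, P.IsHermitian → Q.IsHermitian →
      ‖((P * Q) ^ (2 ^ k)).trace‖ ≤ ‖(P ^ (2 ^ k) * Q ^ (2 ^ k)).trace‖) := by
  induction k with
  | zero =>
    refine ⟨fun M => ?_, fun P Q _ _ => by simp⟩
    have h := aux_trace_cs Mᴴ M
    rw [Matrix.conjTranspose_conjTranspose, Matrix.trace_mul_comm M Mᴴ, ← pow_two] at h
    rw [← pow_two] at h
    simpa using abs_le_of_sq_le_sq' h (norm_nonneg _) |>.2
  | succ k ih =>
    obtain ⟨h1, h2⟩ := ih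
    constructor
    · intro M
      have e : M ^ (2 ^ (k+1+1)) = (M ^ 2) ^ (2 ^ (k+1)) := by rw [← pow_mul]; ring_nf
      have e2 : ((M ^ 2)ᴴ * M ^ 2) = Mᴴ * (Mᴴ * M * M) := by
        rw [pow_two, Matrix.conjTranspose_mul]; simp only [Matrix.mul_assoc]
      have hP : (Mᴴ * M).IsHermitian := Matrix.isHermitian_conjTranspose_mul_self M
      have hQ : (M * Mᴴ).IsHermitian := Matrix.isHermitian_mul_conjTranspose_self M
      have h3 := h1 (M ^ 2)
      rw [e2, aux_trace_pow_comm, Matrix.mul_assoc (Mᴴ * M)] at h3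
      have h4 := h3.trans (h2 _ _ hP hQ)
      have h5 := aux_trace_cs ((Mᴴ * M) ^ (2 ^ k)) ((M * Mᴴ) ^ (2 ^ k))
      rw [(hP.pow _).eq, (hQ.pow _).eq, ← pow_add, ← pow_add, aux_trace_pow_comm M Mᴴ, ← pow_two] at h5
      have h6 := abs_le_of_sq_le_sq' h5 (norm_nonneg _) |>.2
      rw [e]
      refine h4.trans (h6.trans_eq ?_)
      congr 3
      ring
    · intro P Q hP hQ
      have h3 := h1 (P * Q)
      have e : (P * Q)ᴴ * (P * Q) = Q * (P ^ 2 * Q) := by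
        rw [Matrix.conjTranspose_mul, hP.eq, hQ.eq, pow_two]; simp only [Matrix.mul_assoc]
      rw [e, aux_trace_pow_comm Q (P ^ 2 * Q), Matrix.mul_assoc, ← pow_two] at h3
      have h4 := h3.trans (h2 _ _ (hP.pow 2) (hQ.pow 2))
      rw [← pow_mul, ← pow_mul, ← pow_succ'] at h4
      exact h4

theorem aux_isHermitian_smul (r : ℝ) {A : Matrix n n ℂ} (hA : A.IsHermitian) : (r • A).IsHermitian := by
  unfold Matrix.IsHermitian
  rw [Matrix.conjTranspose_smul, hA.eq]; simp

open NormedSpace Filter Topology in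
/-- Golden-Thompson inequality. -/
theorem aux_golden_thompson [Nonempty n] (A B : Matrix n n ℂ) (hA : A.IsHermitian) (hB : B.IsHermitian) :
    ‖(exp (A + B)).trace‖ ≤ ‖(exp A * exp B).trace‖ := by
  have ht := aux_trotter_matrix A B
  have h2 : Tendsto (fun k : ℕ => 2 ^ k) atTop atTop := tendsto_pow_atTop_atTop_of_one_lt (by norm_num : 1 < 2)
  have hc : Continuous (fun M : Matrix n n ℂ => ‖M.trace‖) := (continuous_id.matrix_trace).norm
  have h3 := (hc.tendsto _).comp (ht.comp h2)
  refine le_of_tendsto h3 (Eventually.of_forall fun k => ?_)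
  have h4 := (aux_trace_pow k).2 (exp ((1 / ((2 ^ k : ℕ):ℝ)) • A)) (exp ((1 / ((2 ^ k : ℕ):ℝ)) • B))
    (aux_isHermitian_smul _ hA).exp (aux_isHermitian_smul _ hB).exp
  have e : ∀ X : Matrix n n ℂ, exp ((1 / ((2 ^ k : ℕ):ℝ)) • X) ^ (2 ^ k) = exp X := by
    intro X
    rw [← Matrix.exp_nsmul, ← Nat.cast_smul_eq_nsmul ℝ, smul_smul]
    congr 1
    rw [mul_one_div_cancel (by positivity), one_smul]
  rw [e, e] at h4
  exact h4
end

section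
open scoped ComplexOrder
variable {n : Type*} [Fintype n] [DecidableEq n]

theorem aux_spectral (X : Matrix n n ℂ) (hX : X.IsHermitian) :
    ∃ (U : Matrix n n ℂ) (d : n → ℝ), Uᴴ * U = 1 ∧ U * Uᴴ = 1 ∧
      X = U * diagonal (fun i => (d i : ℂ)) * Uᴴ ∧
      ∀ r : ℝ, NormedSpace.exp (r • X) = U * diagonal (fun i => (Real.exp (r * d i) : ℂ)) * Uᴴ := by
  have h1 : (hX.eigenvectorUnitary : Matrix n n ℂ)ᴴ * (hX.eigenvectorUnitary : Matrix n n ℂ) = 1 :=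
    Unitary.coe_star_mul_self hX.eigenvectorUnitary
  have h2 : (hX.eigenvectorUnitary : Matrix n n ℂ) * (hX.eigenvectorUnitary : Matrix n n ℂ)ᴴ = 1 :=
    Unitary.coe_mul_star_self hX.eigenvectorUnitary
  have h3 : X = (hX.eigenvectorUnitary : Matrix n n ℂ) * diagonal (fun i => (hX.eigenvalues i : ℂ)) *
      (hX.eigenvectorUnitary : Matrix n n ℂ)ᴴ := by
    have h := hX.spectral_theorem
    rw [Unitary.conjStarAlgAut_apply] at h
    exact h
  refine ⟨hX.eigenvectorUnitary, hX.eigenvalues, h1, h2, h3, ?_⟩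
  generalize (hX.eigenvectorUnitary : Matrix n n ℂ) = U at *
  generalize hX.eigenvalues = d at *
  intro r
  have hU : U⁻¹ = Uᴴ := Matrix.inv_eq_left_inv h1
  have hUu : IsUnit U := IsUnit.of_mul_eq_one _ h2
  have e : r • X = U * diagonal (fun i => ((r * d i : ℝ) : ℂ)) * U⁻¹ := by
    rw [h3, hU, ← Matrix.smul_mul, ← Matrix.mul_smul, ← Matrix.diagonal_smul]
    congr 3
    ext i
    simp
  rw [e, Matrix.exp_conj _ _ hUu, Matrix.exp_diagonal, hU]
  congr 3
  ext i
  rw [Pi.coe_exp, ← Complex.exp_eq_exp_ℂ]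
  simp

theorem aux_psd_conj (U : Matrix n n ℂ) (d : n → ℝ) (hd : ∀ i, 0 ≤ d i) :
    (U * diagonal (fun i => (d i : ℂ)) * Uᴴ).PosSemidef := by
  refine Matrix.PosSemidef.mul_mul_conjTranspose_same ?_ U
  exact Matrix.PosSemidef.diagonal (fun i => by simpa using hd i)

theorem aux_exp_psd (H : Matrix n n ℂ) (hH : H.IsHermitian) : (NormedSpace.exp H).PosSemidef := by
  obtain ⟨U, d, h1, h2, h3, h4⟩ := aux_spectral H hH
  have h := h4 1
  rw [one_smul] at h
  rw [h]
  exact aux_psd_conj U _ (fun i => (Real.exp_pos _).le)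

theorem aux_spectral_nonneg (X : Matrix n n ℂ) (hX : X.PosSemidef) (U : Matrix n n ℂ) (d : n → ℝ)
    (h1 : Uᴴ * U = 1) (h3 : X = U * diagonal (fun i => (d i : ℂ)) * Uᴴ) : ∀ i, 0 ≤ d i := by
  have hD : diagonal (fun i => (d i : ℂ)) = Uᴴ * X * U := by
    rw [h3]
    calc diagonal (fun i => (d i : ℂ)) = (Uᴴ * U) * diagonal (fun i => (d i : ℂ)) * (Uᴴ * U) := by rw [h1]; simp
      _ = _ := by simp only [Matrix.mul_assoc]
  have hDp : (diagonal (fun i => (d i : ℂ))).PosSemidef := by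
    rw [hD]; exact hX.conjTranspose_mul_mul_same U
  intro i
  have := Matrix.posSemidef_diagonal_iff.1 hDp i
  simpa using this

theorem aux_psd_factor (P : Matrix n n ℂ) (hP : P.PosSemidef) : ∃ S : Matrix n n ℂ, P = Sᴴ * S := by
  obtain ⟨U, d, h1, h2, h3, -⟩ := aux_spectral P hP.1
  have hd := aux_spectral_nonneg P hP U d h1 h3
  refine ⟨diagonal (fun i => ((Real.sqrt (d i) : ℝ) : ℂ)) * Uᴴ, ?_⟩
  rw [Matrix.conjTranspose_mul, Matrix.conjTranspose_conjTranspose, Matrix.diagonal_conjTranspose,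
    Matrix.mul_assoc, ← Matrix.mul_assoc (diagonal _), Matrix.diagonal_mul_diagonal, ← Matrix.mul_assoc, h3]
  congr 3
  ext i
  simp only [Pi.star_apply, RCLike.star_def, Complex.conj_ofReal]
  rw [← Complex.ofReal_mul, Real.mul_self_sqrt (hd i)]

theorem aux_trace_mul_nonneg (P Q : Matrix n n ℂ) (hP : P.PosSemidef) (hQ : Q.PosSemidef) :
    0 ≤ (P * Q).trace := by
  obtain ⟨S, rfl⟩ := aux_psd_factor P hP
  rw [Matrix.mul_assoc, Matrix.trace_mul_comm]
  exact (hQ.mul_mul_conjTranspose_same S).trace_nonneg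

theorem aux_trace_mul_norm (P Q : Matrix n n ℂ) (hP : P.PosSemidef) (hQ : Q.PosSemidef) :
    ‖(P * Q).trace‖ = (P * Q).trace.re := by
  have h := aux_trace_mul_nonneg P Q hP hQ
  rw [Complex.le_def] at h
  exact (Complex.abs_re_eq_norm.2 h.2.symm).symm.trans (abs_of_nonneg h.1)

theorem aux_exp_quad (x : ℝ) (hx : x ≤ 0) : Real.exp x ≤ 1 + x + x ^ 2 / 2 := by
  have h := Real.quadratic_le_exp_of_nonneg (x := -x) (by linarith)
  have h2 : Real.exp x * Real.exp (-x) = 1 := by rw [← Real.exp_add]; simp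
  have h3 := mul_le_mul_of_nonneg_left h (Real.exp_pos x).le
  rw [h2] at h3
  have h4 : 0 < 1 + -x + (-x) ^ 2 / 2 := by nlinarith [sq_nonneg x]
  by_contra hc
  push Not at hc
  have h5 : (1 + x + x ^ 2 / 2) * (1 + -x + (-x) ^ 2 / 2) = 1 + x ^ 4 / 4 := by ring
  have h6 := mul_lt_mul_of_pos_right hc h4
  nlinarith [sq_nonneg (x ^ 2)]

theorem aux_exp_psd_bound (X : Matrix n n ℂ) (hX : X.PosSemidef) (R θ : ℝ) (hθ : 0 ≤ θ)
    (hR : X.trace.re ≤ R) :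
    ((1 : Matrix n n ℂ) - (θ * (1 - θ * R / 2)) • X - NormedSpace.exp ((-θ) • X)).PosSemidef := by
  obtain ⟨U, d, h1, h2, h3, h4⟩ := aux_spectral X hX.1
  have hd : ∀ i, 0 ≤ d i := aux_spectral_nonneg X hX U d h1 h3
  have htr : ∑ i, d i ≤ R := by
    have : X.trace = ((∑ i, d i : ℝ) : ℂ) := by
      rw [h3, Matrix.trace_mul_comm, ← Matrix.mul_assoc, h1, Matrix.one_mul, Matrix.trace_diagonal]
      push_cast; rfl
    rw [this] at hR
    simpa using hR
  have hdR : ∀ i, d i ≤ R := fun i =>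
    (Finset.single_le_sum (fun j _ => hd j) (Finset.mem_univ i)).trans htr
  have e : (1 : Matrix n n ℂ) - (θ * (1 - θ * R / 2)) • X - NormedSpace.exp ((-θ) • X) =
      U * diagonal (fun i => ((1 - (θ * (1 - θ * R / 2)) * d i - Real.exp (-θ * d i) : ℝ) : ℂ)) * Uᴴ := by
    have e1 : diagonal (fun i => ((1 - (θ * (1 - θ * R / 2)) * d i - Real.exp (-θ * d i) : ℝ) : ℂ)) =
        (1 : Matrix n n ℂ) - (θ * (1 - θ * R / 2)) • diagonal (fun i => (d i : ℂ)) -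
          diagonal (fun i => (Real.exp (-θ * d i) : ℂ)) := by
      rw [← Matrix.diagonal_smul, ← Matrix.diagonal_one, Matrix.diagonal_sub, Matrix.diagonal_sub]
      congr 1
      ext i
      simp
    rw [e1, h4, Matrix.mul_sub, Matrix.mul_sub, Matrix.sub_mul, Matrix.sub_mul, Matrix.mul_one, h2,
      Matrix.mul_smul, Matrix.smul_mul, ← h3]
  rw [e]
  refine aux_psd_conj U _ fun i => ?_
  have h5 := aux_exp_quad (-θ * d i) (by nlinarith [hd i, mul_nonneg hθ (hd i)])
  have h6 : θ ^ 2 * d i * d i ≤ θ ^ 2 * d i * R :=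
    mul_le_mul_of_nonneg_left (hdR i) (mul_nonneg (sq_nonneg _) (hd i))
  nlinarith

theorem aux_sum_cons {ι : Type*} [Fintype ι] {M : Type*} [AddCommMonoid M] (m : ℕ) (f : (Fin (m+1) → ι) → M) :
    ∑ ω, f ω = ∑ j : ι, ∑ ω : Fin m → ι, f (Fin.cons j ω) := by
  rw [← (Fin.consEquiv (fun _ => ι)).sum_comp, Fintype.sum_prod_type]
  rfl

theorem aux_mgf_matrix [Nonempty n] (N : ℕ) (X : Fin N → Matrix n n ℂ) (hX : ∀ j, (X j).PosSemidef) (hsum : ∑ j, X j = 1)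
    (R θ : ℝ) (hθ : 0 ≤ θ) (hR : ∀ j, (X j).trace.re ≤ R) (hN : θ * (1 - θ * R / 2) ≤ N) (m : ℕ) :
    ∀ H : Matrix n n ℂ, H.IsHermitian →
      ∑ ω : Fin m → Fin N, ‖(NormedSpace.exp (H + (-θ) • ∑ k, X (ω k))).trace‖ ≤
        (N - θ * (1 - θ * R / 2)) ^ m * ‖(NormedSpace.exp H).trace‖ := by
  set κ := θ * (1 - θ * R / 2) with hκ
  induction m with
  | zero => intro H _; simp
  | succ m ih =>
    intro H hH
    rw [aux_sum_cons]
    have h1 : ∀ j, ∑ ω : Fin m → Fin N, ‖(NormedSpace.exp (H + (-θ) • ∑ k, X ((Fin.cons j ω : Fin (m+1) → Fin N) k))).trace‖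
        ≤ (N - κ) ^ m * ((NormedSpace.exp H).trace.re - κ * (NormedSpace.exp H * X j).trace.re) := by
      intro j
      have hj : ((-θ) • X j).IsHermitian := aux_isHermitian_smul _ (hX j).1
      have h2 := ih (H + (-θ) • X j) (hH.add hj)
      have h3 : ∀ ω : Fin m → Fin N, H + (-θ) • ∑ k, X ((Fin.cons j ω : Fin (m+1) → Fin N) k) =
          H + (-θ) • X j + (-θ) • ∑ k, X (ω k) := by
        intro ω
        rw [Fin.sum_univ_succ, smul_add, add_assoc]
        simp
      simp only [h3]
      refine h2.trans ?_
      refine mul_le_mul_of_nonneg_left ?_ (pow_nonneg (by linarith) _)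
      refine (aux_golden_thompson _ _ hH hj).trans ?_
      rw [aux_trace_mul_norm _ _ (aux_exp_psd _ hH) (aux_exp_psd _ hj)]
      have h4 := aux_trace_mul_nonneg _ _ (aux_exp_psd _ hH) (aux_exp_psd_bound (X j) (hX j) R θ hθ (hR j))
      rw [Complex.le_def] at h4
      have h5 := h4.1
      rw [Matrix.mul_sub, Matrix.mul_sub, Matrix.mul_one, Matrix.trace_sub, Matrix.trace_sub, Matrix.mul_smul, Matrix.trace_smul] at h5
      simp only [Complex.zero_re, Complex.sub_re, Complex.smul_re, smul_eq_mul] at h5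
      rw [← hκ] at h5
      linarith
    refine (Finset.sum_le_sum fun j _ => h1 j).trans (le_of_eq ?_)
    rw [← Finset.mul_sum, Finset.sum_sub_distrib, ← Finset.mul_sum]
    have h6 : ∑ j, (NormedSpace.exp H * X j).trace.re = (NormedSpace.exp H).trace.re := by
      rw [← Complex.re_sum, ← Matrix.trace_sum, ← Finset.mul_sum, hsum, Matrix.mul_one]
    have h7 : ‖(NormedSpace.exp H).trace‖ = (NormedSpace.exp H).trace.re := by
      simpa using aux_trace_mul_norm _ 1 (aux_exp_psd _ hH) Matrix.PosSemidef.one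
    rw [h6, h7]
    simp
    ring

/-- If `G` is Hermitian and not bounded below by `g`, the trace exponential is large. -/
theorem aux_bad_trace (G : Matrix n n ℂ) (hG : G.IsHermitian) (g θ : ℝ) (hθ : 0 ≤ θ)
    (hbad : ¬ ((G - g • (1 : Matrix n n ℂ)).PosSemidef)) :
    Real.exp (-θ * g) ≤ ‖(NormedSpace.exp ((-θ) • G)).trace‖ := by
  obtain ⟨U, d, h1, h2, h3, h4⟩ := aux_spectral G hG
  have hex : ∃ i, d i < g := by
    by_contra hc
    push Not at hc
    apply hbad
    have e : G - g • (1 : Matrix n n ℂ) = U * diagonal (fun i => ((d i - g : ℝ) : ℂ)) * Uᴴ := by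
      have e1 : diagonal (fun i => ((d i - g : ℝ) : ℂ)) =
          diagonal (fun i => (d i : ℂ)) - g • (1 : Matrix n n ℂ) := by
        rw [← Matrix.diagonal_one, ← Matrix.diagonal_smul, Matrix.diagonal_sub]
        congr 1
        ext i
        simp
      rw [e1, Matrix.mul_sub, Matrix.sub_mul, Matrix.mul_smul, Matrix.smul_mul, Matrix.mul_one, h2, ← h3]
    rw [e]
    exact aux_psd_conj U _ fun i => sub_nonneg.2 (hc i)
  obtain ⟨i, hi⟩ := hex
  have h5 : (NormedSpace.exp ((-θ) • G)).trace = ((∑ i, Real.exp (-θ * d i) : ℝ) : ℂ) := by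
    rw [h4, Matrix.trace_mul_comm, ← Matrix.mul_assoc, h1, Matrix.one_mul, Matrix.trace_diagonal]
    push_cast; rfl
  rw [h5, Complex.norm_real, Real.norm_of_nonneg (by positivity)]
  calc Real.exp (-θ * g) ≤ Real.exp (-θ * d i) := by
        apply Real.exp_le_exp.2; nlinarith
    _ ≤ _ := Finset.single_le_sum (f := fun i => Real.exp (-θ * d i)) (fun j _ => (Real.exp_pos _).le) (Finset.mem_univ i)

open Classical in
/-- Markov inequality on a finite sample space. -/
theorem aux_markov {Ω : Type*} [Fintype Ω] (P : Ω → Prop) (f : Ω → ℝ) (a : ℝ)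
    (hf : ∀ ω, 0 ≤ f ω) (hP : ∀ ω, P ω → a ≤ f ω) :
    (Set.ncard {ω | P ω} : ℝ) * a ≤ ∑ ω, f ω := by
  have hc : Set.ncard {ω | P ω} = (Finset.univ.filter P).card := by
    rw [← Set.ncard_coe_finset]; simp
  rw [hc]
  calc ((Finset.univ.filter P).card : ℝ) * a = ∑ ω ∈ Finset.univ.filter P, a := by simp
    _ ≤ ∑ ω ∈ Finset.univ.filter P, f ω := Finset.sum_le_sum fun ω hω => hP ω (Finset.mem_filter.1 hω).2
    _ ≤ ∑ ω, f ω := Finset.sum_le_sum_of_subset_of_nonneg (Finset.filter_subset _ _) fun ω _ _ => hf ω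

theorem aux_matrix_chernoff [Nonempty n] (N : ℕ) (hN0 : 0 < N) (X : Fin N → Matrix n n ℂ) (hX : ∀ j, (X j).PosSemidef) (hsum : ∑ j, X j = 1)
    (K : ℝ) (hK : 1 ≤ K) (hR : ∀ j, (X j).trace.re ≤ K / N) (m : ℕ) (γ : ℝ) (hγ : 0 ≤ γ) (hγ1 : γ ≤ 1) :
    (Set.ncard {ω : Fin m → Fin N |
      ¬ (((∑ k, X (ω k)) - ((1 - γ) * m / N) • (1 : Matrix n n ℂ)).PosSemidef)} : ℝ) ≤
      (N : ℝ) ^ m * (Fintype.card n * Real.exp (-(γ ^ 2 * m / (2 * K)))) := by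
  have hN : (0:ℝ) < N := by exact_mod_cast hN0
  set θ := γ * N / K with hθ
  have hθ0 : 0 ≤ θ := by positivity
  have hκ : θ * (1 - θ * (K / N) / 2) = N * ((γ - γ ^ 2 / 2) / K) := by
    rw [hθ]; field_simp
  have hle : (γ - γ ^ 2 / 2) / K ≤ 1 := by
    rw [div_le_one (by linarith)]; nlinarith [sq_nonneg γ]
  have h1 := aux_mgf_matrix N X hX hsum (K / N) θ hθ0 hR (by rw [hκ]; nlinarith) m 0 Matrix.isHermitian_zero
  have h2 := aux_markov (fun ω : Fin m → Fin N => ¬ (((∑ k, X (ω k)) - ((1 - γ) * m / N) • (1 : Matrix n n ℂ)).PosSemidef))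
    (fun ω => ‖(NormedSpace.exp (0 + (-θ) • ∑ k, X (ω k))).trace‖) (Real.exp (-θ * ((1 - γ) * m / N)))
    (fun _ => norm_nonneg _) (fun ω hω => by
      rw [zero_add]
      refine aux_bad_trace _ ?_ _ θ hθ0 hω
      exact (Matrix.posSemidef_sum _ fun k _ => hX (ω k)).1)
  have h3 := h2.trans h1
  rw [hκ, NormedSpace.exp_zero, Matrix.trace_one, Complex.norm_natCast] at h3
  have h4 : ((N:ℝ) - N * ((γ - γ ^ 2 / 2) / K)) ^ m ≤ (N:ℝ) ^ m * Real.exp (-(m * ((γ - γ ^ 2 / 2) / K))) := by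
    have : (N:ℝ) - N * ((γ - γ ^ 2 / 2) / K) ≤ N * Real.exp (-((γ - γ ^ 2 / 2) / K)) := by
      have := Real.add_one_le_exp (-((γ - γ ^ 2 / 2) / K))
      nlinarith
    refine (pow_le_pow_left₀ (by nlinarith) this m).trans (le_of_eq ?_)
    rw [mul_pow, ← Real.exp_nat_mul]
    ring_nf
  have h5 := h3.trans (mul_le_mul_of_nonneg_right h4 (Nat.cast_nonneg _))
  have h6 : Real.exp (-(m * ((γ - γ ^ 2 / 2) / K))) = Real.exp (-(γ ^ 2 * m / (2 * K))) * Real.exp (-θ * ((1 - γ) * m / N)) := by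
    rw [← Real.exp_add]
    congr 1
    rw [hθ]
    field_simp
    ring
  rw [h6] at h5
  refine le_of_mul_le_mul_right (h5.trans (le_of_eq ?_)) (Real.exp_pos (-θ * ((1 - γ) * m / N)))
  ring
end

theorem aux_exp_pade (y : ℝ) (hy : 0 ≤ y) : Real.exp y * (1 - y / 3) ≤ 1 + 2 * y / 3 + y ^ 2 / 6 := by
  have hmono : MonotoneOn (fun y : ℝ => (1 + 2 * y / 3 + y ^ 2 / 6) * Real.exp (-y) + y / 3) (Set.Ici 0) := by
    have hder : ∀ x : ℝ, HasDerivAt (fun y : ℝ => (1 + 2 * y / 3 + y ^ 2 / 6) * Real.exp (-y) + y / 3)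
        ((2 / 3 + x / 3) * Real.exp (-x) + (1 + 2 * x / 3 + x ^ 2 / 6) * (-Real.exp (-x)) + 1 / 3) x := by
      intro x
      have h1 : HasDerivAt (fun y : ℝ => 1 + 2 * y / 3 + y ^ 2 / 6) (2 / 3 + x / 3) x := by
        have := (((hasDerivAt_id x).const_mul 2).div_const 3).const_add 1 |>.add ((hasDerivAt_pow 2 x).div_const 6)
        exact this.congr_deriv (by norm_num; ring)
      have h2 : HasDerivAt (fun y : ℝ => Real.exp (-y)) (-Real.exp (-x)) x := by
        have := (hasDerivAt_id x).neg.exp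
        exact this.congr_deriv (by simp only [Pi.neg_apply, id_eq]; ring)
      exact (h1.mul h2).add ((hasDerivAt_id x).div_const 3)
    refine monotoneOn_of_deriv_nonneg (convex_Ici 0) (fun x _ => (hder x).continuousAt.continuousWithinAt)
      (fun x _ => (hder x).differentiableAt.differentiableWithinAt) ?_
    intro x hx
    rw [interior_Ici, Set.mem_Ioi] at hx
    rw [(hder x).deriv]
    have h := Real.quadratic_le_exp_of_nonneg hx.le
    have h2 : Real.exp x * Real.exp (-x) = 1 := by rw [← Real.exp_add]; simp
    have h3 := mul_le_mul_of_nonneg_right h (Real.exp_pos (-x)).le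
    rw [h2] at h3
    nlinarith
  have h := hmono (Set.mem_Ici.2 le_rfl) (Set.mem_Ici.2 hy) hy
  simp only [neg_zero, Real.exp_zero] at h
  have h2 : Real.exp y * Real.exp (-y) = 1 := by rw [← Real.exp_add]; simp
  have h3 : 1 - y / 3 ≤ (1 + 2 * y / 3 + y ^ 2 / 6) * Real.exp (-y) := by linarith
  calc Real.exp y * (1 - y / 3) ≤ Real.exp y * ((1 + 2 * y / 3 + y ^ 2 / 6) * Real.exp (-y)) :=
        mul_le_mul_of_nonneg_left h3 (Real.exp_pos y).le
    _ = (1 + 2 * y / 3 + y ^ 2 / 6) * (Real.exp y * Real.exp (-y)) := by ring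
    _ = _ := by rw [h2, mul_one]

theorem aux_exp_bern (y b : ℝ) (hyb : y ≤ b) (hb : 0 ≤ b) (hb3 : b < 3) :
    Real.exp y ≤ 1 + y + y ^ 2 / (2 * (1 - b / 3)) := by
  have hpos : 0 < 2 * (1 - b / 3) := by linarith
  rcases le_total y 0 with hy | hy
  · refine (aux_exp_quad y hy).trans ?_
    have : y ^ 2 / 2 ≤ y ^ 2 / (2 * (1 - b / 3)) :=
      div_le_div_of_nonneg_left (sq_nonneg _) hpos (by linarith)
    linarith
  · have h := aux_exp_pade y hy
    have hpos' : 0 < 1 - y / 3 := by linarith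
    have h1 : Real.exp y ≤ 1 + y + y ^ 2 / (2 * (1 - y / 3)) := by
      rw [← le_div_iff₀ hpos'] at h
      refine h.trans (le_of_eq ?_)
      have h3 : (3 - y) ≠ 0 := by linarith
      rw [show 1 - y / 3 = (3 - y) / 3 by ring]
      field_simp
      ring
    have : y ^ 2 / (2 * (1 - y / 3)) ≤ y ^ 2 / (2 * (1 - b / 3)) :=
      div_le_div_of_nonneg_left (sq_nonneg _) hpos (by linarith)
    linarith

theorem aux_bern_step (N : ℕ) (hN : 0 < N) (Y : Fin N → ℝ) (s V θ : ℝ) (hs : 0 ≤ s) (hY : ∀ j, Y j ≤ s)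
    (hV : ∑ j, Y j ^ 2 ≤ N * V) (hθ : 0 ≤ θ) (hθs : s / 3 * θ < 1) :
    ∑ j, Real.exp (θ * Y j) ≤ N * Real.exp (θ * ((∑ j, Y j) / N) + V * θ ^ 2 / (2 * (1 - s / 3 * θ))) := by
  have hN' : (0:ℝ) < N := by exact_mod_cast hN
  have hpos : 0 < 2 * (1 - s / 3 * θ) := by linarith
  have h1 : ∀ j, Real.exp (θ * Y j) ≤ 1 + θ * Y j + Y j ^ 2 * (θ ^ 2 / (2 * (1 - s / 3 * θ))) := by
    intro j
    refine (aux_exp_bern (θ * Y j) (θ * s) (mul_le_mul_of_nonneg_left (hY j) hθ) (by positivity) (by linarith)).trans (le_of_eq ?_)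
    rw [show 1 - θ * s / 3 = 1 - s / 3 * θ by ring, mul_pow]
    ring
  refine (Finset.sum_le_sum fun j _ => h1 j).trans ?_
  rw [Finset.sum_add_distrib, Finset.sum_add_distrib, ← Finset.mul_sum, ← Finset.sum_mul]
  have h2 := Real.add_one_le_exp (θ * ((∑ j, Y j) / N) + V * θ ^ 2 / (2 * (1 - s / 3 * θ)))
  have h3 := mul_le_mul_of_nonneg_left h2 hN'.le
  refine le_trans ?_ h3
  have h4 := mul_le_mul_of_nonneg_right hV (show 0 ≤ θ ^ 2 / (2 * (1 - s / 3 * θ)) by positivity)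
  have h5 : N * (θ * ((∑ j, Y j) / N) + V * θ ^ 2 / (2 * (1 - s / 3 * θ)) + 1) =
      N + θ * ∑ j, Y j + N * V * (θ ^ 2 / (2 * (1 - s / 3 * θ))) := by
    have : (N:ℝ) * ((∑ j, Y j) / N) = ∑ j, Y j := by field_simp
    linear_combination θ * this
  rw [h5]
  simp only [Finset.sum_const, Finset.card_univ, Fintype.card_fin, nsmul_eq_mul, mul_one]
  linarith

theorem aux_bern_opt (V c L : ℝ) (hV : 0 < V) (hc : 0 ≤ c) (hL : 0 ≤ L) :
    ∃ θ : ℝ, 0 ≤ θ ∧ c * θ < 1 ∧ V * θ ^ 2 / (2 * (1 - c * θ)) - θ * (Real.sqrt (2 * V * L) + c * L) = -L := by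
  set u := Real.sqrt (2 * L / V) with hu
  have hu0 : 0 ≤ u := Real.sqrt_nonneg _
  have hu2 : u ^ 2 = 2 * L / V := Real.sq_sqrt (by positivity)
  have hVu : V * u ^ 2 = 2 * L := by rw [hu2]; field_simp
  have hsq : Real.sqrt (2 * V * L) = V * u := by
    rw [show 2 * V * L = (V * u) ^ 2 by rw [mul_pow, hu2]; field_simp]
    exact Real.sqrt_sq (by positivity)
  have hp : 0 < 1 + c * u := by positivity
  refine ⟨u / (1 + c * u), by positivity, ?_, ?_⟩
  · rw [← mul_div_assoc, div_lt_one hp]; linarith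
  · rw [hsq]
    have e : 1 - c * (u / (1 + c * u)) = 1 / (1 + c * u) := by field_simp; ring
    rw [e]
    have e2 : V * (u / (1 + c * u)) ^ 2 / (2 * (1 / (1 + c * u))) = V * u ^ 2 / (2 * (1 + c * u)) := by
      field_simp
    rw [e2, hVu]
    have e3 : u / (1 + c * u) * (V * u + c * L) = (V * u ^ 2 + c * u * L) / (1 + c * u) := by
      field_simp
    rw [e3, hVu]
    field_simp
    ring

/-- Scalar one-sided Bernstein inequality for sampling with replacement. -/
theorem aux_bern_scalar (N m : ℕ) (hN : 0 < N) (hm : 0 < m) (Y : Fin N → ℝ) (s V L : ℝ) (hs : 0 ≤ s) (hY : ∀ j, Y j ≤ s)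
    (hV : ∑ j, Y j ^ 2 ≤ N * V) (h0 : ∑ j, Y j = 0) (hL : 0 ≤ L) :
    (Set.ncard {ω : Fin m → Fin N | Real.sqrt (2 * (m * V) * L) + s / 3 * L < ∑ k, Y (ω k)} : ℝ) ≤
      (N:ℝ) ^ m * Real.exp (-L) := by
  have hN' : (0:ℝ) < N := by exact_mod_cast hN
  have hm' : (0:ℝ) < m := by exact_mod_cast hm
  rcases lt_or_ge 0 V with hVp | hVn
  · obtain ⟨θ, hθ0, hθ1, hθ⟩ := aux_bern_opt (m * V) (s / 3) L (by positivity) (by positivity) hL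
    have h1 := aux_markov (fun ω : Fin m → Fin N => Real.sqrt (2 * (m * V) * L) + s / 3 * L < ∑ k, Y (ω k))
      (fun ω => Real.exp (θ * ∑ k, Y (ω k))) (Real.exp (θ * (Real.sqrt (2 * (m * V) * L) + s / 3 * L)))
      (fun _ => (Real.exp_pos _).le) (fun ω hω => Real.exp_le_exp.2 (mul_le_mul_of_nonneg_left hω.le hθ0))
    have h2 : ∑ ω : Fin m → Fin N, Real.exp (θ * ∑ k, Y (ω k)) = (∑ j, Real.exp (θ * Y j)) ^ m := by
      rw [Fintype.sum_pow]
      refine Finset.sum_congr rfl fun ω _ => ?_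
      rw [Finset.mul_sum, Real.exp_sum]
    have h3 := aux_bern_step N hN Y s V θ hs hY hV hθ0 hθ1
    rw [h0, zero_div, mul_zero, zero_add] at h3
    rw [h2] at h1
    have h4 := h1.trans (pow_le_pow_left₀ (Finset.sum_nonneg fun _ _ => (Real.exp_pos _).le) h3 m)
    rw [mul_pow, ← Real.exp_nat_mul] at h4
    refine le_of_mul_le_mul_right (h4.trans (le_of_eq ?_)) (Real.exp_pos (θ * (Real.sqrt (2 * (m * V) * L) + s / 3 * L)))
    rw [mul_assoc, ← Real.exp_add]
    congr 2
    rw [← hθ]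
    ring
  · have hz : ∑ j, Y j ^ 2 = 0 := le_antisymm (hV.trans (by nlinarith)) (Finset.sum_nonneg fun _ _ => sq_nonneg _)
    rw [Finset.sum_eq_zero_iff_of_nonneg (fun _ _ => sq_nonneg _)] at hz
    have hz' : ∀ j, Y j = 0 := fun j => by simpa using hz j (Finset.mem_univ j)
    have : {ω : Fin m → Fin N | Real.sqrt (2 * (m * V) * L) + s / 3 * L < ∑ k, Y (ω k)} = ∅ := by
      ext ω
      simp only [hz', Finset.sum_const_zero, Set.mem_ofPred_eq, Set.mem_empty_iff_false, iff_false, not_lt]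
      positivity
    rw [this]
    simp
    positivity

theorem aux_bern_vec_mgf {E : Type*} [NormedAddCommGroup E] (N : ℕ) (hN : 0 < N) (w : Fin N → E) (s V θ : ℝ)
    (hs : 0 ≤ s) (hw : ∀ j, ‖w j‖ ≤ s) (hV : ∑ j, ‖w j‖ ^ 2 ≤ N * V) (hθ : 0 ≤ θ) (hθs : s / 3 * θ < 1) (m : ℕ) :
    ∀ F : E → ℝ, (∀ x y, |F x - F y| ≤ ‖x - y‖) →
      ∑ ω : Fin m → Fin N, Real.exp (θ * F (∑ k, w (ω k))) ≤
        (N:ℝ) ^ m * Real.exp (θ * ((∑ ω : Fin m → Fin N, F (∑ k, w (ω k))) / (N:ℝ) ^ m) + m * (V * θ ^ 2 / (2 * (1 - s / 3 * θ)))) := by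
  have hN' : (0:ℝ) < N := by exact_mod_cast hN
  set ψ := V * θ ^ 2 / (2 * (1 - s / 3 * θ)) with hψ
  induction m with
  | zero => intro F _; simp
  | succ m ih =>
    intro F hF
    rw [aux_sum_cons, aux_sum_cons]
    simp only [Fin.sum_univ_succ, Fin.cons_zero, Fin.cons_succ]
    set G : E → ℝ := fun x => (∑ ω : Fin m → Fin N, F (x + ∑ k, w (ω k))) / (N:ℝ) ^ m with hG
    have hGL : ∀ x y, |G x - G y| ≤ ‖x - y‖ := by
      intro x y
      rw [hG]
      simp only
      rw [← sub_div, ← Finset.sum_sub_distrib, abs_div, abs_of_pos (by positivity : (0:ℝ) < (N:ℝ) ^ m), div_le_iff₀ (by positivity)]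
      refine (Finset.abs_sum_le_sum_abs _ _).trans ?_
      refine (Finset.sum_le_sum fun ω _ => hF _ _).trans ?_
      simp [mul_comm]
    have h1 : ∀ j, ∑ ω : Fin m → Fin N, Real.exp (θ * F (w j + ∑ k, w (ω k))) ≤
        (N:ℝ) ^ m * Real.exp (θ * G (w j) + m * ψ) := by
      intro j
      exact ih (fun x => F (w j + x)) (fun x y => by simpa using hF (w j + x) (w j + y))
    refine (Finset.sum_le_sum fun j _ => h1 j).trans ?_
    have h2 := aux_bern_step N hN (fun j => G (w j) - G 0) s V θ hs
      (fun j => (le_abs_self _).trans ((hGL _ _).trans (by simpa using hw j)))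
      ((Finset.sum_le_sum fun j _ => by
        rw [← sq_abs]
        exact pow_le_pow_left₀ (abs_nonneg _) (by simpa using hGL (w j) 0) 2).trans hV) hθ hθs
    rw [← hψ] at h2
    have h3 : ∑ j, (G (w j) - G 0) = ∑ j, G (w j) - N * G 0 := by
      rw [Finset.sum_sub_distrib]; simp
    have h4 : ∀ j, (N:ℝ) ^ m * Real.exp (θ * G (w j) + m * ψ) =
        (N:ℝ) ^ m * Real.exp (θ * G 0 + m * ψ) * Real.exp (θ * (G (w j) - G 0)) := by
      intro j
      rw [mul_assoc, ← Real.exp_add]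
      congr 2
      ring
    simp only [h4]
    rw [← Finset.mul_sum]
    refine (mul_le_mul_of_nonneg_left h2 (by positivity)).trans (le_of_eq ?_)
    have h5 : (∑ j, ∑ ω : Fin m → Fin N, F (w j + ∑ k, w (ω k))) / (N:ℝ) ^ (m+1) = (∑ j, G (w j)) / N := by
      rw [hG]
      simp only
      rw [← Finset.sum_div, div_div, pow_succ]
    rw [h5, h3, pow_succ]
    have : ∀ a b : ℝ, (N:ℝ) ^ m * Real.exp a * (N * Real.exp b) = (N:ℝ) ^ m * N * Real.exp (a + b) := by
      intro a b; rw [Real.exp_add]; ring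
    rw [this]
    congr 2
    push_cast
    field_simp
    ring

theorem aux_second_moment {E : Type*} [NormedAddCommGroup E] [InnerProductSpace ℝ E] (N : ℕ) (hN : 0 < N) (w : Fin N → E)
    (h0 : ∑ j, w j = 0) (V : ℝ) (hV : ∑ j, ‖w j‖ ^ 2 ≤ N * V) (m : ℕ) :
    ∀ x : E, ∑ ω : Fin m → Fin N, ‖x + ∑ k, w (ω k)‖ ^ 2 ≤ (N:ℝ) ^ m * (‖x‖ ^ 2 + m * V) := by
  have hN' : (0:ℝ) < N := by exact_mod_cast hN
  induction m with
  | zero => intro x; simp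
  | succ m ih =>
    intro x
    rw [aux_sum_cons]
    simp only [Fin.sum_univ_succ, Fin.cons_zero, Fin.cons_succ, ← add_assoc]
    refine (Finset.sum_le_sum fun j _ => ih (x + w j)).trans ?_
    rw [← Finset.mul_sum, pow_succ, mul_assoc]
    refine mul_le_mul_of_nonneg_left ?_ (by positivity)
    have h1 : ∀ j, ‖x + w j‖ ^ 2 = ‖x‖ ^ 2 + 2 * inner ℝ x (w j) + ‖w j‖ ^ 2 := fun j => norm_add_sq_real _ _
    simp only [h1]
    rw [Finset.sum_add_distrib, Finset.sum_add_distrib, Finset.sum_add_distrib, ← Finset.mul_sum, ← inner_sum, h0]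
    simp
    linarith

/-- Vector Bernstein inequality (dimension free). -/
theorem aux_bern_vec {E : Type*} [NormedAddCommGroup E] [InnerProductSpace ℝ E] (N m : ℕ) (hN : 0 < N) (hm : 0 < m)
    (w : Fin N → E) (h0 : ∑ j, w j = 0) (s V L : ℝ) (hs : 0 ≤ s) (hw : ∀ j, ‖w j‖ ≤ s)
    (hVp : 0 < V) (hV : ∑ j, ‖w j‖ ^ 2 ≤ N * V) (hL : 0 ≤ L) :
    (Set.ncard {ω : Fin m → Fin N | Real.sqrt (m * V) + Real.sqrt (2 * (m * V) * L) + s / 3 * L < ‖∑ k, w (ω k)‖} : ℝ) ≤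
      (N:ℝ) ^ m * Real.exp (-L) := by
  have hN' : (0:ℝ) < N := by exact_mod_cast hN
  have hm' : (0:ℝ) < m := by exact_mod_cast hm
  obtain ⟨θ, hθ0, hθ1, hθ⟩ := aux_bern_opt (m * V) (s / 3) L (by positivity) (by positivity) hL
  have h1 := aux_markov (fun ω : Fin m → Fin N => Real.sqrt (m * V) + Real.sqrt (2 * (m * V) * L) + s / 3 * L < ‖∑ k, w (ω k)‖)
    (fun ω => Real.exp (θ * ‖∑ k, w (ω k)‖)) (Real.exp (θ * (Real.sqrt (m * V) + Real.sqrt (2 * (m * V) * L) + s / 3 * L)))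
    (fun _ => (Real.exp_pos _).le) (fun ω hω => Real.exp_le_exp.2 (mul_le_mul_of_nonneg_left hω.le hθ0))
  have h2 := aux_bern_vec_mgf N hN w s V θ hs hw hV hθ0 hθ1 m (fun x => ‖x‖) (fun x y => abs_norm_sub_norm_le x y)
  have h3 : (∑ ω : Fin m → Fin N, ‖∑ k, w (ω k)‖) / (N:ℝ) ^ m ≤ Real.sqrt (m * V) := by
    apply Real.le_sqrt_of_sq_le
    have h4 := aux_second_moment N hN w h0 V hV m 0
    simp only [zero_add, norm_zero] at h4
    have h5 := sq_sum_le_card_mul_sum_sq (s := (Finset.univ : Finset (Fin m → Fin N))) (f := fun ω => ‖∑ k, w (ω k)‖)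
    simp only [Finset.card_univ, Fintype.card_fun, Fintype.card_fin] at h5
    push_cast at h5
    rw [div_pow, div_le_iff₀ (by positivity)]
    have h6 := h5.trans (mul_le_mul_of_nonneg_left h4 (by positivity))
    refine h6.trans (le_of_eq ?_)
    ring
  have h7 := h1.trans h2
  have h8 := h7.trans (mul_le_mul_of_nonneg_left (Real.exp_le_exp.2 (add_le_add_left (mul_le_mul_of_nonneg_left h3 hθ0) _)) (by positivity))
  refine le_of_mul_le_mul_right (h8.trans (le_of_eq ?_)) (Real.exp_pos (θ * (Real.sqrt (m * V) + Real.sqrt (2 * (m * V) * L) + s / 3 * L)))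
  rw [mul_assoc, ← Real.exp_add]
  congr 2
  rw [← hθ]
  ring

theorem aux_union (N m : ℕ) (hN : 0 < N) (δ : ℝ) (P P1 P2 P3 P4 : (Fin m → Fin N) → Prop)
    (h : ∀ ω, ¬ P1 ω → ¬ P2 ω → ¬ P3 ω → ¬ P4 ω → P ω)
    (h1 : (Set.ncard {ω | P1 ω} : ℝ) ≤ (N:ℝ) ^ m * δ) (h2 : (Set.ncard {ω | P2 ω} : ℝ) ≤ (N:ℝ) ^ m * δ)
    (h3 : (Set.ncard {ω | P3 ω} : ℝ) ≤ (N:ℝ) ^ m * δ) (h4 : (Set.ncard {ω | P4 ω} : ℝ) ≤ (N:ℝ) ^ m * δ) :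
    1 - 4 * δ ≤ (Set.ncard {ω | P ω} : ℝ) / (N:ℝ) ^ m := by
  have hN' : (0:ℝ) < N := by exact_mod_cast hN
  have hsub : (Set.univ : Set (Fin m → Fin N)) ⊆ {ω | P ω} ∪ ({ω | P1 ω} ∪ ({ω | P2 ω} ∪ ({ω | P3 ω} ∪ {ω | P4 ω}))) := by
    intro ω _
    by_cases a1 : P1 ω
    · exact Or.inr (Or.inl a1)
    by_cases a2 : P2 ω
    · exact Or.inr (Or.inr (Or.inl a2))
    by_cases a3 : P3 ω
    · exact Or.inr (Or.inr (Or.inr (Or.inl a3)))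
    by_cases a4 : P4 ω
    · exact Or.inr (Or.inr (Or.inr (Or.inr a4)))
    exact Or.inl (h ω a1 a2 a3 a4)
  have hc := Set.ncard_le_ncard hsub (Set.toFinite _)
  have c1 := Set.ncard_union_le {ω | P ω} ({ω | P1 ω} ∪ ({ω | P2 ω} ∪ ({ω | P3 ω} ∪ {ω | P4 ω})))
  have c2 := Set.ncard_union_le {ω | P1 ω} ({ω | P2 ω} ∪ ({ω | P3 ω} ∪ {ω | P4 ω}))
  have c3 := Set.ncard_union_le {ω | P2 ω} ({ω | P3 ω} ∪ {ω | P4 ω})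
  have c4 := Set.ncard_union_le {ω | P3 ω} {ω | P4 ω}
  have hu : (Set.univ : Set (Fin m → Fin N)).ncard = N ^ m := by
    rw [Set.ncard_univ, Nat.card_eq_fintype_card]; simp
  have hfin : N ^ m ≤ Set.ncard {ω | P ω} + (Set.ncard {ω | P1 ω} + (Set.ncard {ω | P2 ω} + (Set.ncard {ω | P3 ω} + Set.ncard {ω | P4 ω}))) := by
    omega
  have hfin' : (N:ℝ) ^ m ≤ Set.ncard {ω | P ω} + (Set.ncard {ω | P1 ω} + (Set.ncard {ω | P2 ω} + (Set.ncard {ω | P3 ω} + Set.ncard {ω | P4 ω}))) := by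
    exact_mod_cast hfin
  rw [le_div_iff₀ (by positivity)]
  linarith

theorem aux_dot_self {ι : Type*} [Fintype ι] (x : ι → ℂ) : (star x ⬝ᵥ x).re = ∑ i, ‖x i‖ ^ 2 := by
  simp only [dotProduct, Complex.re_sum, Pi.star_apply]
  refine Finset.sum_congr rfl fun i _ => ?_
  have h : star (x i) * x i = ((‖x i‖ ^ 2 : ℝ) : ℂ) := by
    push_cast; rw [← Complex.conj_mul']; rfl
  rw [h, Complex.ofReal_re]

theorem aux_dot_comm_re {ι : Type*} [Fintype ι] (x y : ι → ℂ) : (star x ⬝ᵥ y).re = (star y ⬝ᵥ x).re := by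
  have h : star x ⬝ᵥ y = star (star y ⬝ᵥ x) := by
    rw [Matrix.star_dotProduct]
  rw [h]; simp

theorem aux_dot_adj {ι κ : Type*} [Fintype ι] [Fintype κ] (A : Matrix ι κ ℂ) (x : ι → ℂ) (u : κ → ℂ) :
    star x ⬝ᵥ (A *ᵥ u) = star (Aᴴ *ᵥ x) ⬝ᵥ u := by
  rw [Matrix.star_mulVec, Matrix.conjTranspose_conjTranspose, Matrix.dotProduct_mulVec]

open scoped ComplexOrder in
theorem aux_det {n p : Type*} [Fintype n] [DecidableEq n] [Fintype p] (m : ℕ) (A : Fin m → Matrix p n ℂ)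
    (b : Fin m → p → ℂ) (g : ℝ) (hg : 0 < g)
    (hpsd : ((∑ k, (A k)ᴴ * A k) - g • (1 : Matrix n n ℂ)).PosSemidef) :
    IsUnit (∑ k, (A k)ᴴ * A k) ∧
    0 ≤ (star (∑ k, (A k)ᴴ *ᵥ b k) ⬝ᵥ ((∑ k, (A k)ᴴ * A k)⁻¹ *ᵥ (∑ k, (A k)ᴴ *ᵥ b k))).re ∧
    g * (star (∑ k, (A k)ᴴ *ᵥ b k) ⬝ᵥ ((∑ k, (A k)ᴴ * A k)⁻¹ *ᵥ (∑ k, (A k)ᴴ *ᵥ b k))).re ≤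
      ∑ i, ‖(∑ k, (A k)ᴴ *ᵥ b k) i‖ ^ 2 ∧
    (star (∑ k, (A k)ᴴ *ᵥ b k) ⬝ᵥ ((∑ k, (A k)ᴴ * A k)⁻¹ *ᵥ (∑ k, (A k)ᴴ *ᵥ b k))).re ≤
      ∑ k, ∑ i, ‖b k i‖ ^ 2 := by
  set G := ∑ k, (A k)ᴴ * A k with hG
  set v := ∑ k, (A k)ᴴ *ᵥ b k with hv
  have hsm : g • (1 : Matrix n n ℂ) = (g : ℂ) • (1 : Matrix n n ℂ) := by
    ext i j; simp
  have hpd : G.PosDef := by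
    have h1 : (g • (1 : Matrix n n ℂ)).PosDef := by
      rw [hsm]
      exact Matrix.PosDef.one.smul (by exact_mod_cast hg)
    have := h1.add_posSemidef hpsd
    simpa using this
  have hU : IsUnit G := hpd.isUnit
  have hGH : G.IsHermitian := hpd.1
  refine ⟨hU, ?_⟩
  set u := G⁻¹ *ᵥ v with hu
  have hGu : G *ᵥ u = v := by
    rw [hu, Matrix.mulVec_mulVec, Matrix.mul_nonsing_inv _ ((Matrix.isUnit_iff_isUnit_det _).1 hU), Matrix.one_mulVec]
  have hq : star v ⬝ᵥ u = star u ⬝ᵥ (G *ᵥ u) := by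
    rw [aux_dot_adj G u u, hGH.eq, hGu]
  have hlow : g * (star u ⬝ᵥ u).re ≤ (star v ⬝ᵥ u).re := by
    have h := hpsd.dotProduct_mulVec_nonneg u
    rw [Matrix.sub_mulVec, dotProduct_sub, ← hq, hsm, Matrix.smul_mulVec, Matrix.one_mulVec, dotProduct_smul, Complex.le_def] at h
    have h1 := h.1
    simp only [smul_eq_mul, Complex.zero_re, Complex.sub_re, Complex.re_ofReal_mul] at h1
    linarith
  have huu : 0 ≤ (star u ⬝ᵥ u).re := by rw [aux_dot_self]; positivity
  refine ⟨(mul_nonneg hg.le huu).trans hlow, ?_, ?_⟩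
  · have h : 0 ≤ (star (v - (g:ℂ) • u) ⬝ᵥ (v - (g:ℂ) • u)).re := by rw [aux_dot_self]; positivity
    have e : (star (v - (g:ℂ) • u) ⬝ᵥ (v - (g:ℂ) • u)).re =
        (star v ⬝ᵥ v).re - 2 * g * (star v ⬝ᵥ u).re + g ^ 2 * (star u ⬝ᵥ u).re := by
      rw [star_sub, star_smul, sub_dotProduct, dotProduct_sub, dotProduct_sub, smul_dotProduct, smul_dotProduct,
        dotProduct_smul, dotProduct_smul]
      simp only [smul_eq_mul, Complex.sub_re, RCLike.star_def, Complex.conj_ofReal, Complex.re_ofReal_mul]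
      rw [aux_dot_comm_re u v]
      ring
    rw [e, aux_dot_self v] at h
    nlinarith
  · have h : ∀ k, (star (b k - A k *ᵥ u) ⬝ᵥ (b k - A k *ᵥ u)).re =
        ∑ i, ‖b k i‖ ^ 2 - 2 * (star ((A k)ᴴ *ᵥ b k) ⬝ᵥ u).re + (star u ⬝ᵥ (((A k)ᴴ * A k) *ᵥ u)).re := by
      intro k
      rw [star_sub, sub_dotProduct, dotProduct_sub, dotProduct_sub]
      simp only [Complex.sub_re]
      rw [aux_dot_self, aux_dot_comm_re (A k *ᵥ u) (b k), aux_dot_adj (A k) (b k), aux_dot_adj (A k) (A k *ᵥ u),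
        Matrix.mulVec_mulVec, aux_dot_comm_re u]
      ring
    have h2 : 0 ≤ ∑ k, (star (b k - A k *ᵥ u) ⬝ᵥ (b k - A k *ᵥ u)).re :=
      Finset.sum_nonneg fun k _ => by rw [aux_dot_self]; positivity
    simp only [h] at h2
    rw [Finset.sum_add_distrib, Finset.sum_sub_distrib, ← Finset.mul_sum, ← Complex.re_sum, ← Complex.re_sum,
      ← sum_dotProduct, ← star_sum, ← hv, ← dotProduct_sum, ← Matrix.sum_mulVec, ← hG, ← hq] at h2
    linarith

theorem aux_frob {p n : Type*} [Fintype p] [Fintype n] (A : Matrix p n ℂ) :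
    (Aᴴ * A).trace.re = ∑ i, ∑ l, ‖A i l‖ ^ 2 := by
  simp only [Matrix.trace, Matrix.diag_apply, Matrix.mul_apply, Matrix.conjTranspose_apply, Complex.re_sum]
  rw [Finset.sum_comm]
  refine Finset.sum_congr rfl fun i _ => Finset.sum_congr rfl fun j _ => ?_
  have h : star (A i j) * A i j = ((‖A i j‖ ^ 2 : ℝ) : ℂ) := by
    push_cast; rw [← Complex.conj_mul']; rfl
  rw [h, Complex.ofReal_re]

theorem aux_frob_mulVec {p n : Type*} [Fintype p] [Fintype n] (A : Matrix p n ℂ) (x : p → ℂ) :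
    ∑ l, ‖(Aᴴ *ᵥ x) l‖ ^ 2 ≤ (∑ i, ∑ l, ‖A i l‖ ^ 2) * ∑ i, ‖x i‖ ^ 2 := by
  rw [Finset.sum_comm, Finset.sum_mul]
  refine Finset.sum_le_sum fun l _ => ?_
  have h : ‖(Aᴴ *ᵥ x) l‖ ≤ ∑ i, ‖A i l‖ * ‖x i‖ := by
    simp only [Matrix.mulVec, dotProduct, Matrix.conjTranspose_apply]
    refine (norm_sum_le _ _).trans (Finset.sum_le_sum fun i _ => ?_)
    simp
  exact (pow_le_pow_left₀ (norm_nonneg _) h 2).trans (Finset.sum_mul_sq_le_sq_mul_sq _ _ _)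

theorem aux_numeric (L m M K K₀ γ α β : ℝ) (hL : 0 ≤ L) (hm : 0 < m) (hM : 0 ≤ M) (hK : 1 ≤ K) (hK₀ : K ≤ K₀)
    (hγ : 0 ≤ γ) (hγ1 : γ < 1) (hmL : 8 / 3 * L ≤ m)
    (hα : α = Real.sqrt (2 * M / m * L) + 2 * M / (3 * m) * L) (hα1 : α < 1)
    (hβ : β = (1 + 2 * Real.sqrt L) ^ 2) :
    Real.sqrt (2 * (m * M) * L) + 1 / 3 * L + K * (1 + Real.sqrt (2 * L) + Real.sqrt ((M + 1) / m) / 3 * L) ^ 2 / (1 - γ)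
      ≤ m * α + K₀ * β / (1 - γ) := by
  set r := Real.sqrt L with hr
  have hr0 : 0 ≤ r := Real.sqrt_nonneg _
  have hr2 : r ^ 2 = L := Real.sq_sqrt hL
  set p := Real.sqrt ((M + 1) * L / m) with hp
  have hp0 : 0 ≤ p := Real.sqrt_nonneg _
  have hp2 : p ^ 2 = (M + 1) * L / m := Real.sq_sqrt (by positivity)
  have e1 : Real.sqrt (2 * L) = Real.sqrt 2 * r := Real.sqrt_mul (by norm_num) L
  have e2 : Real.sqrt ((M + 1) / m) * L = p * r := by
    rw [hp, mul_div_right_comm, Real.sqrt_mul (by positivity), ← hr, mul_assoc, ← pow_two, hr2]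
  have e3 : m * α = Real.sqrt (2 * (m * M) * L) + 2 * M * L / 3 := by
    rw [hα, mul_add]
    congr 1
    · have : 2 * (m * M) * L = m ^ 2 * (2 * M / m * L) := by field_simp
      rw [this, Real.sqrt_mul (sq_nonneg m), Real.sqrt_sq hm.le]
    · field_simp
  have hq : 2 * M / m * L < 1 := by
    have h1 : Real.sqrt (2 * M / m * L) < 1 := by
      have : 0 ≤ 2 * M / (3 * m) * L := by positivity
      linarith
    rw [Real.sqrt_lt' one_pos] at h1
    simpa using h1
  have hp3 : p ^ 2 ≤ 7 / 8 := by
    have h1 : (M + 1) * L / m = (2 * M / m * L) / 2 + L / m := by field_simp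
    have h2 : L / m ≤ 3 / 8 := by rw [div_le_iff₀ hm]; linarith
    rw [hp2, h1]; linarith
  have hp4 : p ≤ 19 / 20 := by nlinarith
  have hs2 : Real.sqrt 2 ≤ 3 / 2 := by
    rw [Real.sqrt_le_left (by norm_num)]; norm_num
  set a := Real.sqrt 2 + p / 3 with ha
  have ha0 : 0 ≤ a := by positivity
  have ha1 : a ≤ 11 / 6 := by rw [ha]; linarith
  have eT : 1 + Real.sqrt (2 * L) + Real.sqrt ((M + 1) / m) / 3 * L = 1 + a * r := by
    rw [e1, ha]; linear_combination e2 / 3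
  rw [eT, e3, hβ]
  have hT : (1 + a * r) ^ 2 + L / 3 ≤ (1 + 2 * r) ^ 2 := by
    rw [← hr2]
    have h1 : a * r ≤ 11 / 6 * r := mul_le_mul_of_nonneg_right ha1 hr0
    have h2 : 0 ≤ a * r := by positivity
    nlinarith
  have hg : 0 < 1 - γ := by linarith
  have h1 : L / 3 ≤ (K₀ * (1 + 2 * r) ^ 2 - K * (1 + a * r) ^ 2) / (1 - γ) := by
    rw [le_div_iff₀ hg]
    have h2 : K * (1 + 2 * r) ^ 2 ≤ K₀ * (1 + 2 * r) ^ 2 := mul_le_mul_of_nonneg_right hK₀ (sq_nonneg _)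
    have h3 : K * ((1 + a * r) ^ 2 + L / 3) ≤ K * (1 + 2 * r) ^ 2 := mul_le_mul_of_nonneg_left hT (by linarith)
    have h4 : L / 3 ≤ K * (L / 3) := le_mul_of_one_le_left (by positivity) hK
    have h5 : 0 ≤ L / 3 * γ := by positivity
    linarith
  rw [sub_div] at h1
  have h6 : 0 ≤ 2 * M * L / 3 := by positivity
  linarith


theorem aux_bern_coord {ι : Type*} [Fintype ι] (N m : ℕ) (hN : 0 < N) (hm : 0 < m)
    (w : Fin N → ι → ℂ) (h0 : ∑ j, w j = 0) (s V L : ℝ) (hs : 0 ≤ s) (hw : ∀ j, ∑ i, ‖w j i‖ ^ 2 ≤ s ^ 2)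
    (hVp : 0 < V) (hV : ∑ j, ∑ i, ‖w j i‖ ^ 2 ≤ N * V) (hL : 0 ≤ L) :
    (Set.ncard {ω : Fin m → Fin N | Real.sqrt (m * V) + Real.sqrt (2 * (m * V) * L) + s / 3 * L <
      Real.sqrt (∑ i, ‖(∑ k, w (ω k)) i‖ ^ 2)} : ℝ) ≤
      (N:ℝ) ^ m * Real.exp (-L) := by
  let : InnerProductSpace ℝ (EuclideanSpace ℂ ι) := InnerProductSpace.rclikeToReal ℂ (EuclideanSpace ℂ ι)
  have hs0 : ∀ (q : ℕ) (f : Fin q → ι → ℂ), ∑ j, (WithLp.toLp 2 (f j) : EuclideanSpace ℂ ι) = WithLp.toLp 2 (∑ j, f j) := by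
    intro q f
    ext i; simp
  have h := aux_bern_vec (E := EuclideanSpace ℂ ι) N m hN hm (fun j => WithLp.toLp 2 (w j))
    (by rw [hs0, h0]; rfl) s V L hs
    (fun j => by
      rw [← abs_of_nonneg (norm_nonneg _)]
      apply abs_le_of_sq_le_sq _ hs
      rw [EuclideanSpace.norm_sq_eq]; exact hw j)
    hVp (by simp only [EuclideanSpace.norm_sq_eq]; exact hV) hL
  have e : ∀ ω : Fin m → Fin N, ‖∑ k, (WithLp.toLp 2 (w (ω k)) : EuclideanSpace ℂ ι)‖ = Real.sqrt (∑ i, ‖(∑ k, w (ω k)) i‖ ^ 2) := by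
    intro ω
    rw [hs0, EuclideanSpace.norm_eq]
  simp only [e] at h
  exact h


open scoped ComplexOrder in
def AuxPSD {n : Type*} [Fintype n] (X : Matrix n n ℂ) : Prop := X.PosSemidef

open scoped ComplexOrder in
theorem aux_matrix_chernoff' {p n : Type*} [Fintype p] [Fintype n] [DecidableEq n] [Nonempty n] (N : ℕ) (hN0 : 0 < N)
    (A : Fin N → Matrix p n ℂ) (hsum : ∑ j, (A j)ᴴ * A j = 1)
    (K : ℝ) (hK : 1 ≤ K) (hR : ∀ j, ((A j)ᴴ * A j).trace.re ≤ K / N) (m : ℕ) (γ : ℝ) (hγ : 0 ≤ γ) (hγ1 : γ ≤ 1) :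
    (Set.ncard {ω : Fin m → Fin N |
      ¬ AuxPSD ((∑ k, (A (ω k))ᴴ * A (ω k)) - ((1 - γ) * m / N) • (1 : Matrix n n ℂ))} : ℝ) ≤
      (N : ℝ) ^ m * (Fintype.card n * Real.exp (-(γ ^ 2 * m / (2 * K)))) :=
  aux_matrix_chernoff N hN0 (fun j => (A j)ᴴ * A j) (fun j => Matrix.posSemidef_conjTranspose_mul_self (A j)) hsum K hK hR m γ hγ hγ1

/-- **Corollary 3 (Theorem 1 under the bound `c ≤ √n₃`, the DCT case).**
Sampling with replacement is modeled by the uniform distribution on the finite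
sample space `Fin m → Fin n₁`, probabilities being `#(event) / n₁ ^ m`. -/
theorem tensor_matched_subspace_tubal_energy_estimation_dct
    (n₁ n₂ n₃ m : ℕ) (hn₁ : 0 < n₁) (hn₂ : 0 < n₂) (hn₃ : 0 < n₃) (hm : 0 < m)
    (c μ δ : ℝ) (hc : 0 < c) (hc' : c ≤ Real.sqrt n₃) (hμ : 1 ≤ μ) (hδ : 0 < δ)
    (A : Fin n₁ → Matrix (Fin n₃) (Fin (n₂ * n₃)) ℂ)
    (hA : ∑ j, (A j)ᴴ * A j = 1)
    (hAF : ∀ j, ∑ i, ∑ l, ‖A j i l‖ ^ 2 ≤ c ^ 2 * n₂ * μ / n₁)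
    (b : Fin n₁ → Fin n₃ → ℂ)
    (hb : ∃ j, b j ≠ 0)
    (horth : ∑ j, (A j)ᴴ *ᵥ b j = 0)
    (B Bmax : ℝ)
    (hB : B = ∑ j, ∑ i, ‖b j i‖ ^ 2)
    (hBmax : IsGreatest (Set.range fun j => ∑ i, ‖b j i‖ ^ 2) Bmax)
    (hsize : (8 / 3 : ℝ) * c ^ 2 * n₂ * μ * Real.log (2 * n₂ * n₃ / δ) ≤ m)
    (γ α β : ℝ)
    (hγ : γ = Real.sqrt (8 * c ^ 2 * n₂ * μ * Real.log (2 * n₂ * n₃ / δ) / (3 * m)))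
    (hγ1 : γ < 1)
    (hα : α = Real.sqrt (2 * (n₁ * Bmax - B) / (m * B) * Real.log (1 / δ))
            + 2 * (n₁ * Bmax - B) / (3 * m * B) * Real.log (1 / δ))
    (hβ : β = (1 + 2 * Real.sqrt (Real.log (1 / δ))) ^ 2) :
    1 - 4 * δ ≤
      (Set.ncard {ω : Fin m → Fin n₁ |
        let G : Matrix (Fin (n₂ * n₃)) (Fin (n₂ * n₃)) ℂ := ∑ k, (A (ω k))ᴴ * A (ω k)
        let v : Fin (n₂ * n₃) → ℂ := ∑ k, (A (ω k))ᴴ *ᵥ b (ω k)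
        let Q : ℝ := (∑ k, ∑ i, ‖b (ω k) i‖ ^ 2) - (star v ⬝ᵥ (G⁻¹ *ᵥ v)).re
        IsUnit G ∧
        (m * (1 - α) - (n₃ : ℝ) * n₂ * μ * β / (1 - γ)) / n₁ * B ≤ Q ∧
        Q ≤ (1 + α) * (m / n₁) * B} : ℝ) / (n₁ : ℝ) ^ m := by
  classical
  have hN : (0:ℝ) < n₁ := by exact_mod_cast hn₁
  have hmR : (0:ℝ) < m := by exact_mod_cast hm
  have hn2R : (1:ℝ) ≤ n₂ := by exact_mod_cast hn₂
  have hn3R : (1:ℝ) ≤ n₃ := by exact_mod_cast hn₃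
  by_cases hδ4 : 1 / 4 ≤ δ
  · have : (1:ℝ) - 4 * δ ≤ 0 := by linarith
    exact this.trans (by positivity)
  push Not at hδ4
  set L := Real.log (1 / δ) with hLdef
  have hL : 0 ≤ L := Real.log_nonneg (by rw [le_div_iff₀ hδ]; linarith)
  have hexpL : Real.exp (-L) = δ := by
    rw [hLdef, one_div, Real.log_inv, neg_neg, Real.exp_log hδ]
  set Λ := Real.log (2 * n₂ * n₃ / δ) with hΛdef
  have hn23 : (1:ℝ) ≤ n₂ * n₃ := by nlinarith
  have hΛL : L ≤ Λ := by
    apply Real.log_le_log (by positivity)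
    gcongr
    linarith
  have hΛ0 : 0 ≤ Λ := hL.trans hΛL
  obtain ⟨K, hKdef⟩ : ∃ K : ℝ, K = c ^ 2 * n₂ * μ := ⟨_, rfl⟩
  have hKK₀ : K ≤ (n₃ : ℝ) * n₂ * μ := by
    have : c ^ 2 ≤ n₃ := by
      have := pow_le_pow_left₀ hc.le hc' 2
      rwa [Real.sq_sqrt (by positivity)] at this
    rw [hKdef]
    gcongr
  have hFK : ∀ j, ∑ i, ∑ l, ‖A j i l‖ ^ 2 ≤ K / n₁ := by rw [hKdef]; exact hAF
  have hK1 : (1:ℝ) ≤ K := by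
    have h1 : (∑ j, (A j)ᴴ * A j).trace.re = (n₂ * n₃ : ℝ) := by
      rw [hA, Matrix.trace_one]; simp
    rw [Matrix.trace_sum, Complex.re_sum] at h1
    have h2 : ∑ j, ((A j)ᴴ * A j).trace.re ≤ ∑ _j : Fin n₁, K / n₁ :=
      Finset.sum_le_sum fun j _ => by rw [aux_frob]; exact hFK j
    simp only [Finset.sum_const, Finset.card_univ, Fintype.card_fin, nsmul_eq_mul] at h2
    rw [mul_div_cancel₀ _ hN.ne'] at h2
    linarith
  have hmL : 8 / 3 * L ≤ m := by
    have h1 : 8 / 3 * c ^ 2 * n₂ * μ * Λ = 8 / 3 * (K * Λ) := by rw [hKdef]; ring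
    have h2 : L ≤ K * Λ := hΛL.trans (le_mul_of_one_le_left hΛ0 hK1)
    linarith
  have hγ0 : 0 ≤ γ := by rw [hγ]; exact Real.sqrt_nonneg _
  have hγ2 : γ ^ 2 * m / (2 * K) = 4 / 3 * Λ := by
    rw [hγ, Real.sq_sqrt (by positivity), hKdef]
    have : 0 < μ := by linarith
    field_simp
    ring
  obtain ⟨z, hz⟩ : ∃ z : Fin n₁ → ℝ, z = fun j => ∑ i, ‖b j i‖ ^ 2 := ⟨_, rfl⟩
  have hzj : ∀ j, ∑ i, ‖b j i‖ ^ 2 = z j := fun j => by rw [hz]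
  have hz0 : ∀ j, 0 ≤ z j := fun j => by rw [hz]; positivity
  have hzB : ∀ j, z j ≤ Bmax := fun j => hBmax.2 ⟨j, by rw [hz]⟩
  have hBz : B = ∑ j, z j := by rw [hB, hz]
  have hBpos : 0 < B := by
    obtain ⟨j, hj⟩ := hb
    obtain ⟨i, hi⟩ := Function.ne_iff.1 hj
    have h1 : 0 < z j := by
      rw [← hzj j]
      exact Finset.sum_pos' (fun i _ => by positivity) ⟨i, Finset.mem_univ _, by
        have : 0 < ‖b j i‖ := norm_pos_iff.2 hi
        positivity⟩
    rw [hBz]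
    exact Finset.sum_pos' (fun i _ => hz0 i) ⟨j, Finset.mem_univ _, h1⟩
  have hBle : B ≤ n₁ * Bmax := by
    rw [hBz]
    have h2 : ∑ j, z j ≤ ∑ _j : Fin n₁, Bmax := Finset.sum_le_sum fun j _ => hzB j
    simpa using h2
  obtain ⟨M, hM⟩ : ∃ M : ℝ, M = n₁ * Bmax / B - 1 := ⟨_, rfl⟩
  have hM0 : 0 ≤ M := by
    rw [hM, sub_nonneg, le_div_iff₀ hBpos]; linarith
  have hBm : Bmax = (M + 1) * B / n₁ := by rw [hM]; field_simp; ring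
  have hα' : α = Real.sqrt (2 * M / m * L) + 2 * M / (3 * m) * L := by
    have e : n₁ * Bmax - B = M * B := by rw [hM]; field_simp
    rw [hα]
    rw [show 2 * (n₁ * Bmax - B) / (m * B) = 2 * M / m by rw [mul_sub] at *; rw [hM]; field_simp,
      show 2 * (n₁ * Bmax - B) / (3 * m * B) = 2 * M / (3 * m) by rw [hM]; field_simp]
  have hmα : m * α = Real.sqrt (2 * (m * M) * L) + 2 * M * L / 3 := by
    rw [hα', mul_add]
    congr 1
    · have : 2 * (m * M) * L = (m:ℝ) ^ 2 * (2 * M / m * L) := by field_simp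
      rw [this, Real.sqrt_mul (sq_nonneg _), Real.sqrt_sq hmR.le]
    · field_simp
  have hz2 : ∑ j, z j ^ 2 ≤ Bmax * B := by
    rw [hBz, Finset.mul_sum]
    exact Finset.sum_le_sum fun j _ => by rw [pow_two]; exact mul_le_mul_of_nonneg_right (hzB j) (hz0 j)
  have hY0 : ∑ j, (z j * n₁ / B - 1) = 0 := by
    rw [Finset.sum_sub_distrib, ← Finset.sum_div, ← Finset.sum_mul, ← hBz]
    simp
    field_simp
    simp
  have hY2 : ∑ j, (z j * n₁ / B - 1) ^ 2 ≤ n₁ * M := by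
    have e : ∀ j, (z j * n₁ / B - 1) ^ 2 = (n₁ / B) ^ 2 * z j ^ 2 - 2 * (z j * n₁ / B - 1) - 1 := by
      intro j; field_simp; ring
    simp only [e]
    rw [Finset.sum_sub_distrib, Finset.sum_sub_distrib, ← Finset.mul_sum, ← Finset.mul_sum, hY0]
    have h1 : (n₁ / B) ^ 2 * ∑ j, z j ^ 2 ≤ (n₁ / B) ^ 2 * (Bmax * B) := mul_le_mul_of_nonneg_left hz2 (sq_nonneg _)
    have h2 : (n₁ / B) ^ 2 * (Bmax * B) = n₁ * (M + 1) := by rw [hBm]; field_simp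
    simp
    linarith
  obtain ⟨V, hVdef⟩ : ∃ V : ℝ, V = (K / n₁) * (B / n₁) := ⟨_, rfl⟩
  have hK0 : 0 < K := by linarith
  have hVp : 0 < V := by rw [hVdef]; positivity
  have hwz : ∀ j, ∑ l, ‖((A j)ᴴ *ᵥ b j) l‖ ^ 2 ≤ K / n₁ * z j := by
    intro j
    refine (aux_frob_mulVec (A j) (b j)).trans ?_
    rw [hzj]
    exact mul_le_mul_of_nonneg_right (hFK j) (hz0 j)
  have : Nonempty (Fin (n₂ * n₃)) := ⟨⟨0, Nat.mul_pos hn₂ hn₃⟩⟩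
  refine aux_union n₁ m hn₁ δ _
    (fun ω => ¬ AuxPSD ((∑ k, (A (ω k))ᴴ * A (ω k)) - ((1 - γ) * m / n₁) • (1 : Matrix (Fin (n₂ * n₃)) (Fin (n₂ * n₃)) ℂ)))
    (fun ω => Real.sqrt (2 * (m * M) * L) + M / 3 * L < ∑ k, (z (ω k) * n₁ / B - 1))
    (fun ω => Real.sqrt (2 * (m * M) * L) + 1 / 3 * L < ∑ k, -(z (ω k) * n₁ / B - 1))
    (fun ω => Real.sqrt (m * V) + Real.sqrt (2 * (m * V) * L) + Real.sqrt (V * (M + 1)) / 3 * L <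
      Real.sqrt (∑ i, ‖(∑ k, (A (ω k))ᴴ *ᵥ b (ω k)) i‖ ^ 2))
    ?_ ?_ ?_ ?_ ?_
  · intro ω p1 p2 p3 p4
    replace p1 := not_not.1 p1
    replace p2 := not_lt.1 p2
    replace p3 := not_lt.1 p3
    replace p4 := not_lt.1 p4
    have hg1 : 0 < 1 - γ := by linarith
    obtain ⟨hU, hq0, hgq, hqZ⟩ := aux_det m (fun k => A (ω k)) (fun k => b (ω k)) ((1 - γ) * m / n₁) (by positivity) p1
    show IsUnit (∑ k, (A (ω k))ᴴ * A (ω k)) ∧ _ ∧ _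
    refine ⟨hU, ?_⟩
    generalize hqdef : (star (∑ k, (A (ω k))ᴴ *ᵥ b (ω k)) ⬝ᵥ ((∑ k, (A (ω k))ᴴ * A (ω k))⁻¹ *ᵥ (∑ k, (A (ω k))ᴴ *ᵥ b (ω k)))).re = q at *
    simp only [hzj] at hqZ ⊢
    generalize hWdef : ∑ i, ‖(∑ k, (A (ω k))ᴴ *ᵥ b (ω k)) i‖ ^ 2 = W at *
    have hY : ∑ k, (z (ω k) * n₁ / B - 1) = (n₁ / B) * ∑ k, z (ω k) - m := by
      rw [Finset.sum_sub_distrib, Finset.mul_sum]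
      simp
      exact Finset.sum_congr rfl fun k _ => by ring
    rw [Finset.sum_neg_distrib, hY] at p3
    rw [hY] at p2
    generalize hZdef : ∑ k, z (ω k) = Z at *
    have hZ : Z = (B / n₁) * ((n₁ / B) * Z) := by field_simp
    have hBN : 0 < B / n₁ := by positivity
    constructor
    · by_cases hα1 : α < 1
      · have hnum := aux_numeric L m M K ((n₃ : ℝ) * n₂ * μ) γ α β hL hmR hM0 hK1 hKK₀ hγ0 hγ1 hmL hα' hα1 hβ
        have hT : Real.sqrt (m * V) + Real.sqrt (2 * (m * V) * L) + Real.sqrt (V * (M + 1)) / 3 * L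
            = Real.sqrt (m * V) * (1 + Real.sqrt (2 * L) + Real.sqrt ((M + 1) / m) / 3 * L) := by
          have e1 : Real.sqrt (2 * (m * V) * L) = Real.sqrt (m * V) * Real.sqrt (2 * L) := by
            rw [← Real.sqrt_mul (by positivity)]; congr 1; ring
          have e2 : Real.sqrt (V * (M + 1)) = Real.sqrt (m * V) * Real.sqrt ((M + 1) / m) := by
            rw [← Real.sqrt_mul (by positivity)]; congr 1; field_simp
          rw [e1, e2]; ring
        rw [hT] at p4
        generalize 1 + Real.sqrt (2 * L) + Real.sqrt ((M + 1) / m) / 3 * L = T at *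
        have hW0 : 0 ≤ W := by rw [← hWdef]; positivity
        have hW : W ≤ m * V * T ^ 2 := by
          have h := pow_le_pow_left₀ (Real.sqrt_nonneg _) p4 2
          rwa [Real.sq_sqrt hW0, mul_pow, Real.sq_sqrt (by positivity)] at h
        have hq : q ≤ (B / n₁) * (K * T ^ 2 / (1 - γ)) := by
          have h1 : (1 - γ) * m / n₁ * q ≤ (1 - γ) * m / n₁ * ((B / n₁) * (K * T ^ 2 / (1 - γ))) := by
            refine (hgq.trans hW).trans (le_of_eq ?_)
            rw [hVdef]; field_simp
          exact le_of_mul_le_mul_left h1 (by positivity)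
        have h3 : (B / n₁) * (m - Real.sqrt (2 * (m * M) * L) - 1 / 3 * L) ≤ Z := by
          rw [hZ]
          exact mul_le_mul_of_nonneg_left (by linarith) hBN.le
        have h4 : (m * (1 - α) - (n₃ : ℝ) * n₂ * μ * β / (1 - γ)) / n₁ * B
            = (B / n₁) * (m * (1 - α) - (n₃ : ℝ) * n₂ * μ * β / (1 - γ)) := by ring
        rw [h4]
        have h5 := mul_le_mul_of_nonneg_left hnum hBN.le
        linarith
      · push Not at hα1
        have h1 : (m * (1 - α) - (n₃ : ℝ) * n₂ * μ * β / (1 - γ)) ≤ 0 := by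
          have h2 : m * (1 - α) ≤ 0 := mul_nonpos_of_nonneg_of_nonpos hmR.le (by linarith)
          have h3 : 0 ≤ (n₃ : ℝ) * n₂ * μ * β / (1 - γ) := by
            rw [hβ]; positivity
          linarith
        have h2 : (m * (1 - α) - (n₃ : ℝ) * n₂ * μ * β / (1 - γ)) / n₁ * B ≤ 0 :=
          mul_nonpos_of_nonpos_of_nonneg (div_nonpos_of_nonpos_of_nonneg h1 hN.le) hBpos.le
        linarith
    · have h1 : (1 + α) * (m / n₁) * B = (B / n₁) * (m + m * α) := by ring
      have h2 : (n₁ / B) * Z ≤ m + m * α := by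
        rw [hmα]
        have : 0 ≤ M * L := by positivity
        linarith
      have h3 := mul_le_mul_of_nonneg_left h2 hBN.le
      rw [← hZ] at h3
      rw [h1]; linarith
  · have h := aux_matrix_chernoff' n₁ hn₁ A hA K hK1
      (fun j => by rw [aux_frob]; exact hFK j) m γ hγ0 hγ1.le
    refine h.trans (mul_le_mul_of_nonneg_left ?_ (by positivity))
    rw [hγ2, Fintype.card_fin]
    have h1 : Real.exp (-(4 / 3 * Λ)) ≤ Real.exp (-Λ) := Real.exp_le_exp.2 (by linarith)
    have h2 : Real.exp (-Λ) = δ / (2 * n₂ * n₃) := by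
      rw [hΛdef, ← Real.log_inv, Real.exp_log (by positivity), inv_div]
    rw [h2] at h1
    push_cast
    calc (n₂ * n₃ : ℝ) * Real.exp (-(4 / 3 * Λ)) ≤ (n₂ * n₃ : ℝ) * (δ / (2 * n₂ * n₃)) := by gcongr
      _ = δ / 2 := by field_simp
      _ ≤ δ := by linarith
  · have h := aux_bern_scalar n₁ m hn₁ hm (fun j => z j * n₁ / B - 1) M M L hM0
      (fun j => by
        rw [hM]
        have : z j * n₁ / B ≤ n₁ * Bmax / B := by
          rw [mul_comm]; gcongr; exact hzB j
        linarith) hY2 hY0 hL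
    rwa [hexpL] at h
  · have h := aux_bern_scalar n₁ m hn₁ hm (fun j => -(z j * n₁ / B - 1)) 1 M L zero_le_one
      (fun j => by
        have : 0 ≤ z j * n₁ / B := by have := hz0 j; positivity
        linarith) (by simpa only [neg_sq] using hY2) (by rw [Finset.sum_neg_distrib, hY0, neg_zero]) hL
    rwa [hexpL] at h
  · have h := aux_bern_coord n₁ m hn₁ hm (fun j => (A j)ᴴ *ᵥ b j) horth (Real.sqrt (V * (M + 1))) V L (Real.sqrt_nonneg _)
      (fun j => by
        rw [Real.sq_sqrt (by positivity)]
        refine (hwz j).trans ?_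
        have h1 : K / n₁ * z j ≤ K / n₁ * Bmax := mul_le_mul_of_nonneg_left (hzB j) (by positivity)
        refine h1.trans (le_of_eq ?_)
        rw [hVdef, hBm]; ring) hVp
      (by
        refine (Finset.sum_le_sum fun j _ => hwz j).trans (le_of_eq ?_)
        rw [← Finset.mul_sum, ← hBz, hVdef]; field_simp) hL
    rwa [hexpL] at h
end
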